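/- Let n ≥ 1 be an integer, κ > 0, γ = (n+2)/n and τ > 0. Let f₀ : ℝⁿ×ℝⁿ → [0,c₂] be measurable with ∬_{ℝ²ⁿ}(1+|v|²) f₀(x,v) dx dv < ∞. Then there exists a measurable f : [0,∞)×ℝⁿ×ℝⁿ → [0,c₂] with sup_{t≥0} ∬_{ℝ²ⁿ}(1+|v|²) f(t,x,v) dx dv < ∞ such that: (i) for every t ≥ 0 and almost every (x,v) ∈ ℝ²ⁿ, f(t,x,v) = e^{-t/τ} f₀(x−vt,v) + (1/τ)∫₀^t e^{−(t−s)/τ} M[f(s,x−v(t−s),·)](v) ds, where M[f(s,y,·)] denotes the Maxwellian of the velocity profile v ↦ f(s,y,v); and (ii) for every t ≥ 0 the kinetic entropy inequality holds: ∬_{ℝ²ⁿ} H(f(t,x,v),v) dx dv + (1/τ)∫₀^t ∬_{ℝ²ⁿ} [H(f(s,x,v),v) − H(M[f(s,x,·)](v),v)] dx dv ds ≤ ∬_{ℝ²ⁿ} H(f₀(x,v),v) dx dv. -/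

import Mathlib

open MeasureTheory Real

noncomputable section

abbrev En (n : ℕ) := EuclideanSpace ℝ (Fin n)

/-- the constant `c₁ = κ(n+2)` (end-point case `γ = (n+2)/n`). -/
def cc1e (n : ℕ) (κ : ℝ) : ℝ := κ * ((n : ℝ) + 2)

/-- the constant `c₂ = Γ(n/2+1)/(πκ(n+2))^{n/2}` (end-point case). -/
def cc2e (n : ℕ) (κ : ℝ) : ℝ :=
  Real.Gamma ((n : ℝ) / 2 + 1) / (Real.pi * κ * ((n : ℝ) + 2)) ^ ((n : ℝ) / 2)

/-- the end-point Maxwellian `M[ρ,u](v) = c₂ 1_{c₁ ρ^{2/n} ≥ |v-u|²}`. -/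
def MaxwE (n : ℕ) (κ ρ : ℝ) (u v : En n) : ℝ :=
  if ‖v - u‖ ^ 2 ≤ cc1e n κ * ρ ^ (2 / (n : ℝ)) then cc2e n κ else 0

/-- macroscopic density `ρ_f = ∫ f dv`. -/
def densF (n : ℕ) (f : En n → ℝ) : ℝ := ∫ v, f v

/-- bulk velocity `u_f = ρ_f⁻¹ ∫ v f dv` if `ρ_f ≠ 0`, else `0`. -/
def bulkF (n : ℕ) (f : En n → ℝ) : En n :=
  if densF n f = 0 then 0 else (densF n f)⁻¹ • ∫ v, f v • v

/-- the end-point Maxwellian `M[f] = M[ρ_f, u_f]` of a velocity profile `f`. -/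
def MaxwEOf (n : ℕ) (κ : ℝ) (f : En n → ℝ) (v : En n) : ℝ :=
  MaxwE n κ (densF n f) (bulkF n f) v

/-- kinetic entropy `H(y,v) = |v|² y / 2` (end-point case, for `0 ≤ y ≤ c₂`). -/
def kinEntE (n : ℕ) (y : ℝ) (v : En n) : ℝ := ‖v‖ ^ 2 * y / 2

open Set Filter Topology

theorem integrable_of_bounded_of_support {α : Type*} [MeasurableSpace α] {μ : Measure α}
    {f : α → ℝ} (hf : Measurable f) {S : Set α} (hS : μ S ≠ ⊤) (hz : ∀ x, f x ≠ 0 → x ∈ S)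
    {C : ℝ} (hC : ∀ x, |f x| ≤ C) : Integrable f μ := by
  rw [← integrableOn_iff_integrable_of_support_subset (s := S) (fun x hx => hz x hx)]
  exact Measure.integrableOn_of_bounded hS hf.aestronglyMeasurable (M := C)
    (Eventually.of_forall fun x => by simpa using hC x)

theorem ae_fst_ne_snd : ∀ᵐ q : ℝ × ℝ, q.1 ≠ q.2 := by
  have hm : MeasurableSet {q : ℝ × ℝ | q.1 = q.2} :=
    measurableSet_eq_fun measurable_fst measurable_snd
  have : (volume : Measure (ℝ × ℝ)) {q : ℝ × ℝ | q.1 = q.2} = 0 := by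
    rw [Measure.volume_eq_prod, Measure.measure_prod_null hm]
    refine Eventually.of_forall fun x => ?_
    have : Prod.mk x ⁻¹' {q : ℝ × ℝ | q.1 = q.2} = {x} := by
      ext y; simp [eq_comm]
    simp [this]
  rw [ae_iff]
  simpa using this

theorem norm_le_of_norm_transport_le {E : Type*} [NormedAddCommGroup E] [NormedSpace ℝ E]
    {T X R t : ℝ} (ht : t ∈ Ioc 0 T) {x v : E}
    (hx : ‖x - t • v‖ ≤ X) (hv : ‖v‖ ≤ R) : ‖x‖ ≤ X + T * R := by
  calc ‖x‖ = ‖(x - t • v) + t • v‖ := by simp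
    _ ≤ ‖x - t • v‖ + ‖t • v‖ := norm_add_le _ _
    _ ≤ X + T * R := by
      rw [norm_smul, Real.norm_eq_abs, abs_of_pos ht.1]
      have := ht.1
      gcongr
      exact ht.1.le.trans ht.2
      exact ht.2

theorem measurable_setIntegral_Ioc {α : Type*} [MeasurableSpace α] {h : ℝ × α → ℝ}
    (hm : Measurable h) (ε : ℝ) :
    Measurable fun q : ℝ × α => ∫ s in Ioc 0 (q.1 - ε), h (s, q.2) := by
  have : (fun q : ℝ × α => ∫ s in Ioc 0 (q.1 - ε), h (s, q.2)) = fun q : ℝ × α =>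
      ∫ s, {z : (ℝ × α) × ℝ | 0 < z.2 ∧ z.2 ≤ z.1.1 - ε}.indicator
        (fun z => h (z.2, z.1.2)) (q, s) := by
    ext q
    rw [← integral_indicator measurableSet_Ioc]
    rfl
  rw [this]
  refine (StronglyMeasurable.integral_prod_right' ?_).measurable
  refine (Measurable.indicator (by fun_prop) ?_).stronglyMeasurable
  exact (measurableSet_lt measurable_const measurable_snd).inter
    (measurableSet_le measurable_snd (by fun_prop))

section Transport

variable {E : Type*} [NormedAddCommGroup E] [InnerProductSpace ℝ E] [FiniteDimensional ℝ E]
  [MeasurableSpace E] [BorelSpace E]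

/-- The free transport map `(x, v) ↦ (x + t v, v)`. -/
def shear (t : ℝ) : (E × E) ≃ᵐ (E × E) where
  toFun p := (p.1 + t • p.2, p.2)
  invFun p := (p.1 - t • p.2, p.2)
  left_inv p := by simp
  right_inv p := by simp
  measurable_toFun := by
    change Measurable fun p : E × E => (p.1 + t • p.2, p.2)
    fun_prop
  measurable_invFun := by
    change Measurable fun p : E × E => (p.1 - t • p.2, p.2)
    fun_prop

theorem shear_symm_apply (t : ℝ) (p : E × E) : (shear t).symm p = (p.1 - t • p.2, p.2) := rfl

theorem measurePreserving_shear (t : ℝ) :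
    MeasurePreserving (shear t : E × E → E × E) volume volume := by
  have h1 : MeasurePreserving (fun p : E × E => (p.1, p.2 + t • p.1)) volume volume :=
    (MeasurePreserving.id volume).skew_product (g := fun a c => c + t • a) (by fun_prop)
      (Eventually.of_forall fun a => (measurePreserving_add_right volume (t • a)).map_eq)
  exact (Measure.measurePreserving_swap.comp h1).comp Measure.measurePreserving_swap

/-- The free transport map `(t, x, v) ↦ (t, x + t v, v)` on extended phase space. -/
def timeShear : (ℝ × (E × E)) ≃ᵐ (ℝ × (E × E)) where
  toFun q := (q.1, (q.2.1 + q.1 • q.2.2, q.2.2))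
  invFun q := (q.1, (q.2.1 - q.1 • q.2.2, q.2.2))
  left_inv p := by simp
  right_inv p := by simp
  measurable_toFun := by
    change Measurable fun q : ℝ × (E × E) => (q.1, (q.2.1 + q.1 • q.2.2, q.2.2))
    fun_prop
  measurable_invFun := by
    change Measurable fun q : ℝ × (E × E) => (q.1, (q.2.1 - q.1 • q.2.2, q.2.2))
    fun_prop

theorem measurePreserving_timeShear :
    MeasurePreserving (timeShear : ℝ × (E × E) → ℝ × (E × E)) volume volume :=
  (MeasurePreserving.id volume).skew_product
    (g := fun (t : ℝ) (p : E × E) => (p.1 + t • p.2, p.2)) (by fun_prop)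
    (Eventually.of_forall fun t => (measurePreserving_shear t).map_eq)

theorem integral_mul_integral_transport (t : ℝ) (r : E → ℝ) (q : E × E → ℝ)
    (hi : Integrable fun p : E × E => r (p.1 + t • p.2) * q p) :
    ∫ x, r x * ∫ v, q (x - t • v, v) = ∫ p : E × E, r (p.1 + t • p.2) * q p := by
  have hmp := (measurePreserving_shear (E := E) t).symm
  have h2 : Integrable fun p : E × E => r p.1 * q (p.1 - t • p.2, p.2) := by
    have := (hmp.integrable_comp_emb (shear t).symm.measurableEmbedding).2 hi
    refine this.congr (Eventually.of_forall fun p => ?_)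
    simp [Function.comp, shear_symm_apply]
  have h3 := hmp.integral_comp (shear t).symm.measurableEmbedding
    (fun p : E × E => r (p.1 + t • p.2) * q p)
  rw [← h3]
  simp only [shear_symm_apply, sub_add_cancel]
  rw [Measure.volume_eq_prod, integral_prod _ h2]
  simp only [integral_const_mul]

open Metric in
theorem abs_integral_le_of_support {f : E → ℝ} {C R : ℝ}
    (hC : ∀ x, |f x| ≤ C) (hz : ∀ x, f x ≠ 0 → ‖x‖ ≤ R) :
    |∫ x, f x| ≤ C * volume.real (closedBall (0 : E) R) := by
  have : ∫ x, f x = ∫ x in closedBall (0 : E) R, f x := by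
    rw [setIntegral_eq_integral_of_forall_compl_eq_zero]
    intro x hx
    by_contra h
    exact hx (by simpa using hz x h)
  rw [this, ← Real.norm_eq_abs]
  exact norm_setIntegral_le_of_norm_le_const measure_closedBall_lt_top
    (fun x _ => by simpa using hC x)

open Metric in
theorem exists_tendsto_zero_integral_sq_le {ρ : ℕ → ℝ × E → ℝ} {χ : E → ℝ} {C T X R : ℝ}
    (hm : ∀ k, Measurable (ρ k)) (hb : ∀ k q, |ρ k q| ≤ C)
    (hs : ∀ k q, ρ k q ≠ 0 → q.1 ∈ Ioc 0 T ∧ ‖q.2‖ ≤ X)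
    (hχm : Measurable χ) (hχ0 : ∀ v, 0 ≤ χ v) (hχ1 : ∀ v, χ v ≤ 1) (hχs : ∀ v, χ v ≠ 0 → ‖v‖ ≤ R)
    (ha : ∀ t ∈ Ioc 0 T, ∀ r ∈ Ioc 0 T, t ≠ r → ∀ x,
      Tendsto (fun k => ∫ v, χ v * ρ k (r, x + (r - t) • v)) atTop (𝓝 0)) :
    ∃ σ : ℕ → ℝ, Tendsto σ atTop (𝓝 0) ∧ ∀ k s,
      ∫ p : E × E, χ p.2 * (∫ t in Ici s, ρ k (t, p.1 + t • p.2)) ^ 2 ≤ σ k := by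
  have hC0 : 0 ≤ C := (abs_nonneg _).trans (hb 0 0)
  have hχa : ∀ v, |χ v| ≤ 1 := fun v => by rw [abs_of_nonneg (hχ0 v)]; exact hχ1 v
  set S : ℕ → ℝ × ℝ → ℝ := fun k q =>
    ∫ x, ρ k (q.1, x) * ∫ v, χ v * ρ k (q.2, x + (q.2 - q.1) • v) with hS
  have hSm : ∀ k, StronglyMeasurable (S k) := by
    intro k
    have h1 : StronglyMeasurable fun y : (ℝ × ℝ) × E =>
        ∫ v, χ v * ρ k (y.1.2, y.2 + (y.1.2 - y.1.1) • v) := by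
      refine StronglyMeasurable.integral_prod_right'
        (f := fun z : ((ℝ × ℝ) × E) × E =>
          χ z.2 * ρ k (z.1.1.2, z.1.2 + (z.1.1.2 - z.1.1.1) • z.2)) ?_
      have := hm k
      exact Measurable.stronglyMeasurable (by fun_prop)
    refine StronglyMeasurable.integral_prod_right'
      (f := fun y : (ℝ × ℝ) × E => ρ k (y.1.1, y.2) *
        ∫ v, χ v * ρ k (y.1.2, y.2 + (y.1.2 - y.1.1) • v)) ?_
    refine StronglyMeasurable.mul (Measurable.stronglyMeasurable ?_) h1
    have := hm k
    fun_prop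
  set A := C * volume.real (closedBall (0 : E) R) with hA
  have hinner : ∀ k (t r : ℝ) (x : E), |∫ v, χ v * ρ k (r, x + (r - t) • v)| ≤ A := by
    intro k t r x
    refine abs_integral_le_of_support (fun v => ?_) (fun v hv => hχs v (left_ne_zero_of_mul hv))
    rw [abs_mul]
    calc |χ v| * _ ≤ 1 * C := by gcongr; exacts [hχa v, hb _ _]
      _ = C := one_mul _
  have hA0 : 0 ≤ A := by positivity
  set B := C * A * volume.real (closedBall (0 : E) X) with hB
  have hB0 : 0 ≤ B := by positivity
  have hSb : ∀ k q, |S k q| ≤ B := by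
    intro k q
    refine abs_integral_le_of_support (fun x => ?_)
      (fun x hx => (hs k _ (left_ne_zero_of_mul hx)).2)
    rw [abs_mul]
    gcongr
    exacts [hb _ _, hinner _ _ _ _]
  have hS0 : ∀ k q, S k q ≠ 0 → q ∈ Ioc 0 T ×ˢ Ioc 0 T := by
    intro k q hq
    constructor
    · by_contra h
      apply hq
      have : ∀ x, ρ k (q.1, x) = 0 := fun x => by
        by_contra h'; exact h (hs k _ h').1
      simp [hS, this]
    · by_contra h
      apply hq
      have : ∀ x, ρ k (q.2, x) = 0 := fun x => by
        by_contra h'; exact h (hs k _ h').1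
      simp [hS, this]
  have hSfin : (volume : Measure (ℝ × ℝ)) (Ioc 0 T ×ˢ Ioc 0 T) ≠ ⊤ := by
    rw [Measure.volume_eq_prod, Measure.prod_prod]
    exact ENNReal.mul_ne_top measure_Ioc_lt_top.ne measure_Ioc_lt_top.ne
  have hSi : ∀ k, Integrable (S k) := fun k =>
    integrable_of_bounded_of_support (hSm k).measurable hSfin (hS0 k) (hSb k)
  refine ⟨fun k => ∫ q, |S k q|, ?_, ?_⟩
  · rw [← integral_zero (ℝ × ℝ) ℝ]
    refine tendsto_integral_of_dominated_convergence
      ((Ioc 0 T ×ˢ Ioc 0 T).indicator fun _ => B)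
      (fun k => (hSm k).measurable.abs.aestronglyMeasurable)
      ((integrable_indicator_iff (measurableSet_Ioc.prod measurableSet_Ioc)).2
        (integrableOn_const hSfin)) ?_ ?_
    · refine fun k => Eventually.of_forall fun q => ?_
      by_cases hq : q ∈ Ioc 0 T ×ˢ Ioc 0 T
      · simpa [indicator_of_mem hq] using hSb k q
      · have : S k q = 0 := by by_contra h; exact hq (hS0 k q h)
        simp [this, indicator_of_notMem hq]
    · filter_upwards [ae_fst_ne_snd] with q hq
      by_cases hqm : q ∈ Ioc 0 T ×ˢ Ioc 0 T
      swap
      · have : ∀ k, S k q = 0 := fun k => by by_contra h; exact hqm (hS0 k q h)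
        simp [this]
      have : Tendsto (fun k => S k q) atTop (𝓝 0) := by
        rw [← integral_zero E ℝ]
        refine tendsto_integral_of_dominated_convergence
          ((closedBall (0 : E) X).indicator fun _ => C * A) (fun k => ?_)
          ((integrable_indicator_iff measurableSet_closedBall).2
            (integrableOn_const measure_closedBall_lt_top.ne)) ?_ ?_
        · have := hm k
          refine (StronglyMeasurable.mul (Measurable.stronglyMeasurable (by fun_prop))
            ?_).aestronglyMeasurable
          refine StronglyMeasurable.integral_prod_right'
            (f := fun z : E × E => χ z.2 * ρ k (q.2, z.1 + (q.2 - q.1) • z.2)) ?_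
          exact Measurable.stronglyMeasurable (by fun_prop)
        · refine fun k => Eventually.of_forall fun x => ?_
          by_cases hx : x ∈ closedBall (0 : E) X
          · rw [indicator_of_mem hx, norm_mul]
            simp only [Real.norm_eq_abs]
            gcongr
            exacts [hb _ _, hinner _ _ _ _]
          · have : ρ k (q.1, x) = 0 := by
              by_contra h; exact hx (by simpa using (hs k _ h).2)
            simp [this, indicator_of_notMem hx]
        · refine Eventually.of_forall fun x => ?_
          refine squeeze_zero_norm (a := fun k => C * |∫ v, χ v * ρ k (q.2, x + (q.2 - q.1) • v)|)
            (fun k => ?_) ?_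
          · rw [norm_mul]
            simp only [Real.norm_eq_abs]
            gcongr
            exact hb _ _
          · simpa using ((ha q.1 hqm.1 q.2 hqm.2 hq x).abs.const_mul C)
      simpa using this.abs
  · intro k s
    have hmk := hm k
    let ν := (volume.restrict (Ici s)).prod (volume.restrict (Ici s))
    let Φ : E × E → ℝ × ℝ → ℝ := fun p q =>
      χ p.2 * (ρ k (q.1, p.1 + q.1 • p.2) * ρ k (q.2, p.1 + q.2 • p.2))
    have hΦb : ∀ p q, |Φ p q| ≤ C * C := by
      intro p q
      simp only [Φ, abs_mul]
      calc |χ p.2| * (_ * _) ≤ 1 * (C * C) := by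
            gcongr; exacts [hχa _, hb _ _, hb _ _]
        _ = _ := one_mul _
    have hΦs : ∀ p q, Φ p q ≠ 0 →
        p ∈ closedBall (0 : E) (X + T * R) ×ˢ closedBall (0 : E) R ∧
          q ∈ Ioc 0 T ×ˢ Ioc 0 T := by
      intro p q h
      have h1 := hχs _ (left_ne_zero_of_mul h)
      have h2 := hs k _ (left_ne_zero_of_mul (right_ne_zero_of_mul h))
      have h3 := hs k _ (right_ne_zero_of_mul (right_ne_zero_of_mul h))
      refine ⟨⟨?_, by simpa using h1⟩, h2.1, h3.1⟩
      simp only [mem_closedBall, dist_zero_right]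
      have ht := h2.1
      calc ‖p.1‖ = ‖(p.1 + q.1 • p.2) - q.1 • p.2‖ := by simp
        _ ≤ ‖p.1 + q.1 • p.2‖ + ‖q.1 • p.2‖ := norm_sub_le _ _
        _ ≤ X + T * R := by
          rw [norm_smul, Real.norm_eq_abs, abs_of_pos ht.1]
          have h21 := h2.2
          have := ht.1
          gcongr
          exact ht.1.le.trans ht.2
          exact ht.2
    have hballs : (volume : Measure (E × E))
        (closedBall (0 : E) (X + T * R) ×ˢ closedBall (0 : E) R) ≠ ⊤ := by
      rw [Measure.volume_eq_prod, Measure.prod_prod]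
      exact ENNReal.mul_ne_top measure_closedBall_lt_top.ne measure_closedBall_lt_top.ne
    have hνfin : ν (Ioc 0 T ×ˢ Ioc 0 T) ≠ ⊤ := by
      rw [Measure.prod_prod]
      exact ENNReal.mul_ne_top
        ((Measure.restrict_apply_le _ _).trans_lt measure_Ioc_lt_top).ne
        ((Measure.restrict_apply_le _ _).trans_lt measure_Ioc_lt_top).ne
    have hΦi : Integrable (Function.uncurry Φ) (volume.prod ν) := by
      refine integrable_of_bounded_of_support (C := C * C)
        (S := (closedBall (0 : E) (X + T * R) ×ˢ closedBall (0 : E) R) ×ˢ (Ioc 0 T ×ˢ Ioc 0 T))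
        ?_ ?_ ?_ ?_
      · simp only [Φ, Function.uncurry_def]
        fun_prop
      · rw [Measure.prod_prod]
        exact ENNReal.mul_ne_top hballs hνfin
      · exact fun x hx => hΦs x.1 x.2 hx
      · exact fun x => hΦb x.1 x.2
    have e1 : ∀ p : E × E, χ p.2 * (∫ t in Ici s, ρ k (t, p.1 + t • p.2)) ^ 2 = ∫ q, Φ p q ∂ν := by
      intro p
      simp only [Φ, integral_const_mul]
      congr 1
      rw [sq]
      exact (integral_prod_mul (fun t => ρ k (t, p.1 + t • p.2))
        (fun t => ρ k (t, p.1 + t • p.2))).symm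
    have e2 : ∀ q : ℝ × ℝ, ∫ p, Φ p q = S k q := by
      intro q
      have hi : Integrable fun p : E × E =>
          ρ k (q.1, p.1 + q.1 • p.2) * (χ p.2 * ρ k (q.2, p.1 + q.2 • p.2)) := by
        have : Integrable fun p : E × E => Φ p q := by
          refine integrable_of_bounded_of_support (C := C * C)
            (S := (closedBall (0 : E) (X + T * R) ×ˢ closedBall (0 : E) R)) ?_ hballs ?_ ?_
          · simp only [Φ]
            fun_prop
          · exact fun x hx => (hΦs x q hx).1
          · exact fun x => hΦb x q
        refine this.congr (Eventually.of_forall fun p => ?_)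
        simp only [Φ]; ring
      have := integral_mul_integral_transport q.1 (fun x => ρ k (q.1, x))
        (fun p => χ p.2 * ρ k (q.2, p.1 + q.2 • p.2)) hi
      simp only [hS, Φ]
      calc _ = ∫ p : E × E, ρ k (q.1, p.1 + q.1 • p.2) * (χ p.2 * ρ k (q.2, p.1 + q.2 • p.2)) := by
            refine integral_congr_ae (Eventually.of_forall fun p => ?_)
            dsimp only; ring
        _ = _ := this.symm
        _ = _ := by
            have : ∀ (x v : E), x - q.1 • v + q.2 • v = x + (q.2 - q.1) • v := fun x v => by
              rw [sub_smul]; abel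
            simp only [this]
    calc ∫ p : E × E, χ p.2 * (∫ t in Ici s, ρ k (t, p.1 + t • p.2)) ^ 2
        = ∫ p, ∫ q, Φ p q ∂ν := by simp only [e1]
      _ = ∫ q, (∫ p, Φ p q) ∂ν := integral_integral_swap hΦi
      _ = ∫ q, S k q ∂ν := by simp only [e2]
      _ ≤ ∫ q, |S k q| ∂ν := by
          refine (le_abs_self _).trans ?_
          exact abs_integral_le_integral_abs
      _ ≤ ∫ q, |S k q| := by
          have : ν = (volume : Measure (ℝ × ℝ)).restrict (Ici s ×ˢ Ici s) := by
            simp only [ν, Measure.volume_eq_prod, Measure.prod_restrict]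
          rw [this]
          exact setIntegral_le_integral (hSi k).abs (Eventually.of_forall fun q => abs_nonneg _)

open Metric in
theorem integral_mul_integral_comp_smul {χ : E → ℝ} {P : E × E → ℝ} {A R : ℝ} {c r : ℝ}
    (hc : c ≠ 0) (hχm : Measurable χ) (hχ1 : ∀ v, |χ v| ≤ 1) (hχs : ∀ v, χ v ≠ 0 → ‖v‖ ≤ R)
    (hPm : Measurable P) (hPb : ∀ p, |P p| ≤ A) (hPs : ∀ p, P p ≠ 0 → p ∈ closedBall 0 R) (x : E) :
    ∫ v, χ v * ∫ w, P (x + c • v - r • w, w) =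
      |(c ^ Module.finrank ℝ E)⁻¹| * ∫ p : E × E, χ (c⁻¹ • (p.1 - x + r • p.2)) * P p := by
  have hA : 0 ≤ A := (abs_nonneg _).trans (hPb 0)
  have hball : (volume : Measure (E × E)) (closedBall 0 R) ≠ ⊤ :=
    measure_closedBall_lt_top.ne
  have hball' : (volume.prod volume : Measure (E × E)) (closedBall 0 R) ≠ ⊤ := hball
  have hi : Integrable (Function.uncurry fun v w => χ v * P (x + c • v - r • w, w))
      ((volume : Measure E).prod volume) := by
    refine integrable_of_bounded_of_support (C := 1 * A) (S := closedBall 0 R)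
      (by simp only [Function.uncurry_def]; fun_prop) hball' ?_ ?_
    · rintro ⟨v, w⟩ h
      have h1 := hχs _ (left_ne_zero_of_mul h)
      have h2 := hPs _ (right_ne_zero_of_mul h)
      simp only [mem_closedBall, dist_zero_right, Prod.norm_def, sup_le_iff] at h2 ⊢
      exact ⟨h1, h2.2⟩
    · rintro ⟨v, w⟩
      simp only [Function.uncurry, abs_mul]
      gcongr
      exacts [hχ1 _, hPb _]
  have hi2 : Integrable fun p : E × E => χ (c⁻¹ • (p.1 - x + r • p.2)) * P p := by
    refine integrable_of_bounded_of_support (C := 1 * A) (S := closedBall 0 R)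
      (by fun_prop) hball (fun p h => hPs _ (right_ne_zero_of_mul h)) ?_
    intro p
    rw [abs_mul]
    gcongr
    exacts [hχ1 _, hPb _]
  simp only [← integral_const_mul]
  rw [integral_integral_swap hi, integral_const_mul, Measure.volume_eq_prod,
    integral_prod_symm _ hi2, ← integral_const_mul]
  congr 1
  ext w
  have h1 := Measure.integral_comp_smul (volume : Measure E)
    (fun z => χ (c⁻¹ • z) * P (x + z - r • w, w)) c
  simp only [smul_smul, inv_mul_cancel₀ hc, one_smul, smul_eq_mul] at h1
  rw [h1]
  congr 1
  have h2 := integral_add_right_eq_self (μ := (volume : Measure E))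
    (fun z => χ (c⁻¹ • (z - x + r • w)) * P (z, w)) (x - r • w)
  rw [← h2]
  congr 1
  ext z
  congr 3
  · abel
  · abel

open Metric in
/-- Velocity averaging: if the sources `h k` tend weakly to zero, the velocity averages of
the corresponding solutions of the free transport equation tend strongly to zero. -/
theorem tendsto_integral_sq_velocity_average {h : ℕ → ℝ × (E × E) → ℝ} {C T R : ℝ} (hT : 0 ≤ T)
    (hm : ∀ k, Measurable (h k)) (hb : ∀ k q, |h k q| ≤ C)
    (hs : ∀ k q, h k q ≠ 0 → q.1 ∈ Ioc 0 T ∧ q.2 ∈ closedBall 0 R)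
    (hw : ∀ t ∈ Ioc 0 T, ∀ ψ : E × E → ℝ, Measurable ψ → (∀ p, |ψ p| ≤ 1) →
      Tendsto (fun k => ∫ q, (Ioc 0 t).indicator 1 q.1 * ψ q.2 * h k q) atTop (𝓝 0)) :
    Tendsto (fun k => ∫ q : ℝ × E, ((Ioc 0 T).indicator 1 q.1 *
      ∫ v, ∫ s in Ioc 0 q.1, h k (s, (q.2 - q.1 • v, v))) ^ 2) atTop (𝓝 0) := by
  have hC0 : 0 ≤ C := (abs_nonneg _).trans (hb 0 0)
  set P : ℕ → ℝ × (E × E) → ℝ := fun k q => ∫ s in Ioc 0 q.1, h k (s, q.2) with hP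
  have hPm : ∀ k, Measurable (P k) := fun k => by
    simpa using measurable_setIntegral_Ioc (hm k) 0
  have hPb : ∀ k q, |P k q| ≤ C * T := by
    intro k q
    have : P k q = ∫ s in Ioc 0 q.1 ∩ Ioc 0 T, h k (s, q.2) := by
      refine setIntegral_eq_of_subset_of_forall_sdiff_eq_zero measurableSet_Ioc
        inter_subset_left (fun s hs' => ?_)
      by_contra h'; exact hs'.2 ⟨hs'.1, (hs k _ h').1⟩
    rw [this, ← Real.norm_eq_abs]
    refine (norm_setIntegral_le_of_norm_le_const (C := C)
      ((measure_mono inter_subset_right).trans_lt measure_Ioc_lt_top)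
      (fun s _ => by simpa using hb k _)).trans ?_
    gcongr
    refine (measureReal_mono inter_subset_right measure_Ioc_lt_top.ne).trans ?_
    simp [hT]
  have hPs : ∀ k q, P k q ≠ 0 → q.2 ∈ closedBall 0 R := by
    intro k q hq
    by_contra h'
    apply hq
    have : ∀ s, h k (s, q.2) = 0 := fun s => by
      by_contra h''; exact h' (hs k _ h'').2
    simp [hP, this]
  set ρ : ℕ → ℝ × E → ℝ := fun k q => (Ioc 0 T).indicator 1 q.1 *
      ∫ v, P k (q.1, (q.2 - q.1 • v, v)) with hρ
  have hρm : ∀ k, Measurable (ρ k) := by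
    intro k
    have := hPm k
    refine Measurable.mul ?_ (StronglyMeasurable.integral_prod_right'
      (f := fun z : (ℝ × E) × E => P k (z.1.1, (z.1.2 - z.1.1 • z.2, z.2)))
      (Measurable.stronglyMeasurable (by fun_prop))).measurable
    exact (measurable_one.indicator measurableSet_Ioc).comp measurable_fst
  set A := C * T * volume.real (closedBall (0 : E) R) with hA
  have hind : ∀ t : ℝ, |(Ioc 0 T).indicator (1 : ℝ → ℝ) t| ≤ 1 := by
    intro t
    by_cases ht : t ∈ Ioc 0 T <;> simp [ht]
  have hρb : ∀ k q, |ρ k q| ≤ A := by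
    intro k q
    rw [hρ, abs_mul]
    have h2 : |∫ v, P k (q.1, (q.2 - q.1 • v, v))| ≤ A := by
      refine abs_integral_le_of_support (fun v => hPb k _) (fun v hv => ?_)
      have := hPs k _ hv
      simp only [mem_closedBall, dist_zero_right, Prod.norm_def, sup_le_iff] at this
      exact this.2
    calc _ ≤ 1 * A := by gcongr; exact hind _
      _ = A := one_mul _
  have hA0 : 0 ≤ A := by positivity
  set X := R + T * R with hX
  have hρs : ∀ k q, ρ k q ≠ 0 → q.1 ∈ Ioc 0 T ∧ ‖q.2‖ ≤ X := by
    intro k q hq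
    have h1 : q.1 ∈ Ioc 0 T := by
      by_contra h'
      exact left_ne_zero_of_mul hq (by simp [h'])
    refine ⟨h1, ?_⟩
    by_contra h'
    apply right_ne_zero_of_mul hq
    have : ∀ v, P k (q.1, (q.2 - q.1 • v, v)) = 0 := fun v => by
      by_contra h''
      have := hPs k _ h''
      simp only [mem_closedBall, dist_zero_right, Prod.norm_def, sup_le_iff] at this
      exact h' (norm_le_of_norm_transport_le h1 this.1 this.2)
    simp [this]
  set χ : E → ℝ := (closedBall 0 R).indicator 1 with hχ
  have hχm : Measurable χ := measurable_one.indicator measurableSet_closedBall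
  have hχ01 : ∀ v, χ v = 0 ∧ ¬ ‖v‖ ≤ R ∨ χ v = 1 ∧ ‖v‖ ≤ R := by
    intro v
    by_cases hv : ‖v‖ ≤ R <;> simp [hχ, hv]
  have hχs : ∀ v, χ v ≠ 0 → ‖v‖ ≤ R := by
    intro v hv; rcases hχ01 v with h' | h'; exacts [(hv h'.1).elim, h'.2]
  have hχa : ∀ v, |χ v| ≤ 1 := by
    intro v; rcases hχ01 v with h' | h' <;> simp [h'.1]
  have hχ0 : ∀ v, 0 ≤ χ v := by
    intro v; rcases hχ01 v with h' | h' <;> simp [h'.1]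
  have hballs : (volume : Measure (E × E)) (closedBall 0 R) ≠ ⊤ :=
    measure_closedBall_lt_top.ne
  have hhi : ∀ k (φ : ℝ × (E × E) → ℝ), Measurable φ → (∀ q, |φ q| ≤ 1) →
      Integrable fun q => φ q * h k q := by
    intro k φ hφ hφ1
    have := hm k
    refine integrable_of_bounded_of_support (C := 1 * C)
      (S := Ioc 0 T ×ˢ closedBall (0 : E × E) R) (by fun_prop) ?_ ?_ ?_
    · rw [Measure.volume_eq_prod, Measure.prod_prod]
      exact ENNReal.mul_ne_top measure_Ioc_lt_top.ne hballs
    · exact fun q hq => hs k q (right_ne_zero_of_mul hq)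
    · intro q
      rw [abs_mul]
      gcongr
      exacts [hφ1 q, hb k q]
  obtain ⟨σ, hσ0, hσ⟩ := exists_tendsto_zero_integral_sq_le hρm hρb hρs hχm hχ0
    (fun v => (le_abs_self _).trans (hχa v)) hχs (by
      intro t ht r hr htr x
      have h1 : ∀ k, ∫ v, χ v * ρ k (r, x + (r - t) • v) =
          |((r - t) ^ Module.finrank ℝ E)⁻¹| * ∫ q, (Ioc 0 r).indicator 1 q.1 *
            χ ((r - t)⁻¹ • (q.2.1 - x + r • q.2.2)) * h k q := by
        intro k
        have e := integral_mul_integral_comp_smul (r := r) (sub_ne_zero.2 htr.symm) hχm hχa hχs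
          (P := fun p => P k (r, p)) (A := C * T) (by have := hPm k; fun_prop) (fun p => hPb k _)
          (fun p hp => hPs k _ hp) x
        simp only [hρ, indicator_of_mem hr, Pi.one_apply, one_mul]
        rw [e]
        congr 1
        have hi := hhi k (fun q => (Ioc 0 r).indicator 1 q.1 *
          χ ((r - t)⁻¹ • (q.2.1 - x + r • q.2.2))) ?_ ?_
        · rw [Measure.volume_eq_prod ℝ (E × E), integral_prod_symm _ hi]
          congr 1
          ext p
          simp only [hP]
          rw [← integral_indicator measurableSet_Ioc, ← integral_const_mul]
          congr 1
          ext s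
          by_cases hs' : s ∈ Ioc 0 r <;> simp [hs']
        · refine Measurable.mul ?_ (by fun_prop)
          exact (measurable_one.indicator measurableSet_Ioc).comp measurable_fst
        · intro q
          rw [abs_mul]
          refine mul_le_one₀ ?_ (abs_nonneg _) (hχa _)
          by_cases hs' : q.1 ∈ Ioc 0 r <;> simp [hs']
      simp only [h1]
      simpa using (hw r hr (fun p => χ ((r - t)⁻¹ • (p.1 - x + r • p.2))) (by fun_prop)
        (fun p => hχa _)).const_mul _)
  have hσnn : ∀ k, 0 ≤ σ k := fun k => le_trans
    (integral_nonneg fun p => mul_nonneg (hχ0 _) (sq_nonneg _)) (hσ k 0)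
  set V := volume.real (closedBall (0 : E × E) R) with hV
  -- the duality identity
  have key : ∀ k, ∫ q : ℝ × E, ρ k q ^ 2 =
      ∫ q : ℝ × (E × E), h k q * ∫ t in Ici q.1, ρ k (t, q.2.1 + t • q.2.2) := by
    intro k
    have hmk := hm k
    have hρk := hρm k
    have hPk := hPm k
    let Θ : ℝ → ℝ × (E × E) → ℝ := fun t q =>
      (Ici q.1).indicator 1 t * (h k q * ρ k (t, q.2.1 + t • q.2.2))
    have hΘm : Measurable (Function.uncurry Θ) := by
      refine Measurable.mul ?_ (by fun_prop)
      change Measurable fun z : ℝ × (ℝ × (E × E)) => (Ici z.2.1).indicator (1 : ℝ → ℝ) z.1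
      have : (fun z : ℝ × (ℝ × (E × E)) => (Ici z.2.1).indicator (1 : ℝ → ℝ) z.1) =
          {z : ℝ × (ℝ × (E × E)) | z.2.1 ≤ z.1}.indicator 1 := rfl
      rw [this]
      exact measurable_one.indicator (measurableSet_le (by fun_prop) (by fun_prop))
    have hΘi : Integrable (Function.uncurry Θ) (volume.prod volume) := by
      refine integrable_of_bounded_of_support (C := 1 * (C * A))
        (S := Ioc 0 T ×ˢ (Ioc 0 T ×ˢ closedBall (0 : E × E) R)) hΘm ?_ ?_ ?_
      · rw [Measure.prod_prod, Measure.volume_eq_prod, Measure.prod_prod]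
        exact ENNReal.mul_ne_top measure_Ioc_lt_top.ne
          (ENNReal.mul_ne_top measure_Ioc_lt_top.ne hballs)
      · intro z hz
        have h2 := right_ne_zero_of_mul hz
        exact ⟨(hρs k _ (right_ne_zero_of_mul h2)).1, hs k _ (left_ne_zero_of_mul h2)⟩
      · intro z
        simp only [Function.uncurry, Θ, abs_mul]
        gcongr
        · by_cases hz : z.1 ∈ Ici z.2.1
          · rw [indicator_of_mem hz]; simp
          · rw [indicator_of_notMem hz]; simp
        · exact hb k _
        · exact hρb k _
    have hρ2i : Integrable fun q => ρ k q ^ 2 := by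
      refine integrable_of_bounded_of_support (C := A ^ 2)
        (S := Ioc 0 T ×ˢ closedBall (0 : E) X) (by fun_prop) ?_ ?_ ?_
      · rw [Measure.volume_eq_prod, Measure.prod_prod]
        exact ENNReal.mul_ne_top measure_Ioc_lt_top.ne measure_closedBall_lt_top.ne
      · intro q hq
        have := hρs k q (by simpa using hq)
        exact ⟨this.1, by simpa using this.2⟩
      · intro q
        rw [abs_pow]
        gcongr
        exact hρb k q
    rw [Measure.volume_eq_prod, integral_prod _ hρ2i]
    have lhs : ∀ t, ∫ x, ρ k (t, x) ^ 2 = ∫ q, Θ t q := by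
      intro t
      by_cases ht : t ∈ Ioc 0 T
      swap
      · have : ∀ x, ρ k (t, x) = 0 := fun x => by
          by_contra h'; exact ht (hρs k _ h').1
        simp [Θ, this]
      have e1 : ∀ x, ρ k (t, x) ^ 2 = ρ k (t, x) * ∫ v, P k (t, (x - t • v, v)) := by
        intro x
        rw [sq]
        conv_lhs => rw [hρ]
        simp [ht, hρ]
      simp only [e1]
      have hi := integral_mul_integral_transport t (fun x => ρ k (t, x)) (fun p => P k (t, p)) ?_
      · rw [hi, Measure.volume_eq_prod ℝ (E × E), integral_prod_symm]
        · congr 1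
          ext p
          simp only [hP]
          rw [← integral_indicator measurableSet_Ioc, ← integral_const_mul]
          congr 1
          ext s
          simp only [Θ]
          by_cases hst : s ≤ t
          · by_cases hs0 : 0 < s
            · simp [hst, hs0]; ring
            · have : h k (s, p) = 0 := by
                by_contra h'; exact hs0 (hs k _ h').1.1
              simp [this, indicator]
          · simp [hst]
        · have := hhi k (fun q => (Ici q.1).indicator 1 t * (ρ k (t, q.2.1 + t • q.2.2) / (A + 1)))
            ?_ ?_
          · refine (this.const_mul (A + 1)).congr (Eventually.of_forall fun q => ?_)
            simp only [Θ]
            have : A + 1 ≠ 0 := by positivity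
            field_simp
          · refine Measurable.mul ?_ (by fun_prop)
            change Measurable fun z : ℝ × (E × E) => (Ici z.1).indicator (1 : ℝ → ℝ) t
            have : (fun z : ℝ × (E × E) => (Ici z.1).indicator (1 : ℝ → ℝ) t) =
              {z : ℝ × (E × E) | z.1 ≤ t}.indicator 1 := rfl
            rw [this]
            exact measurable_one.indicator (measurableSet_le (by fun_prop) (by fun_prop))
          · intro q
            rw [abs_mul]
            refine mul_le_one₀ ?_ (abs_nonneg _) ?_
            · by_cases hs' : t ∈ Ici q.1
              · rw [indicator_of_mem hs']; simp
              · rw [indicator_of_notMem hs']; simp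
            · rw [abs_div, abs_of_pos (by positivity : 0 < A + 1), div_le_one (by positivity)]
              linarith [hρb k (t, q.2.1 + t • q.2.2)]
      · refine integrable_of_bounded_of_support (C := A * (C * T))
          (S := closedBall (0 : E × E) R) (by fun_prop) hballs ?_ ?_
        · exact fun p hp => hPs k _ (right_ne_zero_of_mul hp)
        · intro p
          rw [abs_mul]
          gcongr
          exacts [hρb k _, hPb k _]
    simp only [lhs]
    rw [integral_integral_swap hΘi]
    congr 1
    ext q
    rw [← integral_indicator measurableSet_Ici, ← integral_const_mul]
    congr 1
    ext t
    simp only [Θ]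
    by_cases hqt : t ∈ Ici q.1
    · rw [indicator_of_mem hqt, indicator_of_mem hqt]; simp
    · rw [indicator_of_notMem hqt, indicator_of_notMem hqt]; simp
  set D : ℕ → ℝ × (E × E) → ℝ := fun k q => ∫ t in Ici q.1, ρ k (t, q.2.1 + t • q.2.2) with hD
  have hDm : ∀ k, Measurable (D k) := by
    intro k
    have hρk := hρm k
    have : D k = fun q => ∫ t, {z : (ℝ × (E × E)) × ℝ | z.1.1 ≤ z.2}.indicator
        (fun z => ρ k (z.2, z.1.2.1 + z.2 • z.1.2.2)) (q, t) := by
      ext q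
      simp only [hD]
      rw [← integral_indicator measurableSet_Ici]
      rfl
    rw [this]
    refine (StronglyMeasurable.integral_prod_right' ?_).measurable
    refine (Measurable.indicator (by fun_prop) ?_).stronglyMeasurable
    exact measurableSet_le (by fun_prop) measurable_snd
  have hDb : ∀ k q, |D k q| ≤ A * T := by
    intro k q
    have : D k q = ∫ t in Ici q.1 ∩ Ioc 0 T, ρ k (t, q.2.1 + t • q.2.2) := by
      refine setIntegral_eq_of_subset_of_forall_sdiff_eq_zero measurableSet_Ici
        inter_subset_left (fun s hs' => ?_)
      by_contra h'; exact hs'.2 ⟨hs'.1, (hρs k _ h').1⟩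
    rw [this, ← Real.norm_eq_abs]
    refine (norm_setIntegral_le_of_norm_le_const (C := A)
      ((measure_mono inter_subset_right).trans_lt measure_Ioc_lt_top)
      (fun s _ => by simpa using hρb k _)).trans ?_
    gcongr
    refine (measureReal_mono inter_subset_right measure_Ioc_lt_top.ne).trans ?_
    simp [hT]
  have hDs : ∀ k q, D k q ≠ 0 → ‖q.2.2‖ ≤ R → ‖q.2.1‖ ≤ X + T * R := by
    intro k q hq hR'
    by_contra h'
    apply hq
    have : ∀ t, ρ k (t, q.2.1 + t • q.2.2) = 0 := fun t => by
      by_contra h''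
      have h3 := hρs k _ h''
      refine h' (norm_le_of_norm_transport_le (v := -q.2.2) h3.1 ?_ (by simpa using hR'))
      simpa using h3.2
    simp [hD, this]
  have hV0 : 0 ≤ V := measureReal_nonneg
  have bound : ∀ k (c : ℝ), 0 < c →
      ∫ q : ℝ × E, ρ k q ^ 2 ≤ T * (C * (σ k / (2 * c) + c / 2 * V)) := by
    intro k c hc
    have hDk := hDm k
    have hmk := hm k
    set ζ : E × E → ℝ := (closedBall 0 R).indicator 1 with hζ
    have hζm : Measurable ζ := measurable_one.indicator measurableSet_closedBall
    have hζ01 : ∀ p, ζ p = 0 ∧ p ∉ closedBall 0 R ∨ ζ p = 1 ∧ p ∈ closedBall 0 R := by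
      intro p
      by_cases hp : p ∈ closedBall 0 R
      · exact Or.inr ⟨by rw [hζ, indicator_of_mem hp]; rfl, hp⟩
      · exact Or.inl ⟨by rw [hζ, indicator_of_notMem hp], hp⟩
    have hζs : ∀ p, ζ p ≠ 0 → p ∈ closedBall 0 R := by
      intro p hp; rcases hζ01 p with h' | h'; exacts [(hp h'.1).elim, h'.2]
    let W : ℝ × (E × E) → ℝ := fun q => (Ioc 0 T).indicator 1 q.1 *
      (C * (ζ q.2 * D k q ^ 2 / (2 * c) + c / 2 * ζ q.2))
    have hpt : ∀ s p, |ζ p * D k (s, p) ^ 2 / (2 * c) + c / 2 * ζ p| ≤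
        (A * T) ^ 2 / (2 * c) + c / 2 := by
      intro s p
      have : D k (s, p) ^ 2 ≤ (A * T) ^ 2 := by
        rw [← sq_abs]; gcongr; exact hDb k _
      rcases hζ01 p with h' | h' <;> rw [h'.1]
      · simp; positivity
      · rw [abs_of_nonneg (by positivity)]
        simp only [one_mul, mul_one]
        gcongr
    have hWi : Integrable W := by
      refine integrable_of_bounded_of_support
        (C := 1 * (C * ((A * T) ^ 2 / (2 * c) + c / 2)))
        (S := Ioc 0 T ×ˢ closedBall (0 : E × E) R) ?_ ?_ ?_ ?_
      · refine Measurable.mul ?_ (by fun_prop)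
        exact (measurable_one.indicator measurableSet_Ioc).comp measurable_fst
      · rw [Measure.volume_eq_prod, Measure.prod_prod]
        exact ENNReal.mul_ne_top measure_Ioc_lt_top.ne hballs
      · intro q hq
        refine ⟨?_, hζs _ fun h0 => hq (by simp [W, h0])⟩
        by_contra h'; exact hq (by simp only [W]; rw [indicator_of_notMem h']; simp)
      · intro q
        simp only [W, abs_mul]
        rw [abs_of_nonneg hC0]
        gcongr
        exacts [hind _, hpt _ _]
    rw [key]
    have hdom : ∀ q, h k q * D k q ≤ W q := by
      intro q
      by_cases hq : h k q = 0
      · rw [hq, zero_mul]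
        simp only [W]
        refine mul_nonneg (indicator_nonneg (fun _ _ => zero_le_one) _) ?_
        rcases hζ01 q.2 with h' | h' <;> rw [h'.1]
        · simp
        · positivity
      · have hq' := hs k q hq
        have h1 : ζ q.2 = 1 := by
          rcases hζ01 q.2 with h' | h'; exacts [(h'.2 hq'.2).elim, h'.1]
        simp only [W, indicator_of_mem hq'.1, h1, Pi.one_apply, one_mul, mul_one]
        have h2 : |D k q| ≤ D k q ^ 2 / (2 * c) + c / 2 := by
          rw [div_add_div _ _ (by positivity) (by positivity), le_div_iff₀ (by positivity)]
          nlinarith [sq_nonneg (|D k q| - c), sq_abs (D k q)]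
        calc h k q * D k q ≤ |h k q| * |D k q| := by
              rw [← abs_mul]; exact le_abs_self _
          _ ≤ _ := by gcongr; exact hb k q
    have hhDi : Integrable fun q => h k q * D k q := by
      refine integrable_of_bounded_of_support (C := C * (A * T))
        (S := Ioc 0 T ×ˢ closedBall (0 : E × E) R) (by fun_prop) ?_ ?_ ?_
      · rw [Measure.volume_eq_prod, Measure.prod_prod]
        exact ENNReal.mul_ne_top measure_Ioc_lt_top.ne hballs
      · exact fun q hq => hs k q (left_ne_zero_of_mul hq)
      · intro q
        rw [abs_mul]
        gcongr
        exacts [hb k q, hDb k q]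
    have hinner : ∀ s, ∫ p, ζ p * D k (s, p) ^ 2 / (2 * c) + c / 2 * ζ p ≤
        σ k / (2 * c) + c / 2 * V := by
      intro s
      have i1 : Integrable fun p => ζ p * D k (s, p) ^ 2 := by
        refine integrable_of_bounded_of_support (C := 1 * (A * T) ^ 2)
          (S := closedBall (0 : E × E) R) (by fun_prop) hballs
          (fun p hp => hζs _ (left_ne_zero_of_mul hp)) ?_
        intro p
        rw [abs_mul, abs_pow]
        gcongr
        · rcases hζ01 p with h' | h' <;> simp [h'.1]
        · exact hDb k _
      have i2 : Integrable fun p => χ p.2 * D k (s, p) ^ 2 := by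
        refine integrable_of_bounded_of_support (C := 1 * (A * T) ^ 2)
          (S := closedBall (0 : E) (X + T * R) ×ˢ closedBall (0 : E) R) (by fun_prop) ?_ ?_ ?_
        · rw [Measure.volume_eq_prod, Measure.prod_prod]
          exact ENNReal.mul_ne_top measure_closedBall_lt_top.ne measure_closedBall_lt_top.ne
        · intro p hp
          have h1 := hχs _ (left_ne_zero_of_mul hp)
          have h2 := hDs k (s, p) (fun h0 => hp (by simp [h0])) h1
          exact ⟨by simpa using h2, by simpa using h1⟩
        · intro p
          rw [abs_mul, abs_pow]
          gcongr
          exacts [hχa _, hDb k _]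
      have i3 : Integrable ζ := (integrable_indicator_iff measurableSet_closedBall).2
        (integrableOn_const hballs)
      rw [integral_add (i1.div_const _) (i3.const_mul _), integral_div, integral_const_mul]
      gcongr
      · refine (integral_mono i1 i2 fun p => ?_).trans (hσ k s)
        dsimp only
        gcongr
        rcases hζ01 p with h' | h' <;> rw [h'.1]
        · exact hχ0 _
        · have h2 := h'.2
          simp only [mem_closedBall, dist_zero_right, Prod.norm_def, sup_le_iff] at h2
          rcases hχ01 p.2 with h3 | h3
          exacts [(h3.2 h2.2).elim, h3.1.ge]
      · rw [hζ, integral_indicator_one measurableSet_closedBall]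
    calc ∫ q : ℝ × (E × E), h k q * D k q ≤ ∫ q, W q := integral_mono hhDi hWi hdom
      _ = ∫ t, (Ioc 0 T).indicator 1 t *
          (C * ∫ p, ζ p * D k (t, p) ^ 2 / (2 * c) + c / 2 * ζ p) := by
          rw [Measure.volume_eq_prod, integral_prod _ hWi]
          simp only [W, integral_const_mul]
      _ = ∫ t in Ioc 0 T, C * ∫ p, ζ p * D k (t, p) ^ 2 / (2 * c) + c / 2 * ζ p := by
          rw [← integral_indicator measurableSet_Ioc]
          congr 1
          ext t
          by_cases ht : t ∈ Ioc 0 T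
          · rw [indicator_of_mem ht, indicator_of_mem ht]; simp
          · rw [indicator_of_notMem ht, indicator_of_notMem ht]; simp
      _ ≤ ∫ t in Ioc 0 T, C * (σ k / (2 * c) + c / 2 * V) := by
          refine integral_mono_of_nonneg (Eventually.of_forall fun t => ?_)
            (integrable_const _) (Eventually.of_forall fun t => ?_)
          · refine mul_nonneg hC0 (integral_nonneg fun p => ?_)
            rcases hζ01 p with h' | h' <;> simp only [h'.1, Pi.zero_apply]
            · simp
            · positivity
          · dsimp only
            gcongr
            exact hinner t
      _ = T * (C * (σ k / (2 * c) + c / 2 * V)) := by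
          rw [setIntegral_const]; simp [hT]
  refine squeeze_zero (g := fun k => T * (C * ((√(σ k) + 1 / ((k : ℝ) + 1)) / 2 * (1 + V))))
    (fun k => integral_nonneg fun q => sq_nonneg _) (fun k => ?_) ?_
  · have hk : (0 : ℝ) < 1 / ((k : ℝ) + 1) := by positivity
    set c := √(σ k) + 1 / ((k : ℝ) + 1) with hc
    have hc0 : 0 < c := by positivity
    refine (bound k c hc0).trans ?_
    gcongr
    have : σ k ≤ c ^ 2 := by
      calc σ k = √(σ k) ^ 2 := (Real.sq_sqrt (hσnn k)).symm
        _ ≤ c ^ 2 := by gcongr; linarith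
    have h2 : σ k / (2 * c) ≤ c / 2 := by
      rw [div_le_div_iff₀ (by positivity) (by positivity)]
      nlinarith
    linarith
  · have h1 : Tendsto (fun k => √(σ k)) atTop (𝓝 0) := by
      have := (Real.continuous_sqrt.tendsto 0).comp hσ0
      rwa [Real.sqrt_zero] at this
    have h2 : Tendsto (fun k : ℕ => 1 / ((k : ℝ) + 1)) atTop (𝓝 0) :=
      tendsto_one_div_add_atTop_nhds_zero_nat
    have h3 := (((((h1.add h2).div_const 2).mul_const (1 + V)).const_mul C).const_mul T)
    simpa using h3

end Transport

section Maxwellian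

variable {n : ℕ} {κ : ℝ}

theorem cc1e_pos (hκ : 0 < κ) : 0 < cc1e n κ := by unfold cc1e; positivity

theorem cc2e_pos (hκ : 0 < κ) : 0 < cc2e n κ := by
  unfold cc2e
  have := Real.Gamma_pos_of_pos (s := (n : ℝ) / 2 + 1) (by positivity)
  positivity

theorem MaxwE_nonneg (hκ : 0 < κ) (ρ : ℝ) (u v : En n) : 0 ≤ MaxwE n κ ρ u v := by
  unfold MaxwE; split_ifs; exacts [(cc2e_pos hκ).le, le_rfl]

theorem MaxwE_le (hκ : 0 < κ) (ρ : ℝ) (u v : En n) : MaxwE n κ ρ u v ≤ cc2e n κ := by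
  unfold MaxwE; split_ifs; exacts [le_rfl, (cc2e_pos hκ).le]

/-- The radius of the ball supporting the Maxwellian. -/
def maxwRadius (n : ℕ) (κ ρ : ℝ) : ℝ := √(cc1e n κ * ρ ^ (2 / (n : ℝ)))

theorem MaxwE_eq_indicator (hκ : 0 < κ) {ρ : ℝ} (hρ : 0 ≤ ρ) (u : En n) :
    MaxwE n κ ρ u = (Metric.closedBall u (maxwRadius n κ ρ)).indicator fun _ => cc2e n κ := by
  ext v
  have h : 0 ≤ cc1e n κ * ρ ^ (2 / (n : ℝ)) :=
    mul_nonneg (cc1e_pos hκ).le (Real.rpow_nonneg hρ _)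
  simp only [MaxwE, indicator, Metric.mem_closedBall, dist_eq_norm, maxwRadius]
  simp only [Real.le_sqrt (norm_nonneg _) h]

theorem cc2e_mul_volume (hn : 1 ≤ n) (hκ : 0 < κ) {ρ : ℝ} (hρ : 0 ≤ ρ) (u : En n) :
    cc2e n κ * volume.real (Metric.closedBall u (maxwRadius n κ ρ)) = ρ := by
  have : Nonempty (Fin n) := ⟨⟨0, hn⟩⟩
  have hn0 : (n : ℝ) ≠ 0 := by positivity
  have hG := Real.Gamma_pos_of_pos (s := (n : ℝ) / 2 + 1) (by positivity)
  have hr : maxwRadius n κ ρ ^ n = (κ * ((n : ℝ) + 2)) ^ ((n : ℝ) / 2) * ρ := by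
    rw [maxwRadius, Real.sqrt_eq_rpow, ← Real.rpow_natCast, ← Real.rpow_mul
      (mul_nonneg (cc1e_pos hκ).le (Real.rpow_nonneg hρ _)), Real.mul_rpow (cc1e_pos hκ).le
      (Real.rpow_nonneg hρ _), ← Real.rpow_mul hρ]
    have e1 : (1 / 2 * (n : ℝ)) = n / 2 := by ring
    have e2 : 2 / (n : ℝ) * (1 / 2 * (n : ℝ)) = 1 := by field_simp
    rw [e2, e1, Real.rpow_one, cc1e]
  have hr0 : 0 ≤ maxwRadius n κ ρ := Real.sqrt_nonneg _
  have hπ : √π ^ n = π ^ ((n : ℝ) / 2) := by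
    rw [Real.sqrt_eq_rpow, ← Real.rpow_natCast, ← Real.rpow_mul Real.pi_pos.le]
    congr 1; ring
  rw [Measure.real, EuclideanSpace.volume_closedBall, ENNReal.toReal_mul, ENNReal.toReal_pow,
    ENNReal.toReal_ofReal hr0, ENNReal.toReal_ofReal (by simp only [Fintype.card_fin]; positivity),
    Fintype.card_fin, hr, hπ, cc2e]
  rw [mul_assoc π, Real.mul_rpow Real.pi_pos.le (by positivity)]
  have h1 : 0 < π ^ ((n : ℝ) / 2) := by positivity
  have h2 : 0 < (κ * ((n : ℝ) + 2)) ^ ((n : ℝ) / 2) := by positivity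
  field_simp

theorem integrable_MaxwE (hκ : 0 < κ) {ρ : ℝ} (hρ : 0 ≤ ρ) (u : En n) :
    Integrable (MaxwE n κ ρ u) := by
  rw [MaxwE_eq_indicator hκ hρ, integrable_indicator_iff measurableSet_closedBall]
  exact integrableOn_const measure_closedBall_lt_top.ne

theorem integral_MaxwE (hn : 1 ≤ n) (hκ : 0 < κ) {ρ : ℝ} (hρ : 0 ≤ ρ) (u : En n) :
    ∫ v, MaxwE n κ ρ u v = ρ := by
  rw [MaxwE_eq_indicator hκ hρ, integral_indicator measurableSet_closedBall, setIntegral_const,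
    smul_eq_mul, mul_comm, cc2e_mul_volume hn hκ hρ]

theorem continuous_smul_integrable_MaxwE (hκ : 0 < κ) {ρ : ℝ} (hρ : 0 ≤ ρ) (u : En n)
    {F : Type*} [NormedAddCommGroup F] [NormedSpace ℝ F] {φ : En n → F} (hφ : Continuous φ) :
    Integrable fun v => MaxwE n κ ρ u v • φ v := by
  rw [MaxwE_eq_indicator hκ hρ]
  have : (fun v => (Metric.closedBall u (maxwRadius n κ ρ)).indicator (fun _ => cc2e n κ) v • φ v) =
      (Metric.closedBall u (maxwRadius n κ ρ)).indicator fun v => cc2e n κ • φ v := by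
    ext v; by_cases h : v ∈ Metric.closedBall u (maxwRadius n κ ρ) <;> simp [h, indicator]
  rw [this, integrable_indicator_iff measurableSet_closedBall]
  exact (hφ.const_smul _).continuousOn.integrableOn_compact (isCompact_closedBall _ _)

theorem integral_MaxwE_smul_sub {ρ : ℝ} (u : En n) :
    ∫ v, MaxwE n κ ρ u v • (v - u) = 0 := by
  have h1 := integral_add_right_eq_self (μ := (volume : Measure (En n)))
    (fun v => MaxwE n κ ρ u v • (v - u)) u
  have h2 := integral_neg_eq_self (fun v => MaxwE n κ ρ u (v + u) • (v + u - u)) volume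
  rw [← h1]
  have h3 : (fun v => MaxwE n κ ρ u (-v + u) • (-v + u - u)) =
      fun v => -(MaxwE n κ ρ u (v + u) • (v + u - u)) := by
    ext1 v; simp [MaxwE]
  rw [h3, integral_neg] at h2
  have h4 : (2 : ℝ) • ∫ v, MaxwE n κ ρ u (v + u) • (v + u - u) = 0 := by
    rw [two_smul]
    nth_rewrite 1 [← h2]
    exact neg_add_cancel _
  exact (smul_eq_zero.1 h4).resolve_left two_ne_zero

/-- The Maxwellian has the same mass and momentum as the profile and no more energy. -/
theorem integral_energy_MaxwEOf_le (hn : 1 ≤ n) (hκ : 0 < κ) {g : En n → ℝ}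
    (h0 : ∀ v, 0 ≤ g v) (h1 : ∀ v, g v ≤ cc2e n κ) (hi : Integrable g)
    (hi2 : Integrable fun v => ‖v‖ ^ 2 * g v) :
    ∫ v, ‖v‖ ^ 2 * MaxwEOf n κ g v ≤ ∫ v, ‖v‖ ^ 2 * g v := by
  have hρ0 : 0 ≤ densF n g := integral_nonneg h0
  have hi1 : Integrable fun v => g v • v := by
    refine (hi.add hi2).mono' (hi.aestronglyMeasurable.smul aestronglyMeasurable_id)
      (Eventually.of_forall fun v => ?_)
    rw [norm_smul, Real.norm_eq_abs, abs_of_nonneg (h0 v)]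
    simp only [Pi.add_apply]
    nlinarith [h0 v, sq_nonneg (‖v‖ - 1), norm_nonneg v, mul_nonneg (h0 v) (sq_nonneg (‖v‖ - 1)),
      mul_nonneg (h0 v) (sq_nonneg ‖v‖)]
  set ρ := densF n g with hρ
  set u := bulkF n g with hu
  set r2 := cc1e n κ * ρ ^ (2 / (n : ℝ)) with hr2
  have hmom : ∫ v, g v • v = ρ • u := by
    rw [hu, bulkF]
    split_ifs with hz
    · have : g =ᵐ[volume] 0 := (integral_eq_zero_iff_of_nonneg h0 hi).1 hz
      rw [smul_zero, ← integral_zero (En n) (En n)]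
      refine integral_congr_ae (this.mono fun v hv => ?_)
      simp [hv]
    · rw [smul_smul, ← hρ, mul_inv_cancel₀ (by rwa [hρ]), one_smul]
  have iM := integrable_MaxwE hκ hρ0 u
  have iM1 := continuous_smul_integrable_MaxwE hκ hρ0 u (φ := fun v => v) continuous_id
  have iM2 := continuous_smul_integrable_MaxwE hκ hρ0 u (φ := fun v => ‖v‖ ^ 2) (by fun_prop)
  have hmomM : ∫ v, MaxwE n κ ρ u v • v = ρ • u := by
    have := integral_MaxwE_smul_sub (κ := κ) (ρ := ρ) u
    simp only [smul_sub] at this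
    rw [integral_sub iM1 (iM.smul_const u), integral_smul_const, integral_MaxwE hn hκ hρ0] at this
    exact sub_eq_zero.1 this
  have hpt : ∀ v, 0 ≤ (‖v - u‖ ^ 2 - r2) * (g v - MaxwE n κ ρ u v) := by
    intro v
    unfold MaxwE
    split_ifs with h
    · exact mul_nonneg_of_nonpos_of_nonpos (by linarith) (by linarith [h1 v])
    · exact mul_nonneg (by linarith) (by linarith [h0 v])
  have hexp : ∀ v, (‖v - u‖ ^ 2 - r2) * (g v - MaxwE n κ ρ u v) =
      (‖v‖ ^ 2 * g v - ‖v‖ ^ 2 * MaxwE n κ ρ u v) - 2 * (inner ℝ u (g v • v) -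
        inner ℝ u (MaxwE n κ ρ u v • v)) + (‖u‖ ^ 2 - r2) * (g v - MaxwE n κ ρ u v) := by
    intro v
    rw [norm_sub_sq_real, inner_smul_right, inner_smul_right, real_inner_comm]
    ring
  have hint : 0 ≤ ∫ v, (‖v - u‖ ^ 2 - r2) * (g v - MaxwE n κ ρ u v) := integral_nonneg hpt
  simp only [hexp] at hint
  have iM2' : Integrable fun v => ‖v‖ ^ 2 * MaxwE n κ ρ u v := by
    simpa only [smul_eq_mul, mul_comm] using iM2
  have j1 : Integrable fun v => ‖v‖ ^ 2 * g v - ‖v‖ ^ 2 * MaxwE n κ ρ u v := hi2.sub iM2'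
  have k1 : Integrable fun v => inner ℝ u (g v • v) := hi1.const_inner u
  have k2 : Integrable fun v => inner ℝ u (MaxwE n κ ρ u v • v) := iM1.const_inner u
  have j2 : Integrable fun v => 2 * (inner ℝ u (g v • v) - inner ℝ u (MaxwE n κ ρ u v • v)) :=
    (k1.sub k2).const_mul 2
  have j3 : Integrable fun v => (‖u‖ ^ 2 - r2) * (g v - MaxwE n κ ρ u v) :=
    (hi.sub iM).const_mul _
  have j12 : Integrable fun v => ‖v‖ ^ 2 * g v - ‖v‖ ^ 2 * MaxwE n κ ρ u v -
      2 * (inner ℝ u (g v • v) - inner ℝ u (MaxwE n κ ρ u v • v)) := j1.sub j2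
  rw [integral_add j12 j3, integral_sub j1 j2, integral_sub hi2 iM2', integral_const_mul,
    integral_const_mul, integral_sub k1 k2, integral_sub hi iM, integral_inner hi1,
    integral_inner iM1, hmom, hmomM, integral_MaxwE hn hκ hρ0] at hint
  have : ∫ v, g v = ρ := rfl
  rw [this] at hint
  change ∫ v, ‖v‖ ^ 2 * MaxwE n κ ρ u v ≤ _
  linarith

theorem lintegral_moment_MaxwEOf_le (hn : 1 ≤ n) (hκ : 0 < κ) {g : En n → ℝ} (hg : Measurable g)
    (h0 : ∀ v, 0 ≤ g v) (h1 : ∀ v, g v ≤ cc2e n κ) :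
    ∫⁻ v, ENNReal.ofReal ((1 + ‖v‖ ^ 2) * MaxwEOf n κ g v) ≤
      ∫⁻ v, ENNReal.ofReal ((1 + ‖v‖ ^ 2) * g v) := by
  by_cases htop : ∫⁻ v, ENNReal.ofReal ((1 + ‖v‖ ^ 2) * g v) = ⊤
  · rw [htop]; exact le_top
  have hw : Integrable fun v => (1 + ‖v‖ ^ 2) * g v := by
    refine ⟨by fun_prop, ?_⟩
    rw [hasFiniteIntegral_iff_ofReal (Eventually.of_forall fun v =>
      mul_nonneg (by positivity) (h0 v))]
    exact lt_top_iff_ne_top.2 htop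
  have hi : Integrable g := hw.mono' hg.aestronglyMeasurable (Eventually.of_forall fun v => by
    rw [Real.norm_eq_abs, abs_of_nonneg (h0 v)]
    nlinarith [h0 v, mul_nonneg (sq_nonneg ‖v‖) (h0 v)])
  have hi2 : Integrable fun v => ‖v‖ ^ 2 * g v := by
    refine (hw.sub hi).congr (Eventually.of_forall fun v => ?_)
    simp only [Pi.sub_apply]; ring
  have hρ0 : 0 ≤ densF n g := integral_nonneg h0
  have iM : Integrable (MaxwEOf n κ g) := integrable_MaxwE hκ hρ0 _
  have iM2 : Integrable fun v => ‖v‖ ^ 2 * MaxwEOf n κ g v := by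
    refine (continuous_smul_integrable_MaxwE hκ hρ0 (bulkF n g) (φ := fun v => ‖v‖ ^ 2)
      (by fun_prop)).congr (Eventually.of_forall fun v => ?_)
    simp only [smul_eq_mul, mul_comm, MaxwEOf]
  have iMw : Integrable fun v => (1 + ‖v‖ ^ 2) * MaxwEOf n κ g v := by
    refine (iM.add iM2).congr (Eventually.of_forall fun v => ?_)
    simp only [Pi.add_apply]; ring
  rw [← ofReal_integral_eq_lintegral_ofReal hw (Eventually.of_forall fun v =>
      mul_nonneg (by positivity) (h0 v)),
    ← ofReal_integral_eq_lintegral_ofReal iMw (Eventually.of_forall fun v =>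
      mul_nonneg (by positivity) (MaxwE_nonneg hκ _ _ _))]
  refine ENNReal.ofReal_le_ofReal ?_
  simp only [add_mul, one_mul]
  rw [integral_add iM iM2, integral_add hi hi2]
  have e : ∫ v, MaxwEOf n κ g v = ∫ v, g v := integral_MaxwE hn hκ hρ0 _
  rw [e]
  exact add_le_add le_rfl <| integral_energy_MaxwEOf_le hn hκ h0 h1 hi hi2

/-- The Maxwellian depends continuously, locally in `L¹`, on density and bulk velocity. -/
theorem tendsto_setLIntegral_MaxwE_sub (hn : 1 ≤ n) (hκ : 0 < κ) {ρ : ℕ → ℝ} {u : ℕ → En n}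
    {ρ' : ℝ} {u' : En n} (hρ0 : ∀ k, 0 ≤ ρ k) (hρ : Tendsto ρ atTop (𝓝 ρ'))
    (hu : ρ' ≠ 0 → Tendsto u atTop (𝓝 u')) (V : ℝ) :
    Tendsto (fun k => ∫ v in Metric.closedBall 0 V,
      |MaxwE n κ (ρ k) (u k) v - MaxwE n κ ρ' u' v|) atTop (𝓝 0) := by
  have : Nonempty (Fin n) := ⟨⟨0, hn⟩⟩
  have hρ'0 : 0 ≤ ρ' := ge_of_tendsto' hρ hρ0
  have hn0 : (0 : ℝ) < 2 / n := by have : (0 : ℝ) < n := by exact_mod_cast hn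
                                   positivity
  by_cases hz : ρ' = 0
  · have iM : ∀ k, Integrable (MaxwE n κ (ρ k) (u k)) := fun k => integrable_MaxwE hκ (hρ0 k) _
    have iM' : Integrable (MaxwE n κ ρ' u') := integrable_MaxwE hκ hρ'0 _
    refine squeeze_zero (g := fun k => ρ k + ρ') (fun k => integral_nonneg fun v => abs_nonneg _)
      (fun k => ?_) (by simpa [hz] using hρ)
    calc _ ≤ ∫ v, |MaxwE n κ (ρ k) (u k) v - MaxwE n κ ρ' u' v| :=
          setIntegral_le_integral ((iM k).sub iM').abs (Eventually.of_forall fun v => abs_nonneg _)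
      _ ≤ ∫ v, (MaxwE n κ (ρ k) (u k) v + MaxwE n κ ρ' u' v) := by
          refine integral_mono ((iM k).sub iM').abs ((iM k).add iM') fun v => ?_
          refine (abs_sub _ _).trans ?_
          rw [abs_of_nonneg (MaxwE_nonneg hκ _ _ _), abs_of_nonneg (MaxwE_nonneg hκ _ _ _)]
      _ = _ := by
          rw [integral_add (iM k) iM', integral_MaxwE hn hκ (hρ0 k), integral_MaxwE hn hκ hρ'0]
  have hu := hu hz
  have hlim : Tendsto (fun k => cc1e n κ * ρ k ^ (2 / (n : ℝ))) atTop
      (𝓝 (cc1e n κ * ρ' ^ (2 / (n : ℝ)))) :=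
    (hρ.rpow_const (Or.inr hn0.le)).const_mul _
  rw [show (0 : ℝ) = ∫ _ in Metric.closedBall (0 : En n) V, (0 : ℝ) by simp]
  refine tendsto_integral_of_dominated_convergence (fun _ => cc2e n κ)
    (fun k => (((integrable_MaxwE hκ (hρ0 k) _).sub
      (integrable_MaxwE hκ hρ'0 _)).abs.aestronglyMeasurable.restrict))
    (integrableOn_const measure_closedBall_lt_top.ne)
    (fun k => Eventually.of_forall fun v => ?_) (ae_restrict_of_ae ?_)
  · rw [Real.norm_eq_abs, abs_abs, abs_le]
    constructor <;> linarith [MaxwE_le hκ (ρ k) (u k) v, MaxwE_nonneg hκ (ρ k) (u k) v,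
      MaxwE_le hκ ρ' u' v, MaxwE_nonneg hκ ρ' u' v]
  · have hsph : ∀ᵐ v : En n, v ∉ Metric.sphere u' (maxwRadius n κ ρ') :=
      measure_eq_zero_iff_ae_notMem.1 (Measure.addHaar_sphere _ _ _)
    filter_upwards [hsph] with v hv
    have hne : ‖v - u'‖ ^ 2 ≠ cc1e n κ * ρ' ^ (2 / (n : ℝ)) := by
      intro h
      refine hv ?_
      rw [mem_sphere_iff_norm, maxwRadius, ← h, Real.sqrt_sq (norm_nonneg _)]
    have hvl : Tendsto (fun k => ‖v - u k‖ ^ 2) atTop (𝓝 (‖v - u'‖ ^ 2)) :=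
      ((tendsto_const_nhds.sub hu).norm).pow 2
    refine tendsto_const_nhds.congr' ?_
    rcases lt_or_gt_of_ne hne with h | h
    · filter_upwards [hvl.eventually_lt hlim h] with k hk
      simp [MaxwE, hk.le, h.le]
    · filter_upwards [hlim.eventually_lt hvl h] with k hk
      simp [MaxwE, not_le.2 hk, not_le.2 h]

end Maxwellian

section Operators

variable {n : ℕ} {κ τ : ℝ}

theorem measurable_MaxwEOf_prodMk {α : Type*} [MeasurableSpace α] {Φ : α × En n → ℝ}
    (hΦ : Measurable Φ) :
    Measurable fun q : α × En n => MaxwEOf n κ (fun w => Φ (q.1, w)) q.2 := by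
  have hd : Measurable fun a => densF n fun w => Φ (a, w) :=
    (StronglyMeasurable.integral_prod_right' hΦ.stronglyMeasurable).measurable
  have hs : Measurable fun a => ∫ w, Φ (a, w) • w := by
    have : Measurable fun q : α × En n => Φ q • q.2 := by fun_prop
    exact (StronglyMeasurable.integral_prod_right' this.stronglyMeasurable).measurable
  have hb : Measurable fun a => bulkF n fun w => Φ (a, w) := by
    unfold bulkF
    exact Measurable.ite (measurableSet_eq_fun hd measurable_const) measurable_const
      (hd.inv.smul hs)
  unfold MaxwEOf MaxwE
  refine Measurable.ite (measurableSet_le ?_ ?_) measurable_const measurable_const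
  · exact ((measurable_snd.sub (hb.comp measurable_fst)).norm).pow_const 2
  · exact ((hd.comp measurable_fst).pow_const _).const_mul _

/-- Duhamel operator with delay `ε`, along free trajectories `(t, x, v) ↦ (t, x + t v, v)`. -/
def duhamel (τ ε : ℝ) (f₀ : En n × En n → ℝ) (g : ℝ × (En n × En n) → ℝ)
    (q : ℝ × (En n × En n)) : ℝ :=
  Real.exp (-q.1 / τ) * f₀ q.2 +
    (1 / τ) * ∫ s in Ioc 0 (q.1 - ε), Real.exp (-(q.1 - s) / τ) * g (s, q.2)

/-- The local Maxwellian of a density, both expressed along free trajectories. -/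
def gain (κ : ℝ) (F : ℝ × (En n × En n) → ℝ) (q : ℝ × (En n × En n)) : ℝ :=
  MaxwEOf n κ (fun w => F (q.1, (q.2.1 + q.1 • q.2.2 - q.1 • w, w))) q.2.2

/-- Mass plus twice the kinetic energy. -/
def moment (h : En n × En n → ℝ) : ENNReal := ∫⁻ p, ENNReal.ofReal ((1 + ‖p.2‖ ^ 2) * h p)

theorem duhamel_eq (ε : ℝ) (f₀ : En n × En n → ℝ) (g : ℝ × (En n × En n) → ℝ)
    (q : ℝ × (En n × En n)) : duhamel τ ε f₀ g q = Real.exp (-q.1 / τ) * f₀ q.2 +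
      (1 / τ) * (Real.exp (-q.1 / τ) *
        ∫ s in Ioc 0 (q.1 - ε), Real.exp (s / τ) * g (s, q.2)) := by
  rw [duhamel, ← integral_const_mul (Real.exp (-q.1 / τ))]
  congr 2
  refine integral_congr_ae (Eventually.of_forall fun s => ?_)
  simp only [← mul_assoc, ← Real.exp_add]
  congr 2; ring

theorem measurable_duhamel {ε : ℝ} {f₀ : En n × En n → ℝ} {g : ℝ × (En n × En n) → ℝ}
    (hf₀ : Measurable f₀) (hg : Measurable g) : Measurable (duhamel τ ε f₀ g) := by
  have := measurable_setIntegral_Ioc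
    (h := fun z : ℝ × (En n × En n) => Real.exp (z.1 / τ) * g z) (by fun_prop) ε
  simp only [funext (duhamel_eq (τ := τ) ε f₀ g)]
  fun_prop

theorem measurable_gain {F : ℝ × (En n × En n) → ℝ} (hF : Measurable F) :
    Measurable (gain κ F) := by
  have := measurable_MaxwEOf_prodMk (κ := κ)
    (Φ := fun z : (ℝ × En n) × En n => F (z.1.1, (z.1.2 - z.1.1 • z.2, z.2))) (by fun_prop)
  have h2 : Measurable fun q : ℝ × (En n × En n) =>
    (((q.1, q.2.1 + q.1 • q.2.2), q.2.2) : (ℝ × En n) × En n) := by fun_prop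
  have h3 := this.comp h2
  simp only [Function.comp_def] at h3
  exact h3

theorem gain_nonneg (hκ : 0 < κ) (F : ℝ × (En n × En n) → ℝ) (q) : 0 ≤ gain κ F q :=
  MaxwE_nonneg hκ _ _ _

theorem gain_le (hκ : 0 < κ) (F : ℝ × (En n × En n) → ℝ) (q) : gain κ F q ≤ cc2e n κ :=
  MaxwE_le hκ _ _ _

theorem integrableOn_exp_mul {h : ℝ → ℝ} {c a b : ℝ} (hh : Measurable h) (hc : ∀ s, |h s| ≤ c)
    (t : ℝ) : IntegrableOn (fun s => Real.exp (-(t - s) / τ) * h s) (Ioc a b) := by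
  have : IntegrableOn (fun s => Real.exp (-(t - s) / τ)) (Ioc a b) :=
    (Continuous.integrableOn_Icc (by fun_prop)).mono_set Ioc_subset_Icc_self
  exact Integrable.mul_bdd (c := c) this hh.aestronglyMeasurable (Eventually.of_forall hc)

theorem integral_exp_delay {t : ℝ} (ht : 0 ≤ t) :
    (1 / τ) * ∫ s in Ioc 0 t, Real.exp (-(t - s) / τ) = 1 - Real.exp (-t / τ) := by
  rw [← intervalIntegral.integral_of_le ht, ← intervalIntegral.integral_const_mul]
  rw [intervalIntegral.integral_eq_sub_of_hasDerivAt (f := fun s => Real.exp (-(t - s) / τ))]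
  · simp
  · intro s _
    have h1 : HasDerivAt (fun s : ℝ => -(t - s) / τ) (1 / τ) s := by
      have := (((hasDerivAt_id s).const_sub t).neg).div_const τ
      simpa using this
    rw [mul_comm]
    exact h1.exp
  · exact (by fun_prop : Continuous fun s => 1 / τ * Real.exp (-(t - s) / τ)).intervalIntegrable _ _

theorem duhamel_nonneg (hτ : 0 < τ) {ε : ℝ} {f₀ : En n × En n → ℝ} {g : ℝ × (En n × En n) → ℝ}
    (hf₀ : ∀ p, 0 ≤ f₀ p) (hg : ∀ q, 0 ≤ g q) (q) : 0 ≤ duhamel τ ε f₀ g q := by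
  have : 0 ≤ ∫ s in Ioc 0 (q.1 - ε), Real.exp (-(q.1 - s) / τ) * g (s, q.2) :=
    integral_nonneg fun s => mul_nonneg (Real.exp_pos _).le (hg _)
  have := hf₀ q.2
  unfold duhamel
  positivity

theorem duhamel_le (hτ : 0 < τ) {ε c : ℝ} (hε : 0 ≤ ε) {f₀ : En n × En n → ℝ}
    {g : ℝ × (En n × En n) → ℝ} (hgm : Measurable g)
    (hf₀ : ∀ p, f₀ p ≤ c) (hg0 : ∀ q, 0 ≤ g q) (hg : ∀ q, g q ≤ c) {q : ℝ × (En n × En n)}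
    (hq : 0 ≤ q.1) : duhamel τ ε f₀ g q ≤ c := by
  have hc : 0 ≤ c := (hg0 q).trans (hg q)
  have hga : ∀ s, |g (s, q.2)| ≤ c := fun s => by rw [abs_of_nonneg (hg0 _)]; exact hg _
  have h1 : ∫ s in Ioc 0 (q.1 - ε), Real.exp (-(q.1 - s) / τ) * g (s, q.2) ≤
      ∫ s in Ioc 0 q.1, Real.exp (-(q.1 - s) / τ) * c := by
    calc _ ≤ ∫ s in Ioc 0 q.1, Real.exp (-(q.1 - s) / τ) * g (s, q.2) := by
          refine setIntegral_mono_set (integrableOn_exp_mul (by fun_prop) hga _)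
            (Eventually.of_forall fun s => mul_nonneg (Real.exp_pos _).le (hg0 _))
            (Ioc_subset_Ioc_right (by linarith)).eventuallyLE
      _ ≤ _ := by
          refine integral_mono (integrableOn_exp_mul (by fun_prop) hga _)
            (integrableOn_exp_mul measurable_const (c := c) (fun _ => by rw [abs_of_nonneg hc]) _)
            fun s => ?_
          exact mul_le_mul_of_nonneg_left (hg _) (Real.exp_pos _).le
  rw [integral_mul_const] at h1
  have h2 := integral_exp_delay (τ := τ) hq
  have h3 : (1 / τ) * ∫ s in Ioc 0 (q.1 - ε), Real.exp (-(q.1 - s) / τ) * g (s, q.2) ≤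
      (1 - Real.exp (-q.1 / τ)) * c := by
    rw [← h2, mul_assoc]
    exact mul_le_mul_of_nonneg_left h1 (by positivity)
  have h4 := mul_le_mul_of_nonneg_left (hf₀ q.2) (Real.exp_pos (-q.1 / τ)).le
  unfold duhamel
  linarith

theorem moment_duhamel_le (hτ : 0 < τ) {ε c : ℝ} (hε : 0 ≤ ε) {f₀ : En n × En n → ℝ}
    {g : ℝ × (En n × En n) → ℝ} (hf₀m : Measurable f₀) (hgm : Measurable g)
    (hf₀ : ∀ p, 0 ≤ f₀ p) (hg0 : ∀ q, 0 ≤ g q) (hg : ∀ q, g q ≤ c) {t : ℝ} (ht : 0 ≤ t)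
    {E₀ : ENNReal} (hE : moment f₀ ≤ E₀)
    (hE' : ∀ᵐ s ∂volume.restrict (Ioc 0 t), moment (fun p => g (s, p)) ≤ E₀) :
    moment (fun p => duhamel τ ε f₀ g (t, p)) ≤ E₀ := by
  have hga : ∀ p s, |g (s, p)| ≤ c := fun p s => by rw [abs_of_nonneg (hg0 _)]; exact hg _
  have e1 : ∀ p : En n × En n, ENNReal.ofReal ((1 + ‖p.2‖ ^ 2) * duhamel τ ε f₀ g (t, p)) ≤
      ENNReal.ofReal (Real.exp (-t / τ)) * ENNReal.ofReal ((1 + ‖p.2‖ ^ 2) * f₀ p) +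
      ∫⁻ s in Ioc 0 t, ENNReal.ofReal ((1 / τ) * Real.exp (-(t - s) / τ)) *
        ENNReal.ofReal ((1 + ‖p.2‖ ^ 2) * g (s, p)) := by
    intro p
    have hw : 0 ≤ 1 + ‖p.2‖ ^ 2 := by positivity
    have hI0 : 0 ≤ ∫ s in Ioc 0 (t - ε), Real.exp (-(t - s) / τ) * g (s, p) :=
      integral_nonneg fun s => mul_nonneg (Real.exp_pos _).le (hg0 _)
    have h1 : (1 + ‖p.2‖ ^ 2) * duhamel τ ε f₀ g (t, p) =
        Real.exp (-t / τ) * ((1 + ‖p.2‖ ^ 2) * f₀ p) + ((1 + ‖p.2‖ ^ 2) * (1 / τ)) *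
          ∫ s in Ioc 0 (t - ε), Real.exp (-(t - s) / τ) * g (s, p) := by
      simp only [duhamel]; ring
    rw [h1, ENNReal.ofReal_add (mul_nonneg (Real.exp_pos _).le (mul_nonneg hw (hf₀ p)))
      (by positivity), ENNReal.ofReal_mul (Real.exp_pos _).le]
    refine add_le_add le_rfl ?_
    rw [← integral_const_mul, ofReal_integral_eq_lintegral_ofReal
      ((integrableOn_exp_mul (by fun_prop) (hga p) _).const_mul _)
      (Eventually.of_forall fun s => mul_nonneg (by positivity)
        (mul_nonneg (Real.exp_pos _).le (hg0 _)))]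
    refine (lintegral_mono_set (Ioc_subset_Ioc_right (sub_le_self _ hε))).trans (le_of_eq ?_)
    refine lintegral_congr fun s => ?_
    rw [← ENNReal.ofReal_mul (by positivity)]
    congr 1; ring
  have hone : ENNReal.ofReal (Real.exp (-t / τ)) + ∫⁻ s in Ioc 0 t,
      ENNReal.ofReal ((1 / τ) * Real.exp (-(t - s) / τ)) = 1 := by
    have hi : IntegrableOn (fun s => (1 / τ) * Real.exp (-(t - s) / τ)) (Ioc 0 t) :=
      (Continuous.integrableOn_Icc (by fun_prop)).mono_set Ioc_subset_Icc_self
    rw [← ofReal_integral_eq_lintegral_ofReal hi (Eventually.of_forall fun s => by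
      positivity), integral_const_mul, integral_exp_delay (τ := τ) ht,
      ← ENNReal.ofReal_add (Real.exp_pos _).le]
    · simp
    · rw [sub_nonneg, Real.exp_le_one_iff]
      exact div_nonpos_of_nonpos_of_nonneg (by linarith) hτ.le
  calc moment (fun p => duhamel τ ε f₀ g (t, p))
      ≤ ∫⁻ p, (ENNReal.ofReal (Real.exp (-t / τ)) * ENNReal.ofReal ((1 + ‖p.2‖ ^ 2) * f₀ p) +
      ∫⁻ s in Ioc 0 t, ENNReal.ofReal ((1 / τ) * Real.exp (-(t - s) / τ)) *
        ENNReal.ofReal ((1 + ‖p.2‖ ^ 2) * g (s, p))) := lintegral_mono e1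
    _ = ENNReal.ofReal (Real.exp (-t / τ)) * moment f₀ + ∫⁻ s in Ioc 0 t,
        ENNReal.ofReal ((1 / τ) * Real.exp (-(t - s) / τ)) * moment (fun p => g (s, p)) := by
        rw [lintegral_add_left (by fun_prop), lintegral_const_mul _ (by fun_prop),
          lintegral_lintegral_swap (by fun_prop)]
        congr 1
        refine lintegral_congr fun s => ?_
        rw [lintegral_const_mul _ (by fun_prop)]
        rfl
    _ ≤ ENNReal.ofReal (Real.exp (-t / τ)) * E₀ + ∫⁻ s in Ioc 0 t,
        ENNReal.ofReal ((1 / τ) * Real.exp (-(t - s) / τ)) * E₀ := by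
        refine add_le_add (by gcongr) (lintegral_mono_ae ?_)
        filter_upwards [hE'] with s hs
        gcongr
    _ = E₀ := by
        rw [lintegral_mul_const _ (by fun_prop), ← add_mul, hone, one_mul]

theorem moment_gain_le (hn : 1 ≤ n) (hκ : 0 < κ) {F : ℝ × (En n × En n) → ℝ} (hF : Measurable F)
    {t : ℝ} (h0 : ∀ p, 0 ≤ F (t, p)) (h1 : ∀ p, F (t, p) ≤ cc2e n κ) :
    moment (fun p => gain κ F (t, p)) ≤ moment fun p => F (t, p) := by
  have hm1 : Measurable fun p : En n × En n =>
      MaxwEOf n κ (fun w => F (t, (p.1 - t • w, w))) p.2 :=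
    measurable_MaxwEOf_prodMk (Φ := fun z : En n × En n => F (t, (z.1 - t • z.2, z.2)))
      (by fun_prop)
  calc moment (fun p => gain κ F (t, p))
      = ∫⁻ p : En n × En n, ENNReal.ofReal ((1 + ‖p.2‖ ^ 2) *
          MaxwEOf n κ (fun w => F (t, (p.1 - t • w, w))) p.2) :=
        (measurePreserving_shear t).lintegral_comp (f := fun p : En n × En n =>
          ENNReal.ofReal ((1 + ‖p.2‖ ^ 2) * MaxwEOf n κ (fun w => F (t, (p.1 - t • w, w))) p.2))
          (by fun_prop)
    _ = ∫⁻ x, ∫⁻ v, ENNReal.ofReal ((1 + ‖v‖ ^ 2) *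
          MaxwEOf n κ (fun w => F (t, (x - t • w, w))) v) := by
        rw [Measure.volume_eq_prod, lintegral_prod _ (by fun_prop)]
    _ ≤ ∫⁻ x, ∫⁻ v, ENNReal.ofReal ((1 + ‖v‖ ^ 2) * F (t, (x - t • v, v))) :=
        lintegral_mono fun x => lintegral_moment_MaxwEOf_le hn hκ (by fun_prop)
          (fun v => h0 _) fun v => h1 _
    _ = ∫⁻ p : En n × En n, ENNReal.ofReal ((1 + ‖p.2‖ ^ 2) * F (t, (p.1 - t • p.2, p.2))) := by
        rw [Measure.volume_eq_prod, lintegral_prod _ (by fun_prop)]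
    _ = moment fun p => F (t, p) :=
        (measurePreserving_shear t).symm.lintegral_comp (f := fun p : En n × En n =>
          ENNReal.ofReal ((1 + ‖p.2‖ ^ 2) * F (t, p))) (by fun_prop)

end Operators

section Approximation

variable {n : ℕ} {κ τ : ℝ}

/-- Picard iterates of the delayed equation. -/
def delayIter (κ τ ε : ℝ) (f₀ : En n × En n → ℝ) : ℕ → ℝ × (En n × En n) → ℝ
  | 0 => 0
  | j + 1 => gain κ (duhamel τ ε f₀ (delayIter κ τ ε f₀ j))

theorem duhamel_congr {ε : ℝ} {f₀ : En n × En n → ℝ} {g g' : ℝ × (En n × En n) → ℝ} {t : ℝ}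
    (h : ∀ s p, s ∈ Ioc 0 (t - ε) → g (s, p) = g' (s, p)) (p : En n × En n) :
    duhamel τ ε f₀ g (t, p) = duhamel τ ε f₀ g' (t, p) := by
  simp only [duhamel]
  rw [setIntegral_congr_fun measurableSet_Ioc fun s hs => ?_]
  simp only [h s p hs]

theorem gain_congr {F F' : ℝ × (En n × En n) → ℝ} {t : ℝ} (h : ∀ p, F (t, p) = F' (t, p))
    (p : En n × En n) : gain κ F (t, p) = gain κ F' (t, p) := by
  simp only [gain, h]

theorem delayIter_eq_of_le {ε : ℝ} {f₀ : En n × En n → ℝ} (j : ℕ) : ∀ i, j ≤ i → ∀ t p, 0 ≤ t →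
    t < j * ε → delayIter κ τ ε f₀ i (t, p) = delayIter κ τ ε f₀ j (t, p) := by
  induction j with
  | zero => intro i _ t p h1 h2; simp at h2; linarith
  | succ j ih =>
    intro i hi t p h1 h2
    obtain ⟨i, rfl⟩ : ∃ i', i = i' + 1 := ⟨i - 1, by omega⟩
    refine gain_congr (fun p => duhamel_congr (fun s p hs => ?_) p) p
    refine ih i (by omega) s p hs.1.le ?_
    push_cast at h2
    linarith [hs.2]

theorem measurable_delayIter {ε : ℝ} {f₀ : En n × En n → ℝ} (hf₀ : Measurable f₀) (j : ℕ) :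
    Measurable (delayIter κ τ ε f₀ j) := by
  induction j with
  | zero => exact measurable_zero
  | succ j ih => exact measurable_gain (measurable_duhamel hf₀ ih)

theorem delayIter_nonneg (hκ : 0 < κ) {ε : ℝ} {f₀ : En n × En n → ℝ} (j : ℕ) (q) :
    0 ≤ delayIter κ τ ε f₀ j q := by
  cases j
  exacts [le_rfl, gain_nonneg hκ _ _]

theorem delayIter_le (hκ : 0 < κ) {ε : ℝ} {f₀ : En n × En n → ℝ} (j : ℕ) (q) :
    delayIter κ τ ε f₀ j q ≤ cc2e n κ := by
  cases j
  exacts [(cc2e_pos hκ).le, gain_le hκ _ _]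

theorem moment_delayIter_le (hn : 1 ≤ n) (hκ : 0 < κ) (hτ : 0 < τ) {ε : ℝ} (hε : 0 ≤ ε)
    {f₀ : En n × En n → ℝ} (hf₀m : Measurable f₀) (hf₀ : ∀ p, 0 ≤ f₀ p)
    (hf₀' : ∀ p, f₀ p ≤ cc2e n κ) (j : ℕ) : ∀ t, 0 ≤ t →
    moment (fun p => delayIter κ τ ε f₀ j (t, p)) ≤ moment f₀ := by
  induction j with
  | zero => intro t _; simp [delayIter, moment]
  | succ j ih =>
    intro t ht
    have hm := measurable_delayIter (κ := κ) (τ := τ) (ε := ε) hf₀m j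
    refine (moment_gain_le hn hκ (measurable_duhamel hf₀m hm)
      (fun p => duhamel_nonneg hτ hf₀ (delayIter_nonneg hκ j) _)
      (fun p => duhamel_le hτ hε hm hf₀' (delayIter_nonneg hκ j) (delayIter_le hκ j) ht)).trans ?_
    exact moment_duhamel_le hτ hε hf₀m hm hf₀ (delayIter_nonneg hκ j) (delayIter_le hκ j) ht le_rfl
      ((ae_restrict_mem measurableSet_Ioc).mono fun s hs => ih s hs.1.le)

/-- The equation with a positive delay has a global solution. -/
theorem exists_delayed_solution (hn : 1 ≤ n) (hκ : 0 < κ) (hτ : 0 < τ) {ε : ℝ} (hε : 0 < ε)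
    {f₀ : En n × En n → ℝ} (hf₀m : Measurable f₀) (hf₀ : ∀ p, 0 ≤ f₀ p)
    (hf₀' : ∀ p, f₀ p ≤ cc2e n κ) :
    ∃ g : ℝ × (En n × En n) → ℝ, Measurable g ∧ (∀ q, 0 ≤ g q) ∧ (∀ q, g q ≤ cc2e n κ) ∧
      (∀ t, 0 ≤ t → moment (fun p => g (t, p)) ≤ moment f₀) ∧
      ∀ q : ℝ × (En n × En n), 0 ≤ q.1 → g q = gain κ (duhamel τ ε f₀ g) q := by
  refine ⟨fun q => delayIter κ τ ε f₀ (⌊q.1 / ε⌋₊ + 1) q, ?_, fun q => delayIter_nonneg hκ _ _,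
    fun q => delayIter_le hκ _ _,
    fun t ht => moment_delayIter_le hn hκ hτ hε.le hf₀m hf₀ hf₀' (⌊t / ε⌋₊ + 1) t ht, ?_⟩
  · have h1 : Measurable fun z : ℕ × (ℝ × (En n × En n)) => delayIter κ τ ε f₀ z.1 z.2 :=
      measurable_from_prod_countable_right fun j => measurable_delayIter hf₀m j
    have h2 : Measurable fun q : ℝ × (En n × En n) => (⌊q.1 / ε⌋₊ + 1, q) := by
      have : Measurable fun q : ℝ × (En n × En n) => ⌊q.1 / ε⌋₊ :=
        Nat.measurable_floor.comp (by fun_prop)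
      fun_prop
    exact h1.comp h2
  · rintro ⟨t, p⟩ ht
    refine gain_congr (fun p => duhamel_congr (fun s p hs => ?_) p) p
    have hs0 : 0 ≤ s / ε := div_nonneg hs.1.le hε.le
    have h3 : s / ε + 1 ≤ t / ε := by
      rw [← sub_nonneg]
      have : t / ε - (s / ε + 1) = (t - ε - s) / ε := by field_simp; ring
      rw [this]
      exact div_nonneg (by linarith [hs.2]) hε.le
    refine delayIter_eq_of_le _ _ ?_ s p hs.1.le ?_
    · change ⌊s / ε⌋₊ + 1 ≤ ⌊t / ε⌋₊
      rw [← Nat.floor_add_one hs0]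
      exact Nat.floor_le_floor h3
    · have := Nat.lt_floor_add_one (s / ε)
      rw [div_lt_iff₀ hε] at this
      push_cast
      exact this

end Approximation

/-- Bounded sequences in `L²` have weakly convergent subsequences. -/
theorem exists_subseq_tendsto_integral_mul {α : Type*} [MeasurableSpace α] {μ : Measure α}
    [IsSeparable μ] {g : ℕ → α → ℝ} (hg : ∀ k, MemLp (g k) 2 μ) {M : ℝ}
    (hM : ∀ k, eLpNorm (g k) 2 μ ≤ ENNReal.ofReal M) :
    ∃ φ : ℕ → ℕ, StrictMono φ ∧ ∃ g' : α → ℝ, MemLp g' 2 μ ∧ ∀ ψ, MemLp ψ 2 μ →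
      Tendsto (fun k => ∫ x, ψ x * g (φ k) x ∂μ) atTop (𝓝 (∫ x, ψ x * g' x ∂μ)) := by
  have : Fact ((1 : ENNReal) ≤ 2) := ⟨one_le_two⟩
  have : Fact ((2 : ENNReal) ≠ ⊤) := ⟨by simp⟩
  let D := InnerProductSpace.toDual ℝ (Lp ℝ 2 μ)
  let x : ℕ → Lp ℝ 2 μ := fun k => (hg k).toLp (g k)
  have hx : ∀ k, ‖x k‖ ≤ max M 0 := fun k => by
    rw [Lp.norm_toLp]
    exact ENNReal.toReal_le_of_le_ofReal (le_max_right _ _)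
      ((hM k).trans (ENNReal.ofReal_le_ofReal (le_max_left _ _)))
  obtain ⟨y, -, φ, hφ, hlim⟩ := WeakDual.isSeqCompact_closedBall (𝕜 := ℝ) (Lp ℝ 2 μ)
    (0 : StrongDual ℝ (Lp ℝ 2 μ)) (max M 0)
    (x := fun k => StrongDual.toWeakDual (D (x k))) (fun k => by simpa using hx k)
  refine ⟨φ, hφ, D.symm (WeakDual.toStrongDual y), Lp.memLp _, fun ψ hψ => ?_⟩
  have h1 := ((WeakDual.eval_continuous (hψ.toLp ψ)).tendsto y).comp hlim
  have key : ∀ (f : Lp ℝ 2 μ) (f' : α → ℝ), f =ᵐ[μ] f' →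
      D f (hψ.toLp ψ) = ∫ a, ψ a * f' a ∂μ := by
    intro f f' hf
    rw [InnerProductSpace.toDual_apply_apply, L2.inner_def]
    refine integral_congr_ae ?_
    filter_upwards [hf, hψ.coeFn_toLp] with a h1 h2
    simp [h1, h2]
  have h2 := key (D.symm (WeakDual.toStrongDual y)) _ (ae_eq_refl _)
  rw [LinearIsometryEquiv.apply_symm_apply] at h2
  rw [← h2]
  refine h1.congr fun k => ?_
  exact key (x (φ k)) _ (hg (φ k)).coeFn_toLp

section WeakLimit

variable {n : ℕ}

/-- The bounded box of times in `(0, T]` and phase points of norm at most `R`. -/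
def box (n : ℕ) (T R : ℝ) : Set (ℝ × (En n × En n)) := Ioc 0 T ×ˢ Metric.closedBall 0 R

theorem mem_box {T R : ℝ} {q : ℝ × (En n × En n)} :
    q ∈ box n T R ↔ q.1 ∈ Ioc 0 T ∧ q.2 ∈ Metric.closedBall 0 R := Iff.rfl

theorem measurableSet_box (T R : ℝ) : MeasurableSet (box n T R) :=
  measurableSet_Ioc.prod Metric.isClosed_closedBall.measurableSet

theorem volume_box_ne_top (T R : ℝ) : volume (box n T R) ≠ ⊤ := by
  rw [box, Measure.volume_eq_prod, Measure.prod_prod]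
  exact ENNReal.mul_ne_top measure_Ioc_lt_top.ne measure_closedBall_lt_top.ne

theorem iUnion_box : ⋃ N : ℕ, box n N N = Ioi 0 ×ˢ univ := by
  ext q
  simp only [mem_iUnion, mem_box, mem_prod, mem_univ, and_true, mem_Ioi, mem_closedBall_zero_iff]
  refine ⟨fun ⟨N, h⟩ => h.1.1, fun h => ?_⟩
  obtain ⟨N, hN⟩ := exists_nat_ge (max q.1 ‖q.2‖)
  exact ⟨N, ⟨h, (le_max_left _ _).trans hN⟩, (le_max_right _ _).trans hN⟩

theorem ae_restrict_of_forall_box {P : ℝ × (En n × En n) → Prop}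
    (h : ∀ N : ℕ, ∀ᵐ q ∂volume.restrict (box n N N), P q) :
    ∀ᵐ q ∂volume.restrict ((Ioi 0 : Set ℝ) ×ˢ (univ : Set (En n × En n))), P q := by
  rw [← iUnion_box, ae_restrict_iUnion_iff]
  exact h

theorem exists_weak_limit {g : ℕ → ℝ × (En n × En n) → ℝ} {c : ℝ} {E₀ : ENNReal} (hE₀ : E₀ ≠ ⊤)
    (hm : ∀ k, Measurable (g k)) (h0 : ∀ k q, 0 ≤ g k q) (hc : ∀ k q, g k q ≤ c)
    (hE : ∀ k t, 0 ≤ t → moment (fun p => g k (t, p)) ≤ E₀) :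
    ∃ φ : ℕ → ℕ, StrictMono φ ∧ ∃ g' : ℝ × (En n × En n) → ℝ, Measurable g' ∧
      (∀ q, 0 ≤ g' q) ∧ (∀ q, g' q ≤ c) ∧
      (∀ᵐ t ∂volume.restrict (Ioi 0), moment (fun p => g' (t, p)) ≤ E₀) ∧
      ∀ (T R C : ℝ) (ψ : ℝ × (En n × En n) → ℝ), Measurable ψ → (∀ q, |ψ q| ≤ C) →
        (∀ q, ψ q ≠ 0 → q ∈ box n T R) →
        Tendsto (fun k => ∫ q, ψ q * g (φ k) q) atTop (𝓝 (∫ q, ψ q * g' q)) := by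
  have hc0 : 0 ≤ c := (h0 0 0).trans (hc 0 0)
  let χ : ℝ × (En n × En n) → ℝ := (Ioi 0 ×ˢ univ).indicator fun q => Real.exp (-q.1)
  have hχm : Measurable χ := by
    refine Measurable.indicator (by fun_prop) (measurableSet_Ioi.prod MeasurableSet.univ)
  have hbound : ∀ k, eLpNorm (fun q => χ q * g k q) 2 volume ≤
      (ENNReal.ofReal c * E₀) ^ (1 / 2 : ℝ) := by
    intro k
    rw [eLpNorm_eq_lintegral_rpow_enorm_toReal (by simp) (by simp)]
    simp only [ENNReal.toReal_ofNat]
    refine ENNReal.rpow_le_rpow ?_ (by norm_num)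
    calc ∫⁻ q, ‖χ q * g k q‖ₑ ^ (2 : ℝ)
        ≤ ∫⁻ q : ℝ × (En n × En n), (Ioi 0).indicator
            (fun t => ENNReal.ofReal (Real.exp (-t))) q.1 *
            (ENNReal.ofReal c * ENNReal.ofReal ((1 + ‖q.2.2‖ ^ 2) * g k q)) := by
          refine lintegral_mono fun q => ?_
          by_cases hq : 0 < q.1
          · have hq' : q ∈ (Ioi 0 ×ˢ univ : Set (ℝ × (En n × En n))) := ⟨hq, mem_univ _⟩
            have e1 : Real.exp (-q.1) ≤ 1 := by rw [Real.exp_le_one_iff]; linarith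
            have e0 := Real.exp_pos (-q.1)
            simp only [χ, indicator_of_mem hq', indicator_of_mem (show q.1 ∈ Ioi (0 : ℝ) from hq)]
            rw [Real.enorm_eq_ofReal (mul_nonneg e0.le (h0 k q)), ← ENNReal.ofReal_mul hc0,
              ← ENNReal.ofReal_mul e0.le, ENNReal.ofReal_rpow_of_nonneg
                (mul_nonneg e0.le (h0 k q)) (by norm_num)]
            refine ENNReal.ofReal_le_ofReal ?_
            rw [Real.rpow_two, mul_pow, sq (Real.exp _), sq (g k q), mul_assoc]
            refine mul_le_mul_of_nonneg_left ?_ e0.le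
            have := h0 k q
            have h2 : Real.exp (-q.1) * (g k q * g k q) ≤ 1 * (c * g k q) := by
              gcongr
              exact hc k q
            refine h2.trans ?_
            rw [one_mul]
            refine mul_le_mul_of_nonneg_left ?_ hc0
            nlinarith [mul_nonneg (sq_nonneg ‖q.2.2‖) this]
          · have hq' : q ∉ (Ioi 0 ×ˢ univ : Set (ℝ × (En n × En n))) := fun h => hq h.1
            simp [χ, indicator_of_notMem hq']
      _ = ∫⁻ t, (Ioi 0).indicator (fun t => ENNReal.ofReal (Real.exp (-t))) t *
            (ENNReal.ofReal c * moment (fun p => g k (t, p))) := by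
          have hmk := hm k
          have : Measurable ((Ioi 0).indicator fun t : ℝ => ENNReal.ofReal (Real.exp (-t))) :=
            Measurable.indicator (by fun_prop) measurableSet_Ioi
          rw [Measure.volume_eq_prod, lintegral_prod _ (by fun_prop)]
          refine lintegral_congr fun t => ?_
          dsimp only
          rw [lintegral_const_mul _ (by fun_prop), lintegral_const_mul _ (by fun_prop)]
          rfl
      _ ≤ ∫⁻ t, (Ioi 0).indicator (fun t => ENNReal.ofReal (Real.exp (-t))) t *
            (ENNReal.ofReal c * E₀) := by
          refine lintegral_mono fun t => ?_
          by_cases ht : t ∈ Ioi (0 : ℝ)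
          · gcongr
            exact hE k t (mem_Ioi.1 ht).le
          · simp [indicator_of_notMem ht]
      _ = ENNReal.ofReal c * E₀ := by
          have : Measurable ((Ioi 0).indicator fun t : ℝ => ENNReal.ofReal (Real.exp (-t))) :=
            Measurable.indicator (by fun_prop) measurableSet_Ioi
          rw [lintegral_mul_const _ this, lintegral_indicator measurableSet_Ioi,
            ← ofReal_integral_eq_lintegral_ofReal (integrableOn_exp_neg_Ioi 0)
              (Eventually.of_forall fun t => (Real.exp_pos _).le), integral_exp_neg_Ioi_zero]
          simp
  have hfin : (ENNReal.ofReal c * E₀) ^ (1 / 2 : ℝ) ≠ ⊤ :=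
    ENNReal.rpow_ne_top_of_nonneg (by norm_num) (ENNReal.mul_ne_top ENNReal.ofReal_ne_top hE₀)
  have : MeasureTheory.IsSeparable (volume : Measure (ℝ × (En n × En n))) := by
    apply MeasureTheory.instIsSeparableOfCountablyGeneratedOfSFinite
  obtain ⟨φ, hφ, γ, hγ, hlim⟩ := exists_subseq_tendsto_integral_mul
    (μ := (volume : Measure (ℝ × (En n × En n))))
    (g := fun k q => χ q * g k q) (M := ((ENNReal.ofReal c * E₀) ^ (1 / 2 : ℝ)).toReal)
    (fun k => ⟨(hχm.mul (hm k)).aestronglyMeasurable, (hbound k).trans_lt hfin.lt_top⟩)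
    (fun k => by rw [ENNReal.ofReal_toReal hfin]; exact hbound k)
  obtain ⟨g₁, hg₁m, hg₁⟩ : ∃ g₁ : ℝ × (En n × En n) → ℝ, Measurable g₁ ∧
      g₁ =ᵐ[volume] fun q => Real.exp q.1 * γ q := by
    have := hγ.1.aemeasurable
    refine ⟨fun q => Real.exp q.1 * this.mk γ q, by have := this.measurable_mk; fun_prop, ?_⟩
    filter_upwards [this.ae_eq_mk] with q hq
    rw [hq]
  have htest : ∀ (T R C : ℝ) (ψ : ℝ × (En n × En n) → ℝ), Measurable ψ → (∀ q, |ψ q| ≤ C) →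
      (∀ q, ψ q ≠ 0 → q ∈ box n T R) →
      Integrable (fun q => ψ q * g₁ q) ∧
      Tendsto (fun k => ∫ q, ψ q * g (φ k) q) atTop (𝓝 (∫ q, ψ q * g₁ q)) := by
    intro T R C ψ hψm hψC hψs
    have hψ2 : MemLp (fun q => ψ q * Real.exp q.1) 2 volume := by
      rw [memLp_two_iff_integrable_sq (by fun_prop : Measurable _).aestronglyMeasurable]
      refine integrable_of_bounded_of_support (by fun_prop) (volume_box_ne_top T R)
        (C := (C * Real.exp T) ^ 2) (fun q hq => hψs q fun h => hq (by simp [h])) fun q => ?_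
      have hC : 0 ≤ C := (abs_nonneg _).trans (hψC q)
      rw [abs_pow]
      refine pow_le_pow_left₀ (abs_nonneg _) ?_ 2
      by_cases hq : ψ q = 0
      · rw [hq]; simp; positivity
      · rw [abs_mul, Real.abs_exp]
        have := (hψs q hq).1.2
        gcongr
        exact hψC q
    have e : (fun q => ψ q * Real.exp q.1 * γ q) =ᵐ[volume] fun q => ψ q * g₁ q := by
      filter_upwards [hg₁] with q hq
      rw [hq]; ring
    refine ⟨(hψ2.integrable_mul hγ).congr e, ?_⟩
    rw [← integral_congr_ae e]
    refine (hlim _ hψ2).congr fun k => integral_congr_ae (Eventually.of_forall fun q => ?_)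
    by_cases hq : ψ q = 0
    · simp [hq]
    · have hq' : q ∈ (Ioi 0 ×ˢ univ : Set (ℝ × (En n × En n))) := ⟨(hψs q hq).1.1, mem_univ _⟩
      simp only [χ, indicator_of_mem hq']
      have : Real.exp q.1 * Real.exp (-q.1) = 1 := by rw [← Real.exp_add]; simp
      linear_combination ψ q * g (φ k) q * this
  have hbox1 : ∀ (N : ℕ) (S : Set (ℝ × (En n × En n))), MeasurableSet S →
      IntegrableOn g₁ (S ∩ box n N N) ∧
      Tendsto (fun k => ∫ q in S ∩ box n N N, g (φ k) q) atTop
        (𝓝 (∫ q in S ∩ box n N N, g₁ q)) := by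
    intro N S hS
    have hSb := hS.inter (measurableSet_box (n := n) N N)
    have h1 := htest N N 1 ((S ∩ box n N N).indicator 1) (measurable_const.indicator hSb)
      (fun q => by by_cases hq : q ∈ S ∩ box n N N <;> simp [hq])
      (fun q hq => (mem_of_indicator_ne_zero hq).2)
    have e : ∀ f : ℝ × (En n × En n) → ℝ, (fun q => (S ∩ box n N N).indicator 1 q * f q) =
        (S ∩ box n N N).indicator f := fun f => by
      ext q; by_cases hq : q ∈ S ∩ box n N N <;> simp [hq]
    simp only [e, integral_indicator hSb, integrable_indicator_iff hSb] at h1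
    exact h1
  have hbd : ∀ᵐ q ∂volume.restrict ((Ioi 0 : Set ℝ) ×ˢ (univ : Set (En n × En n))),
      0 ≤ g₁ q ∧ g₁ q ≤ c := by
    refine ae_restrict_of_forall_box fun N => ?_
    have hi : IntegrableOn g₁ (box n N N) := by simpa using (hbox1 N univ MeasurableSet.univ).1
    have hcst : IntegrableOn (fun _ => c) (box n N N) := integrableOn_const (volume_box_ne_top _ _)
    refine Eventually.and ?_ ?_
    · refine ae_le_of_forall_setIntegral_le (f := fun _ => 0) (integrable_zero _ _ _) hi
        fun S hS _ => ?_
      rw [Measure.restrict_restrict hS, integral_zero]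
      exact ge_of_tendsto' (hbox1 N S hS).2 fun k => integral_nonneg fun q => h0 _ _
    · refine ae_le_of_forall_setIntegral_le (g := fun _ => c) hi hcst fun S hS _ => ?_
      rw [Measure.restrict_restrict hS]
      have hfin' : volume (S ∩ box n N N) ≠ ⊤ :=
        ((measure_mono inter_subset_right).trans_lt (volume_box_ne_top _ _).lt_top).ne
      refine le_of_tendsto' (hbox1 N S hS).2 fun k => integral_mono_of_nonneg
        (Eventually.of_forall fun q => h0 _ _) (integrableOn_const hfin')
        (Eventually.of_forall fun q => hc _ _)
  let g' : ℝ × (En n × En n) → ℝ := fun q => max 0 (min c (g₁ q))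
  have hg'm : Measurable g' := by fun_prop
  have hg'0 : ∀ q, 0 ≤ g' q := fun q => le_max_left _ _
  have hg'c : ∀ q, g' q ≤ c := fun q => max_le hc0 (min_le_left _ _)
  have hg' : ∀ᵐ q, 0 < q.1 → g' q = g₁ q := by
    rw [ae_restrict_iff' (measurableSet_Ioi.prod MeasurableSet.univ)] at hbd
    filter_upwards [hbd] with q hq h
    obtain ⟨h1, h2⟩ := hq ⟨h, mem_univ _⟩
    simp [g', h1, h2]
  have htest' : ∀ (T R C : ℝ) (ψ : ℝ × (En n × En n) → ℝ), Measurable ψ → (∀ q, |ψ q| ≤ C) →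
      (∀ q, ψ q ≠ 0 → q ∈ box n T R) →
      Tendsto (fun k => ∫ q, ψ q * g (φ k) q) atTop (𝓝 (∫ q, ψ q * g' q)) := by
    intro T R C ψ hψm hψC hψs
    have e : (fun q => ψ q * g' q) =ᵐ[volume] fun q => ψ q * g₁ q := by
      filter_upwards [hg'] with q hq
      by_cases h : ψ q = 0
      · simp [h]
      · rw [hq (hψs q h).1.1]
    rw [integral_congr_ae e]
    exact (htest T R C ψ hψm hψC hψs).2
  refine ⟨φ, hφ, g', hg'm, hg'0, hg'c, ?_, htest'⟩
  have hloc : ∀ N : ℕ, ∀ᵐ t ∂volume.restrict (Ioc (0 : ℝ) N),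
      ∫⁻ p in Metric.closedBall 0 (N : ℝ), ENNReal.ofReal ((1 + ‖p.2‖ ^ 2) * g' (t, p)) ≤ E₀ := by
    intro N
    have hAm : ∀ f : ℝ × (En n × En n) → ℝ, Measurable f → Measurable fun t =>
        ∫⁻ p in Metric.closedBall 0 (N : ℝ), ENNReal.ofReal ((1 + ‖p.2‖ ^ 2) * f (t, p)) :=
      fun f hf => Measurable.lintegral_prod_right' (f := fun q : ℝ × (En n × En n) =>
        ENNReal.ofReal ((1 + ‖q.2.2‖ ^ 2) * f q)) (by fun_prop)
    refine ae_le_of_forall_setLIntegral_le_of_sigmaFinite (hAm g' hg'm) fun S hS _ => ?_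
    rw [Measure.restrict_restrict hS]
    set ψ : ℝ × (En n × En n) → ℝ := ((S ∩ Ioc 0 N) ×ˢ Metric.closedBall 0 (N : ℝ)).indicator
      fun q => 1 + ‖q.2.2‖ ^ 2 with hψ
    have hSm : MeasurableSet ((S ∩ Ioc (0 : ℝ) N) ×ˢ
        Metric.closedBall (0 : En n × En n) (N : ℝ)) :=
      (hS.inter measurableSet_Ioc).prod Metric.isClosed_closedBall.measurableSet
    have hψm : Measurable ψ := Measurable.indicator (by fun_prop) hSm
    have hψs : ∀ q, ψ q ≠ 0 → q ∈ box n N N := fun q hq =>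
      ⟨(mem_of_indicator_ne_zero hq).1.2, (mem_of_indicator_ne_zero hq).2⟩
    have hψ0 : ∀ q, 0 ≤ ψ q := fun q => indicator_nonneg (fun q _ => by positivity) q
    have hψC : ∀ q, |ψ q| ≤ 1 + (N : ℝ) ^ 2 := by
      intro q
      rw [abs_of_nonneg (hψ0 q)]
      by_cases hq : q ∈ (S ∩ Ioc (0 : ℝ) N) ×ˢ Metric.closedBall (0 : En n × En n) (N : ℝ)
      · have : ‖q.2.2‖ ≤ N := (norm_snd_le q.2).trans (by simpa using hq.2)
        rw [hψ, indicator_of_mem hq]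
        gcongr
      · rw [hψ, indicator_of_notMem hq]
        positivity
    have hrep : ∀ f : ℝ × (En n × En n) → ℝ, Measurable f → (∀ q, 0 ≤ f q) → (∀ q, f q ≤ c) →
        ∫⁻ t in S ∩ Ioc (0 : ℝ) N, ∫⁻ p in Metric.closedBall 0 (N : ℝ),
          ENNReal.ofReal ((1 + ‖p.2‖ ^ 2) * f (t, p)) = ENNReal.ofReal (∫ q, ψ q * f q) := by
      intro f hf hf0 hfc
      have hi : Integrable fun q => ψ q * f q := by
        refine integrable_of_bounded_of_support (by fun_prop) (volume_box_ne_top N N)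
          (C := (1 + (N : ℝ) ^ 2) * c) (fun q hq => hψs q fun h => hq (by simp [h])) fun q => ?_
        rw [abs_mul, abs_of_nonneg (hf0 q)]
        exact mul_le_mul (hψC q) (hfc q) (hf0 q) (by positivity)
      rw [ofReal_integral_eq_lintegral_ofReal hi (Eventually.of_forall fun q =>
        mul_nonneg (hψ0 q) (hf0 q))]
      have e : (fun q => ENNReal.ofReal (ψ q * f q)) =
          ((S ∩ Ioc (0 : ℝ) N) ×ˢ Metric.closedBall (0 : En n × En n) (N : ℝ)).indicator
            fun q => ENNReal.ofReal ((1 + ‖q.2.2‖ ^ 2) * f q) := by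
        ext q
        by_cases hq : q ∈ (S ∩ Ioc (0 : ℝ) N) ×ˢ Metric.closedBall (0 : En n × En n) (N : ℝ)
        · simp only [hψ, indicator_of_mem hq]
        · simp only [hψ, indicator_of_notMem hq, zero_mul, ENNReal.ofReal_zero]
      rw [e, lintegral_indicator hSm, Measure.volume_eq_prod ℝ (En n × En n),
        ← Measure.prod_restrict,
        lintegral_prod _ (by fun_prop)]
    rw [hrep g' hg'm hg'0 hg'c, lintegral_const, Measure.restrict_apply MeasurableSet.univ,
      univ_inter]
    refine le_of_tendsto' (ENNReal.tendsto_ofReal (htest' N N _ ψ hψm hψC hψs)) fun k => ?_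
    rw [← hrep _ (hm _) (h0 _) (hc _)]
    calc _ ≤ ∫⁻ t in S ∩ Ioc (0 : ℝ) N, E₀ := by
          refine lintegral_mono_ae ((ae_restrict_mem (hS.inter measurableSet_Ioc)).mono
            fun t ht => ?_)
          exact (setLIntegral_le_lintegral _ _).trans (hE (φ k) t ht.2.1.le)
      _ = _ := by simp
  have hall : ∀ᵐ t, ∀ N : ℕ, t ∈ Ioc (0 : ℝ) N →
      ∫⁻ p in Metric.closedBall 0 (N : ℝ), ENNReal.ofReal ((1 + ‖p.2‖ ^ 2) * g' (t, p)) ≤ E₀ :=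
    ae_all_iff.2 fun N => (ae_restrict_iff' measurableSet_Ioc).1 (hloc N)
  rw [ae_restrict_iff' measurableSet_Ioi]
  filter_upwards [hall] with t ht ht0
  have hcov := (aecover_closedBall (x := (0 : En n × En n)) (μ := volume)
    (tendsto_natCast_atTop_atTop (R := ℝ))).lintegral_tendsto_of_countably_generated
    (f := fun p => ENNReal.ofReal ((1 + ‖p.2‖ ^ 2) * g' (t, p))) (by fun_prop)
  refine le_of_tendsto hcov ?_
  filter_upwards [(tendsto_natCast_atTop_atTop (R := ℝ)).eventually_ge_atTop t] with N hN
  exact ht N ⟨ht0, hN⟩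

end WeakLimit

section StrongConvergence

variable {n : ℕ} {τ : ℝ}

theorem tendsto_setLIntegral_enorm_of_integral_sq {α : Type*} [MeasurableSpace α] {μ : Measure α}
    {B : ℕ → α → ℝ} {K : Set α} (hK : μ K ≠ ⊤) (hB : ∀ k, Measurable (B k))
    (hi : ∀ k, Integrable (fun q => B k q ^ 2) μ)
    (h : Tendsto (fun k => ∫ q, B k q ^ 2 ∂μ) atTop (𝓝 0)) :
    Tendsto (fun k => ∫⁻ q in K, ‖B k q‖ₑ ∂μ) atTop (𝓝 0) := by
  have h2 : Tendsto (fun k => ENNReal.ofReal ((∫ q, B k q ^ 2 ∂μ) ^ (1 / 2 : ℝ)) *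
      μ K ^ (1 / 2 : ℝ)) atTop (𝓝 0) := by
    have h1 := ENNReal.tendsto_ofReal (h.rpow_const (p := (1 / 2 : ℝ)) (Or.inr (by norm_num)))
    rw [Real.zero_rpow (by norm_num), ENNReal.ofReal_zero] at h1
    have := ENNReal.Tendsto.mul_const (b := μ K ^ (1 / 2 : ℝ)) h1
      (Or.inr (ENNReal.rpow_ne_top_of_nonneg (by norm_num) hK))
    rwa [zero_mul] at this
  refine tendsto_of_tendsto_of_tendsto_of_le_of_le tendsto_const_nhds h2 (fun k => zero_le)
    fun k => ?_
  have hL : MemLp (B k) 2 μ := (memLp_two_iff_integrable_sq (hB k).aestronglyMeasurable).2 (hi k)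
  have e1 := eLpNorm_le_eLpNorm_mul_rpow_measure_univ (μ := μ.restrict K) (p := 1) (q := 2)
    one_le_two (hB k).aestronglyMeasurable
  rw [eLpNorm_one_eq_lintegral_enorm, Measure.restrict_apply_univ] at e1
  refine e1.trans ?_
  have e2 : eLpNorm (B k) 2 (μ.restrict K) ≤ eLpNorm (B k) 2 μ :=
    eLpNorm_mono_measure _ Measure.restrict_le_self
  have e3 : eLpNorm (B k) 2 μ = ENNReal.ofReal ((∫ q, B k q ^ 2 ∂μ) ^ (1 / 2 : ℝ)) := by
    rw [hL.eLpNorm_eq_integral_rpow_norm two_ne_zero (by simp)]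
    simp
  rw [← e3]
  have e4 : (1 / (1 : ENNReal).toReal - 1 / (2 : ENNReal).toReal) = (1 / 2 : ℝ) := by norm_num
  rw [e4]
  gcongr

theorem abs_duhamel_sub_le (hτ : 0 < τ) {ε c : ℝ} (hε : 0 ≤ ε) {f₀ : En n × En n → ℝ}
    {g g' : ℝ × (En n × En n) → ℝ} (hg : Measurable g) (hg' : Measurable g')
    (hc : ∀ q, |g q| ≤ c) (hc' : ∀ q, |g' q| ≤ c) (q : ℝ × (En n × En n)) :
    |duhamel τ ε f₀ g q - duhamel τ 0 f₀ g' q - (1 / τ) * (Real.exp (-q.1 / τ) *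
      ∫ s in Ioc 0 q.1, Real.exp (s / τ) * (g (s, q.2) - g' (s, q.2)))| ≤ ε * c / τ := by
  have hi : ∀ {h : ℝ × (En n × En n) → ℝ}, Measurable h → (∀ q, |h q| ≤ c) →
      IntegrableOn (fun s => Real.exp (-(q.1 - s) / τ) * h (s, q.2)) (Ioc 0 q.1) :=
    fun hm hb => integrableOn_exp_mul (by fun_prop) (fun s => hb _) _
  have hsub : Ioc 0 (q.1 - ε) ⊆ Ioc 0 q.1 := Ioc_subset_Ioc_right (sub_le_self _ hε)
  have e1 : Real.exp (-q.1 / τ) *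
      (∫ s in Ioc 0 q.1, Real.exp (s / τ) * (g (s, q.2) - g' (s, q.2))) =
      (∫ s in Ioc 0 q.1, Real.exp (-(q.1 - s) / τ) * g (s, q.2)) -
      ∫ s in Ioc 0 q.1, Real.exp (-(q.1 - s) / τ) * g' (s, q.2) := by
    rw [← integral_sub (hi hg hc) (hi hg' hc'), ← integral_const_mul]
    refine integral_congr_ae (Eventually.of_forall fun s => ?_)
    have : Real.exp (-(q.1 - s) / τ) = Real.exp (-q.1 / τ) * Real.exp (s / τ) := by
      rw [← Real.exp_add]; congr 1; ring
    simp only [this]; ring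
  have e2 := setIntegral_sdiff measurableSet_Ioc (hi hg hc) hsub
  have e3 : |∫ s in Ioc 0 q.1 \ Ioc 0 (q.1 - ε), Real.exp (-(q.1 - s) / τ) * g (s, q.2)| ≤
      c * ε := by
    have hss : Ioc 0 q.1 \ Ioc 0 (q.1 - ε) ⊆ Ioc (q.1 - ε) q.1 := fun s hs =>
      ⟨not_le.1 fun h => hs.2 ⟨hs.1.1, h⟩, hs.1.2⟩
    have hc0 : 0 ≤ c := (abs_nonneg _).trans (hc q)
    have hv : volume.real (Ioc 0 q.1 \ Ioc 0 (q.1 - ε)) ≤ ε := by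
      refine (measureReal_mono hss measure_Ioc_lt_top.ne).trans ?_
      rw [Real.volume_real_Ioc]
      simp [hε]
    rw [← Real.norm_eq_abs]
    refine (norm_setIntegral_le_of_norm_le_const
      ((measure_mono hss).trans_lt measure_Ioc_lt_top) (C := c) fun s hs => ?_).trans
      (mul_le_mul_of_nonneg_left hv hc0)
    rw [norm_mul, Real.norm_eq_abs, Real.norm_eq_abs, Real.abs_exp]
    have : Real.exp (-(q.1 - s) / τ) ≤ 1 := by
      rw [Real.exp_le_one_iff]
      exact div_nonpos_of_nonpos_of_nonneg (by linarith [hs.1.2]) hτ.le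
    calc _ ≤ 1 * c := mul_le_mul this (hc _) (abs_nonneg _) zero_le_one
      _ = c := one_mul c
  rw [e1]
  simp only [duhamel, sub_zero]
  have e4 : ∀ a b d e x : ℝ, a + 1 / τ * b - (a + 1 / τ * d) - 1 / τ * (e - d) =
      -((e - b) / τ) := by intros; ring
  rw [e4 _ _ _ _ 0, abs_neg, abs_div, abs_of_pos hτ, mul_comm ε]
  refine div_le_div_of_nonneg_right ?_ hτ.le
  rwa [← e2]

theorem one_add_norm_le_of_lt {v : En n} {R : ℝ} (hR : 1 ≤ R) (hv : R < ‖v‖) :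
    1 + ‖v‖ ≤ 2 / R * (1 + ‖v‖ ^ 2) := by
  rw [div_mul_eq_mul_div, le_div_iff₀ (by linarith)]
  nlinarith [sq_nonneg (‖v‖ - 1)]

theorem lintegral_tail_le {F : En n × En n → ℝ} (hF : Measurable F) {R t : ℝ} (hR : 1 ≤ R) :
    ∫⁻ x, ∫⁻ v in {v : En n | R < ‖v‖}, ENNReal.ofReal ((1 + ‖v‖) * F (x - t • v, v)) ≤
      ENNReal.ofReal (2 / R) * moment F := by
  have hS : MeasurableSet {v : En n | R < ‖v‖} := measurableSet_lt measurable_const (by fun_prop)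
  have hR0 : 0 ≤ 2 / R := by positivity
  calc _ ≤ ∫⁻ x, ∫⁻ v, ENNReal.ofReal (2 / R) *
          ENNReal.ofReal ((1 + ‖v‖ ^ 2) * F (x - t • v, v)) := by
        refine lintegral_mono fun x => ?_
        refine (setLIntegral_mono' hS fun v hv => ?_).trans (setLIntegral_le_lintegral _ _)
        rw [← ENNReal.ofReal_mul hR0, ← mul_assoc]
        by_cases h : 0 ≤ F (x - t • v, v)
        · exact ENNReal.ofReal_le_ofReal
            (mul_le_mul_of_nonneg_right (one_add_norm_le_of_lt hR hv) h)
        · rw [ENNReal.ofReal_of_nonpos (mul_nonpos_of_nonneg_of_nonpos (by positivity)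
            (not_le.1 h).le)]
          exact zero_le
    _ = ∫⁻ p : En n × En n, ENNReal.ofReal (2 / R) *
          ENNReal.ofReal ((1 + ‖p.2‖ ^ 2) * F (p.1 - t • p.2, p.2)) := by
        rw [Measure.volume_eq_prod, lintegral_prod _ (by fun_prop)]
    _ = _ := by
        rw [lintegral_const_mul _ (by fun_prop)]
        congr 1
        exact (measurePreserving_shear t).symm.lintegral_comp (f := fun p : En n × En n =>
          ENNReal.ofReal ((1 + ‖p.2‖ ^ 2) * F p)) (by fun_prop)

theorem enorm_integral_le_add_tail {f : En n → ℝ} {S : Set (En n)} (hS : MeasurableSet S) :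
    ‖∫ v, f v‖ₑ ≤ ‖∫ v in S, f v‖ₑ + ∫⁻ v in Sᶜ, ‖f v‖ₑ := by
  by_cases h : Integrable f
  · rw [← integral_add_compl hS h]
    exact (enorm_add_le _ _).trans (add_le_add le_rfl (enorm_integral_le_lintegral_enorm _))
  · rw [integral_undef h]; simp

/-- Weak convergence tested against bounded functions supported in bounded boxes. -/
def WeakConv (g : ℕ → ℝ × (En n × En n) → ℝ) (g' : ℝ × (En n × En n) → ℝ) : Prop :=
  ∀ (T R C : ℝ) (ψ : ℝ × (En n × En n) → ℝ), Measurable ψ → (∀ q, |ψ q| ≤ C) →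
    (∀ q, ψ q ≠ 0 → q ∈ box n T R) →
    Tendsto (fun k => ∫ q, ψ q * g k q) atTop (𝓝 (∫ q, ψ q * g' q))

/-- Measurable sources with values in `[0, c]` whose moments at almost every positive time are
at most `E₀`. -/
structure IsSource (c : ℝ) (E₀ : ENNReal) (g : ℝ × (En n × En n) → ℝ) : Prop where
  measurable : Measurable g
  nonneg : ∀ q, 0 ≤ g q
  le : ∀ q, g q ≤ c
  moment_le : ∀ᵐ t ∂volume.restrict (Ioi 0), moment (fun p => g (t, p)) ≤ E₀

theorem IsSource.abs_le {c : ℝ} {E₀ : ENNReal} {g : ℝ × (En n × En n) → ℝ}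
    (hg : IsSource c E₀ g) (q) : |g q| ≤ c := by
  rw [abs_of_nonneg (hg.nonneg q)]; exact hg.le q

theorem IsSource.moment_duhamel_le (hτ : 0 < τ) {c ε : ℝ} (hε : 0 ≤ ε) {E₀ : ENNReal}
    {g : ℝ × (En n × En n) → ℝ} (hg : IsSource c E₀ g) {f₀ : En n × En n → ℝ}
    (hf₀m : Measurable f₀) (hf₀ : ∀ p, 0 ≤ f₀ p) (hE : moment f₀ ≤ E₀) {t : ℝ} (ht : 0 ≤ t) :
    moment (fun p => duhamel τ ε f₀ g (t, p)) ≤ E₀ :=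
  _root_.moment_duhamel_le hτ hε hf₀m hg.measurable hf₀ hg.nonneg hg.le ht hE
    (ae_mono (Measure.restrict_mono Ioc_subset_Ioi_self le_rfl) hg.moment_le)

theorem tendsto_setLIntegral_velocity_average {g : ℕ → ℝ × (En n × En n) → ℝ}
    {g' ω : ℝ × (En n × En n) → ℝ} {c C T R : ℝ} {E₀ : ENNReal} (hT : 0 ≤ T)
    (hg : ∀ k, IsSource c E₀ (g k)) (hg' : IsSource c E₀ g') (hw : WeakConv g g')
    (hω : Measurable ω) (hωC : ∀ q, |ω q| ≤ C) (hωs : ∀ q, ω q ≠ 0 → q ∈ box n T R)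
    {K : Set (ℝ × En n)} (hK : volume K ≠ ⊤) :
    Tendsto (fun k => ∫⁻ q in K, ‖(Ioc 0 T).indicator 1 q.1 * ∫ v, ∫ s in Ioc 0 q.1,
      ω (s, (q.2 - q.1 • v, v)) * (g k (s, (q.2 - q.1 • v, v)) - g' (s, (q.2 - q.1 • v, v)))‖ₑ)
      atTop (𝓝 0) := by
  have hC0 : 0 ≤ C := (abs_nonneg _).trans (hωC 0)
  have hc0 : 0 ≤ c := (abs_nonneg _).trans (hg'.abs_le 0)
  let h : ℕ → ℝ × (En n × En n) → ℝ := fun k q => ω q * (g k q - g' q)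
  have hm : ∀ k, Measurable (h k) := fun k =>
    hω.mul ((hg k).measurable.sub hg'.measurable)
  have hb : ∀ k q, |h k q| ≤ C * c := fun k q => by
    simp only [h, abs_mul]
    refine mul_le_mul (hωC q) (abs_le.2 ⟨?_, ?_⟩) (abs_nonneg _) hC0 <;>
      linarith [(hg k).nonneg q, (hg k).le q, hg'.nonneg q, hg'.le q]
  have hs : ∀ k q, h k q ≠ 0 → q ∈ box n T R := fun k q hq => hωs q (left_ne_zero_of_mul hq)
  have key := tendsto_integral_sq_velocity_average hT hm hb hs fun t ht ψ hψ hψ1 => by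
    let Ψ : ℝ × (En n × En n) → ℝ := fun q => (Ioc 0 t).indicator 1 q.1 * ψ q.2 * ω q
    have hΨm : Measurable Ψ := by
      have : Measurable ((Ioc 0 t).indicator (1 : ℝ → ℝ)) :=
        measurable_one.indicator measurableSet_Ioc
      simp only [Ψ]; fun_prop
    have hΨb : ∀ q, |Ψ q| ≤ C := fun q => by
      simp only [Ψ, abs_mul]
      have e : |(Ioc 0 t).indicator (1 : ℝ → ℝ) q.1| ≤ 1 := by
        by_cases hq : q.1 ∈ Ioc 0 t <;> simp [hq]
      calc _ ≤ 1 * 1 * C := by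
            gcongr
            exacts [hψ1 _, hωC _]
        _ = C := by ring
    have hΨs : ∀ q, Ψ q ≠ 0 → q ∈ box n T R := fun q hq => hωs q (right_ne_zero_of_mul hq)
    have hi : ∀ {u : ℝ × (En n × En n) → ℝ}, IsSource c E₀ u →
        Integrable fun q => Ψ q * u q := fun {u} hu =>
      integrable_of_bounded_of_support (hΨm.mul hu.measurable) (volume_box_ne_top T R)
        (fun q hq => hΨs q (left_ne_zero_of_mul hq)) (C := C * c) fun q => by
          rw [abs_mul]
          exact mul_le_mul (hΨb q) (hu.abs_le q) (abs_nonneg _) hC0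
    have e1 := (hw T R C Ψ hΨm hΨb hΨs).sub_const (∫ q, Ψ q * g' q)
    rw [sub_self] at e1
    refine e1.congr fun k => ?_
    rw [← integral_sub (hi (hg k)) (hi hg')]
    refine integral_congr_ae (Eventually.of_forall fun q => ?_)
    simp only [Ψ, h]; ring
  have hIm : ∀ k, Measurable fun z : (ℝ × En n) × En n =>
      ∫ s in Ioc 0 z.1.1, h k (s, (z.1.2 - z.1.1 • z.2, z.2)) := fun k => by
    have e := measurable_setIntegral_Ioc (hm k) 0
    have e2 : Measurable fun z : (ℝ × En n) × En n =>
      (z.1.1, (z.1.2 - z.1.1 • z.2, z.2)) := by fun_prop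
    simpa [Function.comp_def] using e.comp e2
  have h1m : Measurable fun q : ℝ × En n => (Ioc 0 T).indicator (1 : ℝ → ℝ) q.1 :=
    (measurable_one.indicator measurableSet_Ioc).comp measurable_fst
  have hBm : ∀ k, Measurable fun q : ℝ × En n => (Ioc 0 T).indicator 1 q.1 *
      ∫ v, ∫ s in Ioc 0 q.1, h k (s, (q.2 - q.1 • v, v)) := fun k =>
    h1m.mul (StronglyMeasurable.integral_prod_right' (hIm k).stronglyMeasurable).measurable
  refine tendsto_setLIntegral_enorm_of_integral_sq hK hBm (fun k => ?_) key
  let V := volume.real (Metric.closedBall (0 : En n) R)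
  have hIs : ∀ q : ℝ × En n, q.1 ∈ Ioc 0 T → ∀ v,
      (∫ s in Ioc 0 q.1, h k (s, (q.2 - q.1 • v, v))) ≠ 0 → ‖q.2 - q.1 • v‖ ≤ R ∧ ‖v‖ ≤ R := by
    intro q _ v hne
    obtain ⟨s, hs'⟩ : ∃ s, h k (s, (q.2 - q.1 • v, v)) ≠ 0 := by
      by_contra! hcon
      exact hne (by simp [hcon])
    have := (mem_box.1 (hs k _ hs')).2
    rw [mem_closedBall_zero_iff, Prod.norm_def] at this
    exact ⟨(le_max_left _ _).trans this, (le_max_right _ _).trans this⟩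
  have hIb : ∀ q : ℝ × En n, q.1 ∈ Ioc 0 T → ∀ v,
      |∫ s in Ioc 0 q.1, h k (s, (q.2 - q.1 • v, v))| ≤ C * c * T := by
    intro q hq v
    rw [← Real.norm_eq_abs]
    refine (norm_setIntegral_le_of_norm_le_const measure_Ioc_lt_top
      fun s _ => hb k (s, (q.2 - q.1 • v, v))).trans ?_
    rw [Real.volume_real_Ioc_of_le hq.1.le, sub_zero]
    exact mul_le_mul_of_nonneg_left hq.2 (by positivity)
  refine integrable_of_bounded_of_support ((hBm k).pow_const 2)
    (S := Ioc 0 T ×ˢ Metric.closedBall 0 (R + T * R)) ?_ (fun q hq => ?_)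
    (C := (C * c * T * V) ^ 2) fun q => ?_
  · rw [Measure.volume_eq_prod, Measure.prod_prod]
    exact ENNReal.mul_ne_top measure_Ioc_lt_top.ne measure_closedBall_lt_top.ne
  · have hq' := pow_ne_zero_iff two_ne_zero |>.1 hq
    have hq1 : q.1 ∈ Ioc 0 T := by
      by_contra hcon
      exact left_ne_zero_of_mul hq' (indicator_of_notMem hcon _)
    refine ⟨hq1, ?_⟩
    obtain ⟨v, hv⟩ : ∃ v, (∫ s in Ioc 0 q.1, h k (s, (q.2 - q.1 • v, v))) ≠ 0 := by
      by_contra! hcon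
      exact right_ne_zero_of_mul hq' (integral_eq_zero_of_ae (Eventually.of_forall hcon))
    have := hIs q hq1 v hv
    simpa using norm_le_of_norm_transport_le hq1 this.1 this.2
  · rw [abs_pow]
    refine pow_le_pow_left₀ (abs_nonneg _) ?_ 2
    by_cases hq : q.1 ∈ Ioc 0 T
    · rw [indicator_of_mem hq, Pi.one_apply, one_mul]
      exact abs_integral_le_of_support (hIb q hq) fun v hv => (hIs q hq v hv).2
    · rw [indicator_of_notMem hq, zero_mul, abs_zero]
      positivity

theorem tendsto_setLIntegral_low_velocity (hτ : 0 < τ) {g : ℕ → ℝ × (En n × En n) → ℝ}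
    {g' : ℝ × (En n × En n) → ℝ} {c T X R : ℝ} {E₀ : ENNReal} (hT : 0 ≤ T) (hR : 0 ≤ R)
    (hg : ∀ k, IsSource c E₀ (g k)) (hg' : IsSource c E₀ g') (hw : WeakConv g g')
    {ε : ℕ → ℝ} (hε : ∀ k, 0 ≤ ε k) (hε0 : Tendsto ε atTop (𝓝 0))
    {f₀ : En n × En n → ℝ} (hf₀m : Measurable f₀) (hf₀ : ∀ p, 0 ≤ f₀ p) (hf₀c : ∀ p, f₀ p ≤ c)
    {φ : En n → ℝ} (hφm : Measurable φ) (hφ : ∀ v, |φ v| ≤ 1 + ‖v‖) :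
    Tendsto (fun k => ∫⁻ q in Ioc 0 T ×ˢ Metric.closedBall 0 X,
      ‖∫ v in Metric.closedBall 0 R, φ v * (duhamel τ (ε k) f₀ (g k) (q.1, (q.2 - q.1 • v, v)) -
        duhamel τ 0 f₀ g' (q.1, (q.2 - q.1 • v, v)))‖ₑ) atTop (𝓝 0) := by
  have hc0 : 0 ≤ c := (abs_nonneg _).trans (hg'.abs_le 0)
  set K : Set (ℝ × En n) := Ioc 0 T ×ˢ Metric.closedBall 0 X with hKdef
  have hKm : MeasurableSet K := measurableSet_Ioc.prod Metric.isClosed_closedBall.measurableSet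
  have hK : volume K ≠ ⊤ := by
    rw [hKdef, Measure.volume_eq_prod, Measure.prod_prod]
    exact ENNReal.mul_ne_top measure_Ioc_lt_top.ne measure_closedBall_lt_top.ne
  set R₁ := max (X + T * R) R with hR₁
  set S : Set (En n) := Metric.closedBall 0 R with hS
  have hSm : MeasurableSet S := Metric.isClosed_closedBall.measurableSet
  have hSf : volume S ≠ ⊤ := measure_closedBall_lt_top.ne
  let ω : ℝ × (En n × En n) → ℝ := (box n T R₁).indicator fun q =>
    Real.exp (q.1 / τ) * S.indicator φ q.2.2
  have hφS : ∀ v, |S.indicator φ v| ≤ 1 + R := fun v => by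
    by_cases hv : v ∈ S
    · rw [indicator_of_mem hv]
      have := mem_closedBall_zero_iff.1 hv
      linarith [hφ v]
    · rw [indicator_of_notMem hv, abs_zero]; linarith
  have hωm : Measurable ω := by
    have := hφm.indicator hSm
    exact Measurable.indicator (by fun_prop) (measurableSet_box _ _)
  have hωb : ∀ q, |ω q| ≤ Real.exp (T / τ) * (1 + R) := fun q => by
    by_cases hq : q ∈ box n T R₁
    · simp only [ω, indicator_of_mem hq, abs_mul, Real.abs_exp]
      have := (mem_box.1 hq).1.2
      have := hφS q.2.2
      gcongr
    · simp only [ω, indicator_of_notMem hq, abs_zero]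
      positivity
  have hωs : ∀ q, ω q ≠ 0 → q ∈ box n T R₁ := fun q hq => by
    by_contra hcon
    exact hq (indicator_of_notMem hcon _)
  have key := tendsto_setLIntegral_velocity_average hT hg hg' hw
    hωm hωb hωs hK
  set B : ℕ → ℝ × En n → ℝ := fun k q => (Ioc 0 T).indicator 1 q.1 * ∫ v, ∫ s in Ioc 0 q.1,
    ω (s, (q.2 - q.1 • v, v)) *
      (g k (s, (q.2 - q.1 • v, v)) - g' (s, (q.2 - q.1 • v, v))) with hB
  set V := volume.real S
  have hpt : ∀ k, ∀ q ∈ K, ‖∫ v in S, φ v * (duhamel τ (ε k) f₀ (g k) (q.1, (q.2 - q.1 • v, v)) -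
      duhamel τ 0 f₀ g' (q.1, (q.2 - q.1 • v, v)))‖ₑ ≤
      ENNReal.ofReal (1 / τ) * ‖B k q‖ₑ + ENNReal.ofReal ((1 + R) * (ε k * c / τ) * V) := by
    intro k q hq
    have hq1 : q.1 ∈ Ioc 0 T := hq.1
    have hq2 : ‖q.2‖ ≤ X := mem_closedBall_zero_iff.1 hq.2
    let I : En n → ℝ := fun v => ∫ s in Ioc 0 q.1, Real.exp (s / τ) *
      (g k (s, (q.2 - q.1 • v, v)) - g' (s, (q.2 - q.1 • v, v)))
    let D : En n → ℝ := fun v => duhamel τ (ε k) f₀ (g k) (q.1, (q.2 - q.1 • v, v)) -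
      duhamel τ 0 f₀ g' (q.1, (q.2 - q.1 • v, v))
    have hBI : B k q = ∫ v in S, φ v * I v := by
      simp only [hB]
      rw [indicator_of_mem hq1, Pi.one_apply, one_mul, ← integral_indicator hSm]
      refine integral_congr_ae (Eventually.of_forall fun v => ?_)
      by_cases hv : v ∈ S
      · simp only [indicator_of_mem hv, I]
        rw [← integral_const_mul]
        refine setIntegral_congr_fun measurableSet_Ioc fun s hs => ?_
        have hv' : ‖v‖ ≤ R := mem_closedBall_zero_iff.1 hv
        have hmem : ((s, (q.2 - q.1 • v, v)) : ℝ × (En n × En n)) ∈ box n T R₁ := by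
          refine mem_box.2 ⟨⟨hs.1, hs.2.trans hq1.2⟩, ?_⟩
          rw [mem_closedBall_zero_iff, Prod.norm_def]
          refine max_le ?_ (hv'.trans (le_max_right _ _))
          refine le_trans ?_ (le_max_left _ _)
          calc ‖q.2 - q.1 • v‖ ≤ ‖q.2‖ + ‖q.1 • v‖ := norm_sub_le _ _
            _ ≤ X + T * R := by
              rw [norm_smul, Real.norm_eq_abs, abs_of_pos hq1.1]
              exact add_le_add hq2 (mul_le_mul hq1.2 hv' (norm_nonneg _) hT)
        simp only [ω, indicator_of_mem hmem, indicator_of_mem hv]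
        ring
      · rw [indicator_of_notMem hv]
        refine setIntegral_eq_zero_of_forall_eq_zero fun s _ => ?_
        have : ω (s, (q.2 - q.1 • v, v)) = 0 := by
          simp [ω, hv]
        rw [this, zero_mul]
    have hcomp : Measurable fun v : En n => ((q.1, (q.2 - q.1 • v, v)) : ℝ × (En n × En n)) := by
      fun_prop
    have hDm : Measurable D :=
      ((measurable_duhamel hf₀m (hg k).measurable).comp hcomp).sub
        ((measurable_duhamel hf₀m hg'.measurable).comp hcomp)
    have hIm : Measurable I := by
      have e := measurable_setIntegral_Ioc (h := fun z : ℝ × (En n × En n) =>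
        Real.exp (z.1 / τ) * (g k z - g' z)) (by
          have := (hg k).measurable
          have := hg'.measurable
          fun_prop) 0
      simpa [Function.comp_def] using e.comp hcomp
    have hDI : ∀ v, |D v - (1 / τ) * (Real.exp (-q.1 / τ) * I v)| ≤ ε k * c / τ := fun v =>
      abs_duhamel_sub_le hτ (hε k) (hg k).measurable hg'.measurable (hg k).abs_le hg'.abs_le
        (q.1, (q.2 - q.1 • v, v))
    have hDc : ∀ v, |D v| ≤ c := fun v => by
      have a1 := duhamel_le hτ (hε k) (hg k).measurable hf₀c (hg k).nonneg (hg k).le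
        (q := (q.1, (q.2 - q.1 • v, v))) hq1.1.le
      have a2 := duhamel_le hτ le_rfl hg'.measurable hf₀c hg'.nonneg hg'.le
        (q := (q.1, (q.2 - q.1 • v, v))) hq1.1.le
      have a3 := duhamel_nonneg hτ (ε := ε k) hf₀ (hg k).nonneg (q.1, (q.2 - q.1 • v, v))
      have a4 := duhamel_nonneg hτ (ε := 0) hf₀ hg'.nonneg (q.1, (q.2 - q.1 • v, v))
      exact abs_le.2 ⟨by simp only [D]; linarith, by simp only [D]; linarith⟩
    have hφR : ∀ v ∈ S, |φ v| ≤ 1 + R := fun v hv => by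
      simpa [indicator_of_mem hv] using hφS v
    have hint : ∀ {u : En n → ℝ} {A : ℝ}, Measurable u → (∀ v, |u v| ≤ A) →
        IntegrableOn (fun v => φ v * u v) S := fun {u A} hu hA =>
      Measure.integrableOn_of_bounded hSf (hφm.mul hu).aestronglyMeasurable
        (M := (1 + R) * A) (by
          refine (ae_restrict_iff' hSm).2 (Eventually.of_forall fun v hv => ?_)
          rw [norm_mul, Real.norm_eq_abs, Real.norm_eq_abs]
          exact mul_le_mul (hφR v hv) (hA v) (abs_nonneg _) (by linarith))
    have hdm : Measurable fun v => D v - (1 / τ) * (Real.exp (-q.1 / τ) * I v) := by fun_prop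
    have hsplit : ∫ v in S, φ v * D v = (1 / τ) * Real.exp (-q.1 / τ) * B k q +
        ∫ v in S, φ v * (D v - (1 / τ) * (Real.exp (-q.1 / τ) * I v)) := by
      have e := integral_sub (hint hDm hDc) (hint hdm hDI)
      have e' : ∫ v in S, (φ v * D v - φ v * (D v - (1 / τ) * (Real.exp (-q.1 / τ) * I v))) =
          (1 / τ) * Real.exp (-q.1 / τ) * B k q := by
        rw [hBI, ← integral_const_mul]
        refine integral_congr_ae (Eventually.of_forall fun v => ?_)
        ring
      rw [e'] at e
      linarith
    have hrest : |∫ v in S, φ v * (D v - (1 / τ) * (Real.exp (-q.1 / τ) * I v))| ≤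
        (1 + R) * (ε k * c / τ) * V := by
      rw [← Real.norm_eq_abs]
      refine norm_setIntegral_le_of_norm_le_const hSf.lt_top fun v hv => ?_
      rw [norm_mul, Real.norm_eq_abs, Real.norm_eq_abs]
      exact mul_le_mul (hφR v hv) (hDI v) (abs_nonneg _) (by linarith)
    change ‖∫ v in S, φ v * D v‖ₑ ≤ _
    rw [hsplit]
    refine (enorm_add_le _ _).trans (add_le_add ?_ ?_)
    · rw [enorm_mul]
      refine mul_le_mul_left ?_ _
      rw [Real.enorm_eq_ofReal (by positivity)]
      refine ENNReal.ofReal_le_ofReal ?_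
      have : Real.exp (-q.1 / τ) ≤ 1 := by
        rw [Real.exp_le_one_iff]
        exact div_nonpos_of_nonpos_of_nonneg (by linarith [hq1.1]) hτ.le
      exact mul_le_of_le_one_right (by positivity) this
    · rw [Real.enorm_eq_ofReal_abs]
      exact ENNReal.ofReal_le_ofReal hrest
  have hlim : Tendsto (fun k => ENNReal.ofReal (1 / τ) * (∫⁻ q in K, ‖B k q‖ₑ) +
      ENNReal.ofReal ((1 + R) * (ε k * c / τ) * V) * volume K) atTop (𝓝 0) := by
    have a1 := ENNReal.Tendsto.const_mul (a := ENNReal.ofReal (1 / τ)) key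
      (Or.inr ENNReal.ofReal_ne_top)
    have a2 : Tendsto (fun k => (1 + R) * (ε k * c / τ) * V) atTop
        (𝓝 ((1 + R) * (0 * c / τ) * V)) :=
      (((hε0.mul_const c).div_const τ).const_mul _).mul_const _
    have a3 := ENNReal.Tendsto.mul_const (b := volume K) (ENNReal.tendsto_ofReal a2) (Or.inr hK)
    simpa only [mul_zero, zero_mul, zero_div, ENNReal.ofReal_zero, add_zero] using a1.add a3
  refine tendsto_of_tendsto_of_tendsto_of_le_of_le tendsto_const_nhds hlim (fun k => zero_le)
    fun k => ?_
  refine (setLIntegral_mono' hKm (hpt k)).trans ?_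
  rw [lintegral_add_right _ measurable_const, setLIntegral_const,
    lintegral_const_mul' _ _ ENNReal.ofReal_ne_top]

theorem setLIntegral_tail_le {F : ℝ × (En n × En n) → ℝ} (hF : Measurable F) {E₀ : ENNReal}
    {R T X : ℝ} (hR : 1 ≤ R) (hE : ∀ t ∈ Ioc 0 T, moment (fun p => F (t, p)) ≤ E₀) :
    ∫⁻ q in Ioc 0 T ×ˢ Metric.closedBall (0 : En n) X, ∫⁻ v in {v : En n | R < ‖v‖},
      ENNReal.ofReal ((1 + ‖v‖) * F (q.1, (q.2 - q.1 • v, v))) ≤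
      ENNReal.ofReal (2 / R) * E₀ * ENNReal.ofReal T := by
  have hm : Measurable fun q : ℝ × En n => ∫⁻ v in {v : En n | R < ‖v‖},
      ENNReal.ofReal ((1 + ‖v‖) * F (q.1, (q.2 - q.1 • v, v))) :=
    Measurable.lintegral_prod_right' (f := fun z : (ℝ × En n) × En n =>
      ENNReal.ofReal ((1 + ‖z.2‖) * F (z.1.1, (z.1.2 - z.1.1 • z.2, z.2)))) (by fun_prop)
  rw [Measure.volume_eq_prod, ← Measure.prod_restrict, lintegral_prod _ hm.aemeasurable]
  calc _ ≤ ∫⁻ t in Ioc 0 T, ENNReal.ofReal (2 / R) * E₀ := by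
        refine setLIntegral_mono' measurableSet_Ioc fun t ht => ?_
        refine (setLIntegral_le_lintegral _ _).trans ?_
        refine (lintegral_tail_le (F := fun p => F (t, p)) (by fun_prop) hR).trans ?_
        exact mul_le_mul_right (hE t ht) _
    _ = _ := by rw [setLIntegral_const, Real.volume_Ioc, sub_zero]

theorem tendsto_setLIntegral_duhamel_average (hτ : 0 < τ) {g : ℕ → ℝ × (En n × En n) → ℝ}
    {g' : ℝ × (En n × En n) → ℝ} {c T X : ℝ} {E₀ : ENNReal} (hE₀ : E₀ ≠ ⊤) (hT : 0 ≤ T)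
    (hg : ∀ k, IsSource c E₀ (g k)) (hg' : IsSource c E₀ g') (hw : WeakConv g g')
    {ε : ℕ → ℝ} (hε : ∀ k, 0 ≤ ε k) (hε0 : Tendsto ε atTop (𝓝 0))
    {f₀ : En n × En n → ℝ} (hf₀m : Measurable f₀) (hf₀ : ∀ p, 0 ≤ f₀ p) (hf₀c : ∀ p, f₀ p ≤ c)
    (hf₀E : moment f₀ ≤ E₀)
    {φ : En n → ℝ} (hφm : Measurable φ) (hφ : ∀ v, |φ v| ≤ 1 + ‖v‖) :
    Tendsto (fun k => ∫⁻ q in Ioc 0 T ×ˢ Metric.closedBall 0 X,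
      ‖∫ v, φ v * (duhamel τ (ε k) f₀ (g k) (q.1, (q.2 - q.1 • v, v)) -
        duhamel τ 0 f₀ g' (q.1, (q.2 - q.1 • v, v)))‖ₑ) atTop (𝓝 0) := by
  set A := 2 * (E₀ * ENNReal.ofReal T) with hA
  have hA' : A ≠ ⊤ := ENNReal.mul_ne_top (by simp) (ENNReal.mul_ne_top hE₀ ENNReal.ofReal_ne_top)
  have htail : ∀ R : ℝ, 1 ≤ R → ∀ k, (∫⁻ q in Ioc 0 T ×ˢ Metric.closedBall 0 X,
      ‖∫ v, φ v * (duhamel τ (ε k) f₀ (g k) (q.1, (q.2 - q.1 • v, v)) -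
        duhamel τ 0 f₀ g' (q.1, (q.2 - q.1 • v, v)))‖ₑ) ≤
      (∫⁻ q in Ioc 0 T ×ˢ Metric.closedBall 0 X, ‖∫ v in Metric.closedBall 0 R,
        φ v * (duhamel τ (ε k) f₀ (g k) (q.1, (q.2 - q.1 • v, v)) -
        duhamel τ 0 f₀ g' (q.1, (q.2 - q.1 • v, v)))‖ₑ) + ENNReal.ofReal (2 / R) * A := by
    intro R hR k
    have hcompl : (Metric.closedBall (0 : En n) R)ᶜ = {v | R < ‖v‖} := by
      ext v; simp
    have hm1 := measurable_duhamel (τ := τ) (ε := ε k) hf₀m (hg k).measurable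
    have hm2 := measurable_duhamel (τ := τ) (ε := 0) hf₀m hg'.measurable
    have hmt : ∀ {F : ℝ × (En n × En n) → ℝ}, Measurable F →
        Measurable fun q : ℝ × En n => ∫⁻ v in {v : En n | R < ‖v‖},
          ENNReal.ofReal ((1 + ‖v‖) * F (q.1, (q.2 - q.1 • v, v))) := fun {F} hF =>
      Measurable.lintegral_prod_right' (f := fun z : (ℝ × En n) × En n =>
        ENNReal.ofReal ((1 + ‖z.2‖) * F (z.1.1, (z.1.2 - z.1.1 • z.2, z.2)))) (by fun_prop)
    have hpt : ∀ q : ℝ × En n, ‖∫ v, φ v * (duhamel τ (ε k) f₀ (g k) (q.1, (q.2 - q.1 • v, v)) -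
        duhamel τ 0 f₀ g' (q.1, (q.2 - q.1 • v, v)))‖ₑ ≤
        ‖∫ v in Metric.closedBall 0 R,
          φ v * (duhamel τ (ε k) f₀ (g k) (q.1, (q.2 - q.1 • v, v)) -
          duhamel τ 0 f₀ g' (q.1, (q.2 - q.1 • v, v)))‖ₑ +
        ((∫⁻ v in {v : En n | R < ‖v‖}, ENNReal.ofReal
          ((1 + ‖v‖) * duhamel τ (ε k) f₀ (g k) (q.1, (q.2 - q.1 • v, v)))) +
        ∫⁻ v in {v : En n | R < ‖v‖}, ENNReal.ofReal
          ((1 + ‖v‖) * duhamel τ 0 f₀ g' (q.1, (q.2 - q.1 • v, v)))) := by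
      intro q
      refine (enorm_integral_le_add_tail
        (Metric.isClosed_closedBall (x := (0 : En n)) (ε := R)).measurableSet).trans ?_
      refine add_le_add le_rfl ?_
      rw [hcompl, ← lintegral_add_left (by fun_prop)]
      refine lintegral_mono fun v => ?_
      have a3 := duhamel_nonneg hτ (ε := ε k) hf₀ (hg k).nonneg (q.1, (q.2 - q.1 • v, v))
      have a4 := duhamel_nonneg hτ (ε := 0) hf₀ hg'.nonneg (q.1, (q.2 - q.1 • v, v))
      rw [← ENNReal.ofReal_add (by positivity) (by positivity), Real.enorm_eq_ofReal_abs, abs_mul,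
        ← mul_add]
      refine ENNReal.ofReal_le_ofReal (mul_le_mul (hφ v) ?_ (abs_nonneg _) (by positivity))
      exact abs_le.2 ⟨by linarith, by linarith⟩
    refine (lintegral_mono hpt).trans ?_
    have hm12 : Measurable fun q : ℝ × En n => (∫⁻ v in {v : En n | R < ‖v‖}, ENNReal.ofReal
          ((1 + ‖v‖) * duhamel τ (ε k) f₀ (g k) (q.1, (q.2 - q.1 • v, v)))) +
        ∫⁻ v in {v : En n | R < ‖v‖}, ENNReal.ofReal
          ((1 + ‖v‖) * duhamel τ 0 f₀ g' (q.1, (q.2 - q.1 • v, v))) := (hmt hm1).add (hmt hm2)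
    rw [lintegral_add_right _ hm12, lintegral_add_left (hmt hm1)]
    refine add_le_add le_rfl ?_
    have b1 := setLIntegral_tail_le (X := X) (T := T) hm1 hR fun t ht =>
      (hg k).moment_duhamel_le hτ (hε k) hf₀m hf₀ hf₀E ht.1.le
    have b2 := setLIntegral_tail_le (X := X) (T := T) hm2 hR fun t ht =>
      hg'.moment_duhamel_le hτ le_rfl hf₀m hf₀ hf₀E ht.1.le
    refine (add_le_add b1 b2).trans (le_of_eq ?_)
    rw [hA]; ring
  rw [ENNReal.tendsto_nhds_zero]
  intro δ hδ
  have hlim : Tendsto (fun R : ℝ => ENNReal.ofReal (2 / R) * A) atTop (𝓝 0) := by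
    have := ENNReal.Tendsto.mul_const (b := A) (ENNReal.tendsto_ofReal
      (tendsto_const_nhds.div_atTop tendsto_id : Tendsto (fun R : ℝ => 2 / R) atTop (𝓝 0)))
      (Or.inr hA')
    simpa only [ENNReal.ofReal_zero, zero_mul] using this
  obtain ⟨R, hRδ, hR⟩ := ((ENNReal.tendsto_nhds_zero.1 hlim (δ / 2)
    (ENNReal.half_pos hδ.ne')).and (eventually_ge_atTop 1)).exists
  have hlow := tendsto_setLIntegral_low_velocity (X := X) hτ hT (zero_le_one.trans hR) hg hg' hw
    hε hε0 hf₀m hf₀ hf₀c hφm hφ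
  filter_upwards [ENNReal.tendsto_nhds_zero.1 hlow (δ / 2) (ENNReal.half_pos hδ.ne')] with k hk
  calc _ ≤ _ := htail R hR k
    _ ≤ δ / 2 + δ / 2 := add_le_add hk hRδ
    _ = δ := ENNReal.add_halves δ

end StrongConvergence

section LimitEquation

variable {n : ℕ} {κ τ : ℝ}

theorem exists_subseq_ae_tendsto_of_lintegral {α ι : Type*} [Fintype ι] [MeasurableSpace α]
    {μ : Measure α} {f : ι → ℕ → α → ℝ} (hf : ∀ i k, Measurable (f i k))
    (h : ∀ i, Tendsto (fun k => ∫⁻ x, ‖f i k x‖ₑ ∂μ) atTop (𝓝 0)) :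
    ∃ σ : ℕ → ℕ, StrictMono σ ∧
      ∀ᵐ x ∂μ, ∀ i, Tendsto (fun k => f i (σ k) x) atTop (𝓝 0) := by
  have hm : ∀ k, Measurable fun x => ∑ i, |f i k x| := fun k =>
    Finset.measurable_sum _ fun i _ => (hf i k).abs
  have hlim : Tendsto (fun k => eLpNorm ((fun x => ∑ i, |f i k x|) - fun _ => 0) 1 μ)
      atTop (𝓝 0) := by
    have e : ∀ k, eLpNorm ((fun x => ∑ i, |f i k x|) - fun _ => 0) 1 μ =
        ∑ i, ∫⁻ x, ‖f i k x‖ₑ ∂μ := fun k => by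
      rw [eLpNorm_one_eq_lintegral_enorm, ← lintegral_finsetSum _ fun i _ => (hf i k).enorm]
      refine lintegral_congr fun x => ?_
      simp only [Pi.sub_apply, sub_zero]
      rw [Real.enorm_eq_ofReal (Finset.sum_nonneg fun i _ => abs_nonneg _),
        ENNReal.ofReal_sum_of_nonneg fun i _ => abs_nonneg _]
      simp only [Real.enorm_eq_ofReal_abs]
    simp only [e]
    simpa using tendsto_finsetSum Finset.univ fun i _ => h i
  obtain ⟨σ, hσ, hae⟩ := (tendstoInMeasure_of_tendsto_eLpNorm one_ne_zero
    (fun k => (hm k).aestronglyMeasurable) aestronglyMeasurable_const hlim).exists_seq_tendsto_ae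
  refine ⟨σ, hσ, hae.mono fun x hx i => ?_⟩
  exact squeeze_zero_norm (fun k => Finset.single_le_sum
    (f := fun i => |f i (σ k) x|) (fun j _ => abs_nonneg _) (Finset.mem_univ i)) hx

theorem ae_integrable_profile {F : ℝ × (En n × En n) → ℝ} (hF : Measurable F) {E₀ : ENNReal}
    (hE₀ : E₀ ≠ ⊤) {T X : ℝ} (h0 : ∀ t ∈ Ioc 0 T, ∀ p, 0 ≤ F (t, p))
    (hE : ∀ t ∈ Ioc 0 T, moment (fun p => F (t, p)) ≤ E₀) :
    ∀ᵐ q ∂volume.restrict (Ioc 0 T ×ˢ Metric.closedBall (0 : En n) X),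
      Integrable (fun v => F (q.1, (q.2 - q.1 • v, v))) ∧
      Integrable (fun v => F (q.1, (q.2 - q.1 • v, v)) • v) := by
  have hm : Measurable fun q : ℝ × En n => ∫⁻ v,
      ENNReal.ofReal ((1 + ‖v‖ ^ 2) * F (q.1, (q.2 - q.1 • v, v))) :=
    Measurable.lintegral_prod_right' (f := fun z : (ℝ × En n) × En n =>
      ENNReal.ofReal ((1 + ‖z.2‖ ^ 2) * F (z.1.1, (z.1.2 - z.1.1 • z.2, z.2)))) (by fun_prop)
  have hle : ∫⁻ q in Ioc 0 T ×ˢ Metric.closedBall (0 : En n) X, ∫⁻ v,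
      ENNReal.ofReal ((1 + ‖v‖ ^ 2) * F (q.1, (q.2 - q.1 • v, v))) ≤ E₀ * ENNReal.ofReal T := by
    rw [Measure.volume_eq_prod, ← Measure.prod_restrict, lintegral_prod _ hm.aemeasurable]
    calc _ ≤ ∫⁻ t in Ioc 0 T, E₀ := by
          refine setLIntegral_mono' measurableSet_Ioc fun t ht => ?_
          refine (setLIntegral_le_lintegral _ _).trans (le_trans (le_of_eq ?_) (hE t ht))
          rw [← lintegral_prod (fun p : En n × En n =>
            ENNReal.ofReal ((1 + ‖p.2‖ ^ 2) * F (t, (p.1 - t • p.2, p.2)))) (by fun_prop)]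
          exact (measurePreserving_shear t).symm.lintegral_comp (f := fun p : En n × En n =>
            ENNReal.ofReal ((1 + ‖p.2‖ ^ 2) * F (t, p))) (by fun_prop)
      _ = _ := by rw [setLIntegral_const, Real.volume_Ioc, sub_zero]
  have hfin := ae_lt_top hm
    (hle.trans_lt (ENNReal.mul_lt_top hE₀.lt_top ENNReal.ofReal_lt_top)).ne
  filter_upwards [hfin, ae_restrict_mem
    (measurableSet_Ioc.prod Metric.isClosed_closedBall.measurableSet)] with q hq hqK
  have hpm : Measurable fun v => F (q.1, (q.2 - q.1 • v, v)) := by fun_prop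
  have h0' : ∀ v, 0 ≤ F (q.1, (q.2 - q.1 • v, v)) := fun v => h0 _ hqK.1 _
  have hi : Integrable fun v => (1 + ‖v‖ ^ 2) * F (q.1, (q.2 - q.1 • v, v)) := by
    refine ⟨(by fun_prop : Measurable _).aestronglyMeasurable, ?_⟩
    rw [hasFiniteIntegral_iff_ofReal (Eventually.of_forall fun v =>
      mul_nonneg (by positivity) (h0' v))]
    exact hq
  refine ⟨hi.mono' hpm.aestronglyMeasurable (Eventually.of_forall fun v => ?_),
    hi.mono' (by fun_prop : Measurable _).aestronglyMeasurable (Eventually.of_forall fun v => ?_)⟩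
  · rw [Real.norm_of_nonneg (h0' v)]
    nlinarith [h0' v, sq_nonneg ‖v‖, mul_nonneg (sq_nonneg ‖v‖) (h0' v)]
  · rw [norm_smul, Real.norm_of_nonneg (h0' v), mul_comm]
    exact mul_le_mul_of_nonneg_right (by nlinarith [sq_nonneg (‖v‖ - 1), sq_nonneg ‖v‖]) (h0' v)

theorem tendsto_setIntegral_MaxwEOf_sub (hn : 1 ≤ n) (hκ : 0 < κ) {p : ℕ → En n → ℝ}
    {p' : En n → ℝ} (h0 : ∀ k v, 0 ≤ p k v) (hi : ∀ k, Integrable (p k))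
    (hi' : Integrable p') (hs : ∀ k, Integrable fun v => p k v • v)
    (hs' : Integrable fun v => p' v • v)
    (hρ : Tendsto (fun k => ∫ v, (p k v - p' v)) atTop (𝓝 0))
    (hm : ∀ i, Tendsto (fun k => ∫ v : En n, v i * (p k v - p' v)) atTop (𝓝 0)) (V : ℝ) :
    Tendsto (fun k => ∫ v in Metric.closedBall 0 V,
      |MaxwEOf n κ (p k) v - MaxwEOf n κ p' v|) atTop (𝓝 0) := by
  have hd : Tendsto (fun k => densF n (p k)) atTop (𝓝 (densF n p')) := by
    refine (tendsto_sub_nhds_zero_iff).1 (hρ.congr fun k => ?_)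
    exact integral_sub (hi k) hi'
  have hM : Tendsto (fun k => ∫ v, p k v • v) atTop (𝓝 (∫ v, p' v • v)) := by
    have hco : ∀ {r : En n → ℝ}, Integrable (fun v => r v • v) → ∀ i,
        (∫ v, r v • v) i = ∫ v : En n, v i * r v := fun {r} hr i => by
      have e := (EuclideanSpace.proj (𝕜 := ℝ) i).integral_comp_comm hr
      refine e.symm.trans ?_
      refine integral_congr_ae (Eventually.of_forall fun v => ?_)
      simp [mul_comm]
    have hci : ∀ {r : En n → ℝ}, Integrable (fun v => r v • v) → ∀ i,
        Integrable fun v : En n => v i * r v := fun {r} hr i => by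
      have e := (EuclideanSpace.proj (𝕜 := ℝ) i).integrable_comp hr
      refine e.congr (Eventually.of_forall fun v => ?_)
      simp [mul_comm]
    have hcoord : ∀ i, Tendsto (fun k => (∫ v, p k v • v) i) atTop
        (𝓝 ((∫ v, p' v • v) i)) := fun i => by
      refine (tendsto_sub_nhds_zero_iff).1 ((hm i).congr fun k => ?_)
      rw [hco (hs k), hco hs', ← integral_sub (hci (hs k) i) (hci hs' i)]
      refine integral_congr_ae (Eventually.of_forall fun v => ?_)
      ring
    exact ((PiLp.continuous_toLp 2 fun _ : Fin n => ℝ).tendsto _).comp (tendsto_pi_nhds.2 hcoord)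
  refine tendsto_setLIntegral_MaxwE_sub hn hκ
    (fun k => integral_nonneg (h0 k)) hd (fun hne => ?_) V
  have e : (fun k => (densF n (p k))⁻¹ • ∫ v, p k v • v) =ᶠ[atTop] fun k => bulkF n (p k) := by
    filter_upwards [hd.eventually_ne hne] with k hk
    rw [bulkF, if_neg hk]
  rw [show bulkF n p' = (densF n p')⁻¹ • ∫ v, p' v • v by rw [bulkF, if_neg hne]]
  exact ((hd.inv₀ hne).smul hM).congr' e

theorem setLIntegral_gain_sub_le {F F' : ℝ × (En n × En n) → ℝ} (hF : Measurable F)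
    (hF' : Measurable F') (T R : ℝ) (hT : 0 ≤ T) :
    ∫⁻ q in box n T R, ‖gain κ F q - gain κ F' q‖ₑ ≤
      ∫⁻ q in Ioc 0 T ×ˢ Metric.closedBall (0 : En n) (R + T * R),
        ∫⁻ v in Metric.closedBall (0 : En n) R,
          ‖MaxwEOf n κ (fun w => F (q.1, (q.2 - q.1 • w, w))) v -
            MaxwEOf n κ (fun w => F' (q.1, (q.2 - q.1 • w, w))) v‖ₑ := by
  let H : ℝ × (En n × En n) → ENNReal := fun z =>
    ‖MaxwEOf n κ (fun w => F (z.1, (z.2.1 - z.1 • w, w))) z.2.2 -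
      MaxwEOf n κ (fun w => F' (z.1, (z.2.1 - z.1 • w, w))) z.2.2‖ₑ
  have hGm : ∀ {F : ℝ × (En n × En n) → ℝ}, Measurable F →
      Measurable fun z : (ℝ × En n) × En n =>
        MaxwEOf n κ (fun w => F (z.1.1, (z.1.2 - z.1.1 • w, w))) z.2 := fun {F} hF =>
    measurable_MaxwEOf_prodMk (κ := κ)
      (Φ := fun z : (ℝ × En n) × En n => F (z.1.1, (z.1.2 - z.1.1 • z.2, z.2))) (by fun_prop)
  have hH' : Measurable fun z : (ℝ × En n) × En n => H (z.1.1, (z.1.2, z.2)) :=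
    ((hGm hF).sub (hGm hF')).enorm
  have hH : Measurable H := by
    have h2 : Measurable fun z : ℝ × (En n × En n) =>
      (((z.1, z.2.1), z.2.2) : (ℝ × En n) × En n) := by fun_prop
    have := hH'.comp h2
    simp only [Function.comp_def] at this
    exact this
  have hsub : box n T R ⊆ (timeShear : ℝ × (En n × En n) → ℝ × (En n × En n)) ⁻¹'
      (Ioc 0 T ×ˢ (Metric.closedBall 0 (R + T * R) ×ˢ Metric.closedBall 0 R)) := fun q hq => by
    have hq2 := (mem_box.1 hq).2
    rw [mem_closedBall_zero_iff, Prod.norm_def] at hq2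
    have h1 := (le_max_left _ _).trans hq2
    have h2 := (le_max_right _ _).trans hq2
    refine ⟨hq.1, mem_closedBall_zero_iff.2 ?_, mem_closedBall_zero_iff.2 h2⟩
    calc ‖q.2.1 + q.1 • q.2.2‖ ≤ ‖q.2.1‖ + ‖q.1 • q.2.2‖ := norm_add_le _ _
      _ ≤ R + T * R := by
        rw [norm_smul, Real.norm_eq_abs, abs_of_pos hq.1.1]
        exact add_le_add h1 (mul_le_mul hq.1.2 h2 (norm_nonneg _) hT)
  calc ∫⁻ q in box n T R, ‖gain κ F q - gain κ F' q‖ₑ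
      = ∫⁻ q in box n T R, H (timeShear q) := rfl
    _ ≤ _ := lintegral_mono_set hsub
    _ = ∫⁻ z in Ioc 0 T ×ˢ (Metric.closedBall 0 (R + T * R) ×ˢ Metric.closedBall 0 R), H z :=
      measurePreserving_timeShear.setLIntegral_comp_preimage_emb
        timeShear.measurableEmbedding _ _
    _ = _ := by
      rw [Measure.volume_eq_prod ℝ (En n × En n), Measure.volume_eq_prod (En n) (En n),
        ← Measure.prod_restrict, ← Measure.prod_restrict, lintegral_prod _ hH.aemeasurable,
        Measure.volume_eq_prod ℝ (En n), ← Measure.prod_restrict,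
        lintegral_prod _ hH'.lintegral_prod_right'.aemeasurable]
      refine lintegral_congr fun t => ?_
      rw [lintegral_prod _ (by fun_prop)]

theorem abs_MaxwEOf_sub_le (hκ : 0 < κ) (p p' : En n → ℝ) (v : En n) :
    |MaxwEOf n κ p v - MaxwEOf n κ p' v| ≤ cc2e n κ := by
  have a1 := MaxwE_nonneg hκ (densF n p) (bulkF n p) v
  have a2 := MaxwE_nonneg hκ (densF n p') (bulkF n p') v
  have a3 := MaxwE_le hκ (densF n p) (bulkF n p) v
  have a4 := MaxwE_le hκ (densF n p') (bulkF n p') v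
  exact abs_le.2 ⟨by simp only [MaxwEOf]; linarith, by simp only [MaxwEOf]; linarith⟩

theorem integrableOn_closedBall_MaxwEOf_sub (hκ : 0 < κ) (p p' : En n → ℝ) {V : ℝ} :
    IntegrableOn (fun v => MaxwEOf n κ p v - MaxwEOf n κ p' v) (Metric.closedBall 0 V) := by
  have hm : ∀ p : En n → ℝ, Measurable (MaxwEOf n κ p) := fun p => by
    unfold MaxwEOf MaxwE
    exact Measurable.ite (measurableSet_le (by fun_prop) measurable_const) measurable_const
      measurable_const
  exact Measure.integrableOn_of_bounded measure_closedBall_lt_top.ne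
    ((hm p).sub (hm p')).aestronglyMeasurable
    (Eventually.of_forall fun v => abs_MaxwEOf_sub_le hκ p p' v)

theorem ae_eq_gain (hn : 1 ≤ n) (hκ : 0 < κ) (hτ : 0 < τ) {g : ℕ → ℝ × (En n × En n) → ℝ}
    {g' : ℝ × (En n × En n) → ℝ} {E₀ : ENNReal} (hE₀ : E₀ ≠ ⊤)
    (hg : ∀ k, IsSource (cc2e n κ) E₀ (g k)) (hg' : IsSource (cc2e n κ) E₀ g')
    (hw : WeakConv g g') {ε : ℕ → ℝ} (hε : ∀ k, 0 ≤ ε k) (hε0 : Tendsto ε atTop (𝓝 0))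
    {f₀ : En n × En n → ℝ} (hf₀m : Measurable f₀) (hf₀ : ∀ p, 0 ≤ f₀ p)
    (hf₀c : ∀ p, f₀ p ≤ cc2e n κ) (hf₀E : moment f₀ ≤ E₀)
    (hfix : ∀ k q, 0 ≤ q.1 → g k q = gain κ (duhamel τ (ε k) f₀ (g k)) q) :
    ∀ᵐ q ∂volume.restrict (Ioi 0 ×ˢ univ), g' q = gain κ (duhamel τ 0 f₀ g') q := by
  refine ae_restrict_of_forall_box fun N => ?_
  set F : ℕ → ℝ × (En n × En n) → ℝ := fun k => duhamel τ (ε k) f₀ (g k) with hFdef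
  set F' : ℝ × (En n × En n) → ℝ := duhamel τ 0 f₀ g' with hFdef'
  have hFm : ∀ k, Measurable (F k) := fun k => measurable_duhamel hf₀m (hg k).measurable
  have hFm' : Measurable F' := measurable_duhamel hf₀m hg'.measurable
  have hT : (0 : ℝ) ≤ N := N.cast_nonneg
  set K : Set (ℝ × En n) := Ioc 0 (N : ℝ) ×ˢ Metric.closedBall 0 (N + N * N : ℝ) with hK
  have hKf : volume K ≠ ⊤ := by
    rw [hK, Measure.volume_eq_prod, Measure.prod_prod]
    exact ENNReal.mul_ne_top measure_Ioc_lt_top.ne measure_closedBall_lt_top.ne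
  let φ : Option (Fin n) → En n → ℝ := fun i v => i.elim 1 fun j => v j
  have hφm : ∀ i, Measurable (φ i) := fun i => by
    cases i
    · exact measurable_const
    · simp only [φ, Option.elim]; fun_prop
  have hφ : ∀ i v, |φ i v| ≤ 1 + ‖v‖ := fun i v => by
    cases i with
    | none => simp [φ]
    | some j =>
      have := PiLp.norm_apply_le v j
      rw [Real.norm_eq_abs] at this
      simp only [φ, Option.elim]
      linarith
  obtain ⟨σ, hσ, hae⟩ := exists_subseq_ae_tendsto_of_lintegral (μ := volume.restrict K)
    (f := fun i k q => ∫ v, φ i v *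
      (F k (q.1, (q.2 - q.1 • v, v)) - F' (q.1, (q.2 - q.1 • v, v)))) (fun i k => by
        have := hφm i
        have := hFm k
        have hz : Measurable fun z : (ℝ × En n) × En n => φ i z.2 *
            (F k (z.1.1, (z.1.2 - z.1.1 • z.2, z.2)) -
              F' (z.1.1, (z.1.2 - z.1.1 • z.2, z.2))) := by fun_prop
        exact (StronglyMeasurable.integral_prod_right' hz.stronglyMeasurable).measurable)
    fun i => tendsto_setLIntegral_duhamel_average hτ hE₀ hT hg hg' hw hε hε0 hf₀m hf₀ hf₀c hf₀E
      (hφm i) (hφ i)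
  have hprof : ∀ᵐ q ∂volume.restrict K, ∀ k,
      Integrable (fun v => F k (q.1, (q.2 - q.1 • v, v))) ∧
      Integrable (fun v => F k (q.1, (q.2 - q.1 • v, v)) • v) := ae_all_iff.2 fun k =>
    ae_integrable_profile (hFm k) hE₀ (fun t _ p => duhamel_nonneg hτ hf₀ (hg k).nonneg _)
      fun t ht => (hg k).moment_duhamel_le hτ (hε k) hf₀m hf₀ hf₀E ht.1.le
  have hprof' := ae_integrable_profile (X := (N + N * N : ℝ)) hFm' hE₀ (T := N)
    (fun t _ p => duhamel_nonneg hτ hf₀ hg'.nonneg _)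
    fun t ht => hg'.moment_duhamel_le hτ le_rfl hf₀m hf₀ hf₀E ht.1.le
  set J : ℕ → ℝ × En n → ENNReal := fun k q => ∫⁻ v in Metric.closedBall (0 : En n) N,
    ‖MaxwEOf n κ (fun w => F k (q.1, (q.2 - q.1 • w, w))) v -
      MaxwEOf n κ (fun w => F' (q.1, (q.2 - q.1 • w, w))) v‖ₑ with hJ
  have hGm : ∀ {F : ℝ × (En n × En n) → ℝ}, Measurable F →
      Measurable fun z : (ℝ × En n) × En n =>
        MaxwEOf n κ (fun w => F (z.1.1, (z.1.2 - z.1.1 • w, w))) z.2 := fun {F} hF =>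
    measurable_MaxwEOf_prodMk (κ := κ)
      (Φ := fun z : (ℝ × En n) × En n => F (z.1.1, (z.1.2 - z.1.1 • z.2, z.2))) (by fun_prop)
  have hJlim : Tendsto (fun k => ∫⁻ q in K, J (σ k) q) atTop (𝓝 0) := by
    have := tendsto_lintegral_of_dominated_convergence (μ := volume.restrict K)
      (F := fun k => J (σ k)) (f := fun _ => 0)
      (fun _ => ENNReal.ofReal (cc2e n κ) * volume (Metric.closedBall (0 : En n) N))
      (fun k => ((hGm (hFm (σ k))).sub (hGm hFm')).enorm.lintegral_prod_right')
      (fun k => Eventually.of_forall fun q => ?_) ?_ ?_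
    · simpa using this
    · calc J (σ k) q ≤ ∫⁻ v in Metric.closedBall (0 : En n) N, ENNReal.ofReal (cc2e n κ) := by
            refine lintegral_mono fun v => ?_
            rw [Real.enorm_eq_ofReal_abs]
            exact ENNReal.ofReal_le_ofReal (abs_MaxwEOf_sub_le hκ _ _ v)
        _ = _ := setLIntegral_const _ _
    · rw [setLIntegral_const]
      exact ENNReal.mul_ne_top
        (ENNReal.mul_ne_top ENNReal.ofReal_ne_top measure_closedBall_lt_top.ne) hKf
    · filter_upwards [hae, hprof, hprof'] with q h1 h2 h3
      have key := tendsto_setIntegral_MaxwEOf_sub hn hκ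
        (p := fun k v => F (σ k) (q.1, (q.2 - q.1 • v, v)))
        (fun k v => duhamel_nonneg hτ hf₀ (hg (σ k)).nonneg _) (fun k => (h2 (σ k)).1) h3.1
        (fun k => (h2 (σ k)).2) h3.2 (by simpa [φ] using h1 none) (fun i => h1 (some i)) N
      have := ENNReal.tendsto_ofReal key
      rw [ENNReal.ofReal_zero] at this
      refine this.congr fun k => ?_
      exact ofReal_integral_norm_eq_lintegral_enorm (integrableOn_closedBall_MaxwEOf_sub hκ _ _)
  have hint : ∀ {u : ℝ × (En n × En n) → ℝ}, Measurable u → (∀ q, 0 ≤ u q) →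
      (∀ q, u q ≤ cc2e n κ) → IntegrableOn u (box n N N) := fun {u} hm h0 hc =>
    Measure.integrableOn_of_bounded (volume_box_ne_top _ _) hm.aestronglyMeasurable
      (M := cc2e n κ) (Eventually.of_forall fun q => by
        rw [Real.norm_of_nonneg (h0 q)]; exact hc q)
  have hgain := hint (measurable_gain hFm') (gain_nonneg hκ F') (gain_le hκ F')
  have hL1 : Tendsto (fun k => ∫⁻ q in box n N N, ‖g (σ k) q - gain κ F' q‖ₑ) atTop (𝓝 0) := by
    refine tendsto_of_tendsto_of_tendsto_of_le_of_le tendsto_const_nhds hJlim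
      (fun k => zero_le) fun k => ?_
    refine le_trans (le_of_eq ?_) (setLIntegral_gain_sub_le (hFm (σ k)) hFm' N N hT)
    refine setLIntegral_congr_fun (measurableSet_box _ _) fun q hq => ?_
    rw [hfix (σ k) q (mem_box.1 hq).1.1.le]
  refine Integrable.ae_eq_of_forall_setIntegral_eq _ _
    (hint hg'.measurable hg'.nonneg hg'.le) hgain fun s hs _ => ?_
  have t1 := tendsto_setIntegral_of_L1 (gain κ F') hgain.aestronglyMeasurable
    (Eventually.of_forall fun k =>
      hint (hg (σ k)).measurable (hg (σ k)).nonneg (hg (σ k)).le) hL1 s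
  have t2 := (hw N N 1 ((s ∩ box n N N).indicator 1)
    (measurable_one.indicator (hs.inter (measurableSet_box _ _)))
    (fun q => by by_cases hq : q ∈ s ∩ box n N N <;> simp [hq])
    (fun q hq => by
      by_contra hcon
      exact hq (indicator_of_notMem (fun h => hcon h.2) _))).comp hσ.tendsto_atTop
  have e : ∀ u : ℝ × (En n × En n) → ℝ, ∫ q, (s ∩ box n N N).indicator 1 q * u q =
      ∫ q in s, u q ∂volume.restrict (box n N N) := fun u => by
    rw [Measure.restrict_restrict hs, ← integral_indicator (hs.inter (measurableSet_box _ _))]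
    refine integral_congr_ae (Eventually.of_forall fun q => ?_)
    by_cases hq : q ∈ s ∩ box n N N
    · simp only [indicator_of_mem hq, Pi.one_apply, one_mul]
    · simp only [indicator_of_notMem hq, zero_mul]
  simp only [Function.comp_def, e] at t2
  exact tendsto_nhds_unique t2 t1

end LimitEquation

section MildSolution

variable {n : ℕ} {κ τ : ℝ}

theorem exists_source (hn : 1 ≤ n) (hκ : 0 < κ) (hτ : 0 < τ) {f₀ : En n × En n → ℝ}
    (hf₀m : Measurable f₀) (hf₀ : ∀ p, 0 ≤ f₀ p) (hf₀c : ∀ p, f₀ p ≤ cc2e n κ)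
    (hE₀ : moment f₀ ≠ ⊤) :
    ∃ g, IsSource (cc2e n κ) (moment f₀) g ∧
      ∀ᵐ q ∂volume.restrict (Ioi 0 ×ˢ univ), g q = gain κ (duhamel τ 0 f₀ g) q := by
  have hε : ∀ k : ℕ, (0 : ℝ) < 1 / ((k : ℝ) + 1) := fun k => Nat.one_div_pos_of_nat
  choose g hgm hg0 hgc hgE hfix using fun k =>
    exists_delayed_solution hn hκ hτ (hε k) hf₀m hf₀ hf₀c
  obtain ⟨φ, hφ, g', hgm', hg0', hgc', hgE', hw⟩ := exists_weak_limit hE₀ hgm hg0 hgc hgE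
  have hg : ∀ k, IsSource (cc2e n κ) (moment f₀) (g k) := fun k =>
    ⟨hgm k, hg0 k, hgc k, (ae_restrict_mem measurableSet_Ioi).mono fun t ht =>
      hgE k t (le_of_lt ht)⟩
  have hg' : IsSource (cc2e n κ) (moment f₀) g' := ⟨hgm', hg0', hgc', hgE'⟩
  exact ⟨g', hg', ae_eq_gain hn hκ hτ hE₀ (fun k => hg (φ k)) hg' hw (fun k => (hε (φ k)).le)
    (tendsto_one_div_add_atTop_nhds_zero_nat.comp hφ.tendsto_atTop) hf₀m hf₀ hf₀c le_rfl
    fun k => hfix (φ k)⟩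

theorem integrable_moment {h : En n × En n → ℝ} (hm : Measurable h) (h0 : ∀ p, 0 ≤ h p)
    (hE : moment h ≠ ⊤) : Integrable fun p : En n × En n => (1 + ‖p.2‖ ^ 2) * h p := by
  refine ⟨(by fun_prop : Measurable _).aestronglyMeasurable, ?_⟩
  rw [hasFiniteIntegral_iff_ofReal (Eventually.of_forall fun v =>
    mul_nonneg (by positivity) (h0 v))]
  exact hE.lt_top

theorem integral_moment {h : En n × En n → ℝ} (hm : Measurable h) (h0 : ∀ p, 0 ≤ h p) :
    ∫ p : En n × En n, (1 + ‖p.2‖ ^ 2) * h p = (moment h).toReal :=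
  integral_eq_lintegral_of_nonneg_ae (Eventually.of_forall fun p =>
    mul_nonneg (by positivity) (h0 p)) (by fun_prop : Measurable _).aestronglyMeasurable

theorem integrable_energy {h : En n × En n → ℝ} (hm : Measurable h) (h0 : ∀ p, 0 ≤ h p)
    (hE : moment h ≠ ⊤) : Integrable fun p : En n × En n => ‖p.2‖ ^ 2 * h p := by
  refine (integrable_moment hm h0 hE).mono' (by fun_prop : Measurable _).aestronglyMeasurable
    (Eventually.of_forall fun p => ?_)
  rw [Real.norm_of_nonneg (mul_nonneg (by positivity) (h0 p))]
  exact mul_le_mul_of_nonneg_right (by linarith) (h0 p)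

theorem integral_energy_le {h : En n × En n → ℝ} (hm : Measurable h) (h0 : ∀ p, 0 ≤ h p)
    {E : ENNReal} (hE : E ≠ ⊤) (hle : moment h ≤ E) :
    ∫ p : En n × En n, ‖p.2‖ ^ 2 * h p ≤ E.toReal := by
  have hf := ne_top_of_le_ne_top hE hle
  refine le_trans ?_ (ENNReal.toReal_mono hE hle)
  rw [← integral_moment hm h0]
  exact integral_mono (integrable_energy hm h0 hf) (integrable_moment hm h0 hf)
    fun p => mul_le_mul_of_nonneg_right (by linarith) (h0 p)

theorem moment_comp_shear_symm {h : En n × En n → ℝ} (hm : Measurable h) (t : ℝ) :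
    moment (fun p => h (p.1 - t • p.2, p.2)) = moment h :=
  (measurePreserving_shear t).symm.lintegral_comp (f := fun p : En n × En n =>
    ENNReal.ofReal ((1 + ‖p.2‖ ^ 2) * h p)) (by fun_prop)

theorem integral_energy_comp_shear_symm (h : En n × En n → ℝ) (t : ℝ) :
    ∫ p : En n × En n, ‖p.2‖ ^ 2 * h (p.1 - t • p.2, p.2) = ∫ p : En n × En n, ‖p.2‖ ^ 2 * h p :=
  (measurePreserving_shear t).symm.integral_comp' (g := fun p : En n × En n => ‖p.2‖ ^ 2 * h p)

theorem integral_energy_duhamel (hτ : 0 < τ) {c : ℝ} {E₀ : ENNReal} (hE₀ : E₀ ≠ ⊤)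
    {f₀ : En n × En n → ℝ} {g : ℝ × (En n × En n) → ℝ} (hg : IsSource c E₀ g)
    (hf₀m : Measurable f₀) (hf₀ : ∀ p, 0 ≤ f₀ p) (hf₀E : moment f₀ ≤ E₀) (t : ℝ) :
    ∫ p : En n × En n, ‖p.2‖ ^ 2 * duhamel τ 0 f₀ g (t, p) =
      Real.exp (-t / τ) * (∫ p : En n × En n, ‖p.2‖ ^ 2 * f₀ p) +
      (1 / τ) * ∫ s in Ioc 0 t, Real.exp (-(t - s) / τ) *
        ∫ p : En n × En n, ‖p.2‖ ^ 2 * g (s, p) := by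
  have hgm := hg.measurable
  have hint : Integrable (fun z : ℝ × (En n × En n) =>
      Real.exp (-(t - z.1) / τ) * (‖z.2.2‖ ^ 2 * g z))
      ((volume.restrict (Ioc 0 t)).prod volume) := by
    refine ⟨(by fun_prop : Measurable _).aestronglyMeasurable, ?_⟩
    rw [hasFiniteIntegral_iff_ofReal (Eventually.of_forall fun z =>
      mul_nonneg (Real.exp_pos _).le (mul_nonneg (by positivity) (hg.nonneg z))),
      lintegral_prod _ (by fun_prop)]
    refine lt_of_le_of_lt (b := ∫⁻ s in Ioc 0 t, E₀) (lintegral_mono_ae ?_) ?_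
    · filter_upwards [ae_mono (Measure.restrict_mono Ioc_subset_Ioi_self le_rfl) hg.moment_le,
        ae_restrict_mem measurableSet_Ioc] with s hs hst
      refine le_trans (lintegral_mono fun p => ENNReal.ofReal_le_ofReal ?_) hs
      have h1 : Real.exp (-(t - s) / τ) ≤ 1 := by
        rw [Real.exp_le_one_iff]
        exact div_nonpos_of_nonpos_of_nonneg (by linarith [hst.2]) hτ.le
      rw [← mul_assoc]
      refine mul_le_mul_of_nonneg_right ?_ (hg.nonneg _)
      nlinarith [sq_nonneg ‖p.2‖]
    · rw [setLIntegral_const]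
      exact ENNReal.mul_lt_top hE₀.lt_top measure_Ioc_lt_top
  have e1 : ∀ p : En n × En n, ‖p.2‖ ^ 2 * duhamel τ 0 f₀ g (t, p) =
      Real.exp (-t / τ) * (‖p.2‖ ^ 2 * f₀ p) + (1 / τ) * ∫ s in Ioc 0 t,
        Real.exp (-(t - s) / τ) * (‖p.2‖ ^ 2 * g (s, p)) := fun p => by
    have : ∫ s in Ioc 0 t, Real.exp (-(t - s) / τ) * (‖p.2‖ ^ 2 * g (s, p)) =
        ‖p.2‖ ^ 2 * ∫ s in Ioc 0 t, Real.exp (-(t - s) / τ) * g (s, p) := by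
      rw [← integral_const_mul (‖p.2‖ ^ 2)]
      refine integral_congr_ae (Eventually.of_forall fun s => ?_)
      ring
    rw [this]
    simp only [duhamel, sub_zero]
    ring
  simp only [e1]
  rw [integral_add ((integrable_energy hf₀m hf₀ (ne_top_of_le_ne_top hE₀ hf₀E)).const_mul _)
    (hint.integral_prod_right.const_mul _), integral_const_mul (Real.exp (-t / τ)),
    integral_const_mul (1 / τ), ← integral_integral_swap (f := fun (s : ℝ) (p : En n × En n) =>
      Real.exp (-(t - s) / τ) * (‖p.2‖ ^ 2 * g (s, p))) hint]
  simp only [integral_const_mul]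

theorem relaxation_identity (hτ : 0 < τ) {y G : ℝ → ℝ} {y₀ t : ℝ} (ht : 0 ≤ t)
    (hG : IntegrableOn G (Ioc 0 t))
    (hy : ∀ s ∈ Icc 0 t, y s = Real.exp (-s / τ) * y₀ +
      (1 / τ) * ∫ r in Ioc 0 s, Real.exp (-(s - r) / τ) * G r) :
    IntegrableOn y (Ioc 0 t) ∧ y t + (1 / τ) * ∫ s in Ioc 0 t, (y s - G s) = y₀ := by
  let μ : Measure ℝ := volume.restrict (Ioc 0 t)
  let k : ℝ → ℝ → ℝ := fun s r => (Iio s).indicator (fun r => Real.exp (-(s - r) / τ) * G r) r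
  have hkm : AEStronglyMeasurable (Function.uncurry k) (μ.prod μ) := by
    have : Function.uncurry k = {z : ℝ × ℝ | z.2 < z.1}.indicator
        fun z => Real.exp (-(z.1 - z.2) / τ) * G z.2 := by
      ext z
      simp [k, Function.uncurry, indicator_apply]
    rw [this]
    refine AEStronglyMeasurable.indicator ?_ (measurableSet_lt measurable_snd measurable_fst)
    exact (by fun_prop : Measurable fun z : ℝ × ℝ =>
      Real.exp (-(z.1 - z.2) / τ)).aestronglyMeasurable.mul hG.aestronglyMeasurable.comp_snd
  have hk : Integrable (Function.uncurry k) (μ.prod μ) := by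
    refine (Integrable.comp_snd hG μ).norm.mono' hkm (Eventually.of_forall fun z => ?_)
    simp only [Function.uncurry, k]
    by_cases hz : z.2 ∈ Iio z.1
    · rw [indicator_of_mem hz, norm_mul, Real.norm_of_nonneg (Real.exp_pos _).le]
      refine mul_le_of_le_one_left (norm_nonneg _) ?_
      rw [Real.exp_le_one_iff]
      exact div_nonpos_of_nonpos_of_nonneg (by linarith [mem_Iio.1 hz]) hτ.le
    · rw [indicator_of_notMem hz, norm_zero]
      exact norm_nonneg _
  have hinner : ∀ s ∈ Ioc 0 t, ∫ r, k s r ∂μ =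
      ∫ r in Ioc 0 s, Real.exp (-(s - r) / τ) * G r := fun s hs => by
    simp only [k, μ]
    rw [integral_indicator measurableSet_Iio, Measure.restrict_restrict measurableSet_Iio]
    refine setIntegral_congr_set ?_
    have : Iio s ∩ Ioc 0 t = Ioo 0 s := by
      ext r; simp only [mem_inter_iff, mem_Iio, mem_Ioc, mem_Ioo]
      exact ⟨fun h => ⟨h.2.1, h.1⟩, fun h => ⟨h.2, h.1, h.2.le.trans hs.2⟩⟩
    rw [this]
    exact Ioo_ae_eq_Ioc
  have hexp : ∀ a b : ℝ, a ≤ b → ∫ s in Ioc a b, Real.exp (-(s - a) / τ) =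
      τ * (1 - Real.exp (-(b - a) / τ)) := fun a b hab => by
    rw [← intervalIntegral.integral_of_le hab]
    have hd : ∀ s ∈ uIcc a b, HasDerivAt (fun s => -τ * Real.exp (-(s - a) / τ))
        (Real.exp (-(s - a) / τ)) s := fun s _ => by
      have h1 : HasDerivAt (fun s => -(s - a) / τ) (-1 / τ) s :=
        (((hasDerivAt_id s).sub_const a).neg).div_const τ
      refine (h1.exp.const_mul (-τ)).congr_deriv ?_
      field_simp
    rw [intervalIntegral.integral_eq_sub_of_hasDerivAt hd
      ((by fun_prop : Continuous fun s => Real.exp (-(s - a) / τ)).intervalIntegrable a b)]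
    simp only [sub_self, neg_zero, zero_div, Real.exp_zero]
    ring
  have houter : ∀ r ∈ Ioc 0 t, ∫ s, k s r ∂μ =
      τ * (1 - Real.exp (-(t - r) / τ)) * G r := fun r hr => by
    have e : ∀ s, k s r = (Ioi r).indicator (fun s => Real.exp (-(s - r) / τ) * G r) s :=
      fun s => by simp [k, indicator_apply]
    simp only [e, μ]
    rw [integral_indicator measurableSet_Ioi, Measure.restrict_restrict measurableSet_Ioi]
    have : Ioi r ∩ Ioc 0 t = Ioc r t := by
      ext s; simp only [mem_inter_iff, mem_Ioi, mem_Ioc]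
      exact ⟨fun h => ⟨h.1, h.2.2⟩, fun h => ⟨h.1, hr.1.trans h.1, h.2⟩⟩
    rw [this, integral_mul_const, hexp r t hr.2]
  have hGe : IntegrableOn (fun r => Real.exp (-(t - r) / τ) * G r) (Ioc 0 t) := by
    refine hG.norm.mono' ((by fun_prop : Measurable fun r =>
      Real.exp (-(t - r) / τ)).aestronglyMeasurable.mul hG.aestronglyMeasurable) ?_
    filter_upwards [ae_restrict_mem measurableSet_Ioc] with r hr
    rw [norm_mul, Real.norm_of_nonneg (Real.exp_pos _).le]
    refine mul_le_of_le_one_left (norm_nonneg _) ?_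
    rw [Real.exp_le_one_iff]
    exact div_nonpos_of_nonpos_of_nonneg (by linarith [hr.2]) hτ.le
  have hyk : ∀ s ∈ Ioc 0 t, y s = Real.exp (-s / τ) * y₀ + (1 / τ) * ∫ r, k s r ∂μ :=
    fun s hs => by rw [hinner s hs, hy s ⟨hs.1.le, hs.2⟩]
  have hexpi : IntegrableOn (fun s => Real.exp (-s / τ) * y₀) (Ioc 0 t) :=
    (by fun_prop : Continuous fun s => Real.exp (-s / τ) * y₀).integrableOn_Ioc
  have hki : IntegrableOn (fun s => (1 / τ) * ∫ r, k s r ∂μ) (Ioc 0 t) :=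
    hk.integral_prod_left.const_mul _
  have hyi : IntegrableOn y (Ioc 0 t) :=
    (integrableOn_congr_fun hyk measurableSet_Ioc).2 (hexpi.add hki)
  refine ⟨hyi, ?_⟩
  have hyint : ∫ s in Ioc 0 t, y s = τ * (1 - Real.exp (-t / τ)) * y₀ +
      ((∫ r in Ioc 0 t, G r) - ∫ r in Ioc 0 t, Real.exp (-(t - r) / τ) * G r) := by
    rw [setIntegral_congr_fun measurableSet_Ioc hyk, integral_add hexpi hki, integral_mul_const,
      integral_const_mul (1 / τ)]
    have e0 := hexp 0 t ht
    simp only [sub_zero] at e0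
    rw [e0]
    congr 1
    change 1 / τ * ∫ s, ∫ r, k s r ∂μ ∂μ = _
    rw [integral_integral_swap hk, setIntegral_congr_fun measurableSet_Ioc houter,
      ← integral_sub hG hGe, ← integral_const_mul (1 / τ)]
    refine integral_congr_ae (Eventually.of_forall fun r => ?_)
    field_simp
  rw [integral_sub hyi hG, hyint, hy t ⟨ht, le_rfl⟩]
  field_simp
  ring

theorem ae_ae_eq_gain {g F : ℝ × (En n × En n) → ℝ} (h : ∀ᵐ q ∂volume.restrict
    ((Ioi 0 : Set ℝ) ×ˢ (univ : Set (En n × En n))), g q = gain κ F q) :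
    ∀ᵐ s ∂volume.restrict (Ioi (0 : ℝ)), ∀ᵐ p : En n × En n, g (s, p) = gain κ F (s, p) := by
  rw [Measure.volume_eq_prod ℝ (En n × En n), ← Measure.prod_restrict, Measure.restrict_univ] at h
  exact Measure.ae_ae_of_ae_prod h

theorem ae_ae_swap_eq_gain {g F : ℝ × (En n × En n) → ℝ} (hg : Measurable g) (hF : Measurable F)
    (h : ∀ᵐ q ∂volume.restrict ((Ioi 0 : Set ℝ) ×ˢ (univ : Set (En n × En n))),
      g q = gain κ F q) :
    ∀ᵐ p : En n × En n, ∀ᵐ s ∂volume.restrict (Ioi (0 : ℝ)), g (s, p) = gain κ F (s, p) :=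
  (Measure.ae_ae_comm (p := fun s p => g (s, p) = gain κ F (s, p))
    (measurableSet_eq_fun hg (measurable_gain hF))).1 (ae_ae_eq_gain h)

theorem gain_shear_symm (F : ℝ × (En n × En n) → ℝ) (s t : ℝ) (p : En n × En n) :
    gain κ F (s, (p.1 - t • p.2, p.2)) =
      MaxwEOf n κ (fun w => F (s, (p.1 - (t - s) • p.2 - s • w, w))) p.2 := by
  have e : p.1 - t • p.2 + s • p.2 = p.1 - (t - s) • p.2 := by rw [sub_smul]; abel
  simp only [gain, e]

theorem mild_form {f₀ : En n × En n → ℝ} {g : ℝ × (En n × En n) → ℝ} (hf₀m : Measurable f₀)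
    (hgm : Measurable g) (hg : ∀ᵐ q ∂volume.restrict ((Ioi 0 : Set ℝ) ×ˢ univ),
      g q = gain κ (duhamel τ 0 f₀ g) q) {t : ℝ} (ht : 0 ≤ t) :
    ∀ᵐ p : En n × En n, duhamel τ 0 f₀ g (t, (p.1 - t • p.2, p.2)) =
      Real.exp (-t / τ) * f₀ (p.1 - t • p.2, p.2) +
        (1 / τ) * ∫ s in (0 : ℝ)..t, Real.exp (-(t - s) / τ) * MaxwEOf n κ (fun w =>
          if 0 ≤ s then duhamel τ 0 f₀ g (s, (p.1 - (t - s) • p.2 - s • w, w)) else 0) p.2 := by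
  have h := (measurePreserving_shear (E := En n) t).symm.quasiMeasurePreserving.ae
    (ae_ae_swap_eq_gain hgm (measurable_duhamel hf₀m hgm) hg)
  filter_upwards [h] with p hp
  rw [intervalIntegral.integral_of_le ht]
  simp only [duhamel, sub_zero]
  congr 2
  refine integral_congr_ae ?_
  filter_upwards [ae_mono (Measure.restrict_mono Ioc_subset_Ioi_self le_rfl) hp,
    ae_restrict_mem measurableSet_Ioc] with s hs hst
  rw [shear_symm_apply, gain_shear_symm] at hs
  rw [hs]
  simp only [if_pos hst.1.le, duhamel, sub_zero]

theorem entropy_identity (hn : 1 ≤ n) (hκ : 0 < κ) (hτ : 0 < τ) {f₀ : En n × En n → ℝ}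
    {g : ℝ × (En n × En n) → ℝ} (hf₀m : Measurable f₀) (hf₀ : ∀ p, 0 ≤ f₀ p)
    (hf₀c : ∀ p, f₀ p ≤ cc2e n κ) (hE₀ : moment f₀ ≠ ⊤)
    (hgs : IsSource (cc2e n κ) (moment f₀) g)
    (hg : ∀ᵐ q ∂volume.restrict ((Ioi 0 : Set ℝ) ×ˢ univ),
      g q = gain κ (duhamel τ 0 f₀ g) q) {t : ℝ} (ht : 0 ≤ t) :
    (∫ p : En n × En n, kinEntE n (duhamel τ 0 f₀ g (t, (p.1 - t • p.2, p.2))) p.2) +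
      (1 / τ) * ∫ s in Ioc 0 t, ∫ p : En n × En n,
        (kinEntE n (duhamel τ 0 f₀ g (s, (p.1 - s • p.2, p.2))) p.2 -
          kinEntE n (MaxwEOf n κ (fun w => duhamel τ 0 f₀ g (s, (p.1 - s • w, w))) p.2) p.2) =
      ∫ p : En n × En n, kinEntE n (f₀ p) p.2 := by
  have hgm := hgs.measurable
  set F := duhamel τ 0 f₀ g with hF
  have hFm : Measurable F := measurable_duhamel hf₀m hgm
  have hF0 : ∀ q, 0 ≤ F q := duhamel_nonneg hτ hf₀ hgs.nonneg
  have hFE : ∀ s, 0 ≤ s → moment (fun p => F (s, p)) ≤ moment f₀ := fun s hs =>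
    hgs.moment_duhamel_le hτ le_rfl hf₀m hf₀ le_rfl hs
  let y : ℝ → ℝ := fun s => ∫ p : En n × En n, ‖p.2‖ ^ 2 * F (s, p)
  let G : ℝ → ℝ := fun s => ∫ p : En n × En n, ‖p.2‖ ^ 2 * g (s, p)
  have hGm : StronglyMeasurable G :=
    StronglyMeasurable.integral_prod_right' (ν := (volume : Measure (En n × En n)))
      (f := fun q : ℝ × (En n × En n) => ‖q.2.2‖ ^ 2 * g q)
      (by fun_prop : Measurable _).stronglyMeasurable
  have hgE : ∀ᵐ s ∂volume.restrict (Ioc 0 t), moment (fun p => g (s, p)) ≤ moment f₀ :=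
    ae_mono (Measure.restrict_mono Ioc_subset_Ioi_self le_rfl) hgs.moment_le
  have hG : IntegrableOn G (Ioc 0 t) := by
    refine Measure.integrableOn_of_bounded (M := (moment f₀).toReal) measure_Ioc_lt_top.ne
      hGm.aestronglyMeasurable ?_
    filter_upwards [hgE] with s hs
    rw [Real.norm_of_nonneg (integral_nonneg fun p => mul_nonneg (by positivity) (hgs.nonneg _))]
    exact integral_energy_le (by fun_prop) (fun p => hgs.nonneg _) hE₀ hs
  have key := (relaxation_identity (y := y) hτ ht hG fun s _ =>
    integral_energy_duhamel hτ hE₀ hgs hf₀m hf₀ le_rfl s).2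
  have hkin : ∀ h : En n × En n → ℝ, ∫ p : En n × En n, kinEntE n (h p) p.2 =
      (∫ p : En n × En n, ‖p.2‖ ^ 2 * h p) / 2 := fun h => by
    simp only [kinEntE]
    rw [integral_div]
  have hrel : ∀ᵐ s ∂volume.restrict (Ioc 0 t), (∫ p : En n × En n,
      (kinEntE n (F (s, (p.1 - s • p.2, p.2))) p.2 -
        kinEntE n (MaxwEOf n κ (fun w => F (s, (p.1 - s • w, w))) p.2) p.2)) =
      (y s - G s) / 2 := by
    filter_upwards [ae_mono (Measure.restrict_mono Ioc_subset_Ioi_self le_rfl) (ae_ae_eq_gain hg),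
      ae_restrict_mem measurableSet_Ioc] with s hs hst
    have hgain : ∀ p : En n × En n, MaxwEOf n κ (fun w => F (s, (p.1 - s • w, w))) p.2 =
        gain κ F (s, (p.1 - s • p.2, p.2)) := fun p => by
      rw [gain_shear_symm]; simp only [sub_self, zero_smul, sub_zero]
    have hGs : ∫ p : En n × En n, ‖p.2‖ ^ 2 * gain κ F (s, p) = G s := by
      refine integral_congr_ae ?_
      filter_upwards [hs] with p hp
      rw [hp]
    have hgnm : Measurable (gain κ F) := measurable_gain hFm
    have hFs := ne_top_of_le_ne_top hE₀ (hFE s hst.1.le)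
    have i1 : Integrable fun p : En n × En n => ‖p.2‖ ^ 2 * F (s, (p.1 - s • p.2, p.2)) :=
      integrable_energy (h := fun p => F (s, (p.1 - s • p.2, p.2))) (by fun_prop)
        (fun p => hF0 _)
        (by rw [moment_comp_shear_symm (h := fun p => F (s, p)) (by fun_prop)]; exact hFs)
    have i2 : Integrable fun p : En n × En n =>
        ‖p.2‖ ^ 2 * gain κ F (s, (p.1 - s • p.2, p.2)) :=
      integrable_energy (h := fun p => gain κ F (s, (p.1 - s • p.2, p.2))) (by fun_prop)
        (fun p => gain_nonneg hκ _ _) (by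
          rw [moment_comp_shear_symm (h := fun p => gain κ F (s, p)) (by fun_prop)]
          exact ne_top_of_le_ne_top hFs (moment_gain_le hn hκ hFm (fun p => hF0 _) fun p =>
            duhamel_le hτ le_rfl hgm hf₀c hgs.nonneg hgs.le hst.1.le))
    simp only [hgain, kinEntE]
    rw [integral_sub (i1.div_const 2) (i2.div_const 2), integral_div, integral_div,
      integral_energy_comp_shear_symm (fun p => F (s, p)),
      integral_energy_comp_shear_symm (fun p => gain κ F (s, p)), hGs]
    ring
  rw [hkin, hkin f₀, integral_energy_comp_shear_symm (fun p => F (t, p)), integral_congr_ae hrel,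
    integral_div, ← key]
  ring

end MildSolution

/-- Global existence of mild entropy solutions to the BGK model in the
end-point case `γ = (n+2)/n` with finite kinetic entropy initial data `f₀ ≤ c₂`. -/
theorem stmt1 (n : ℕ) (hn : 1 ≤ n) (κ τ : ℝ) (hκ : 0 < κ) (hτ : 0 < τ)
    (f₀ : En n × En n → ℝ) (hf₀meas : Measurable f₀)
    (hf₀nonneg : ∀ p, 0 ≤ f₀ p) (hf₀bdd : ∀ p, f₀ p ≤ cc2e n κ)
    (hf₀int : Integrable (fun p : En n × En n => (1 + ‖p.2‖ ^ 2) * f₀ p)) :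
    ∃ f : ℝ → En n × En n → ℝ,
      Measurable (Function.uncurry f) ∧
      (∀ t p, 0 ≤ f t p) ∧ (∀ t p, f t p ≤ cc2e n κ) ∧
      (∃ C : ℝ, ∀ t : ℝ, 0 ≤ t →
        Integrable (fun p : En n × En n => (1 + ‖p.2‖ ^ 2) * f t p) ∧
        (∫ p : En n × En n, (1 + ‖p.2‖ ^ 2) * f t p) ≤ C) ∧
      -- (i) mild form
      (∀ t : ℝ, 0 ≤ t → ∀ᵐ p : En n × En n,
        f t p = Real.exp (-t / τ) * f₀ (p.1 - t • p.2, p.2) +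
          (1 / τ) * ∫ s in (0:ℝ)..t,
            Real.exp (-(t - s) / τ) *
              MaxwEOf n κ (fun w => f s (p.1 - (t - s) • p.2, w)) p.2) ∧
      -- (ii) kinetic entropy inequality
      (∀ t : ℝ, 0 ≤ t →
        (∫ p : En n × En n, kinEntE n (f t p) p.2) +
          (1 / τ) * ∫ s in (0:ℝ)..t, ∫ p : En n × En n,
            (kinEntE n (f s p) p.2 -
              kinEntE n (MaxwEOf n κ (fun w => f s (p.1, w)) p.2) p.2)
        ≤ ∫ p : En n × En n, kinEntE n (f₀ p) p.2) := by
  have hE₀ : moment f₀ ≠ ⊤ := by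
    have h := hf₀int.hasFiniteIntegral
    rw [hasFiniteIntegral_iff_ofReal (Eventually.of_forall fun p =>
      mul_nonneg (by positivity) (hf₀nonneg p))] at h
    exact h.ne
  obtain ⟨g, hgs, hg⟩ := exists_source hn hκ hτ hf₀meas hf₀nonneg hf₀bdd hE₀
  have hgm := hgs.measurable
  have hFm : Measurable (duhamel τ 0 f₀ g) := measurable_duhamel hf₀meas hgm
  let f : ℝ → En n × En n → ℝ := fun t p =>
    if 0 ≤ t then duhamel τ 0 f₀ g (t, (p.1 - t • p.2, p.2)) else 0
  have hfpos : ∀ {t : ℝ}, 0 ≤ t → ∀ p, f t p = duhamel τ 0 f₀ g (t, (p.1 - t • p.2, p.2)) :=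
    fun ht p => if_pos ht
  have hfE : ∀ t : ℝ, 0 ≤ t → moment (f t) ≤ moment f₀ := fun t ht => by
    rw [funext (hfpos ht),
      moment_comp_shear_symm (h := fun p => duhamel τ 0 f₀ g (t, p)) (by fun_prop)]
    exact hgs.moment_duhamel_le hτ le_rfl hf₀meas hf₀nonneg le_rfl ht
  have hfm : Measurable (Function.uncurry f) :=
    Measurable.ite (measurableSet_le measurable_const measurable_fst)
      (hFm.comp (by fun_prop : Measurable fun q : ℝ × (En n × En n) =>
        (q.1, (q.2.1 - q.1 • q.2.2, q.2.2)))) measurable_const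
  have hfm' : ∀ t, Measurable (f t) := fun t => hfm.comp measurable_prodMk_left
  have hf0 : ∀ t p, 0 ≤ f t p := fun t p => by
    by_cases ht : 0 ≤ t
    · rw [hfpos ht]; exact duhamel_nonneg hτ hf₀nonneg hgs.nonneg _
    · exact (if_neg ht).ge
  refine ⟨f, hfm, hf0, fun t p => ?_, ⟨(moment f₀).toReal, fun t ht => ?_⟩, fun t ht => ?_,
    fun t ht => ?_⟩
  · by_cases ht : 0 ≤ t
    · rw [hfpos ht]; exact duhamel_le hτ le_rfl hgm hf₀bdd hgs.nonneg hgs.le ht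
    · exact (if_neg ht).trans_le (cc2e_pos hκ).le
  · refine ⟨integrable_moment (hfm' t) (hf0 t) (ne_top_of_le_ne_top hE₀ (hfE t ht)), ?_⟩
    rw [integral_moment (hfm' t) (hf0 t)]
    exact ENNReal.toReal_mono hE₀ (hfE t ht)
  · filter_upwards [mild_form hf₀meas hgm hg ht] with p hp
    rw [hfpos ht, hp]
  · rw [intervalIntegral.integral_of_le ht,
      ← entropy_identity hn hκ hτ hf₀meas hf₀nonneg hf₀bdd hE₀ hgs hg ht]
    simp only [hfpos ht]
    refine le_of_eq ?_
    congr 2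
    refine setIntegral_congr_fun measurableSet_Ioc fun s hs => ?_
    simp only [hfpos hs.1.le]
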